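/- Let d ≥ 2, max{d−2,0} < α < d, m > d/2 + 2, and let (h,u) be the global solution from the small-data global well-posedness theorem for the pressureless damped Euler–Riesz system on the torus 𝕋^d. Then there exist positive constants C and λ independent of t such that ‖(h,u)(·,t)‖_{X^m} ≤ C e^{−λ t} for all t ≥ 0. -/

import Mathlib

noncomputable section

open MeasureTheory Real Filter
open scoped FourierTransform Topology RealInnerProductSpace BigOperators ENNReal

abbrev Rd (d : ℕ) := EuclideanSpace ℝ (Fin d)

variable {d : ℕ}

/-- fundamental domain of the unit torus -/
def TdFund (d : ℕ) : Set (Rd d) := {x | ∀ i, 0 ≤ x i ∧ x i < 1}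

def Per (f : Rd d → ℝ) : Prop :=
  ∀ (x : Rd d) (i : Fin d), f (x + EuclideanSpace.single i 1) = f x

def PerV (u : Rd d → Rd d) : Prop :=
  ∀ (x : Rd d) (i : Fin d), u (x + EuclideanSpace.single i 1) = u x

def zNorm (n : Fin d → ℤ) : ℝ := Real.sqrt (∑ i, ((n i : ℝ)) ^ 2)

def eTheta (θ : ℝ) : ℂ := Complex.exp (2 * Real.pi * Complex.I * θ)

/-- Fourier coefficient of a (periodic) function on the torus -/
def fCoef (f : Rd d → ℝ) (n : Fin d → ℤ) : ℂ :=
  ∫ x in TdFund d, (f x : ℂ) * eTheta (-(∑ i, (n i : ℝ) * x i))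

/-- fractional Laplacian on the torus via Fourier multipliers `|n|^s` -/
def tFracLap (s : ℝ) (f : Rd d → ℝ) : Rd d → ℝ :=
  fun x => (∑' n : Fin d → ℤ,
    (zNorm n ^ s : ℝ) • (fCoef f n * eTheta (∑ i, (n i : ℝ) * x i))).re

def tHSobSq (s : ℝ) (f : Rd d → ℝ) : ℝ :=
  ∑' n : Fin d → ℤ, zNorm n ^ (2 * s) * ‖fCoef f n‖ ^ 2
def tHSob (s : ℝ) (f : Rd d → ℝ) : ℝ := Real.sqrt (tHSobSq s f)
def tSobSq (s : ℝ) (f : Rd d → ℝ) : ℝ :=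
  ∑' n : Fin d → ℤ, (1 + zNorm n ^ 2) ^ s * ‖fCoef f n‖ ^ 2
def tSob (s : ℝ) (f : Rd d → ℝ) : ℝ := Real.sqrt (tSobSq s f)

def tMemHSob (s : ℝ) (f : Rd d → ℝ) : Prop :=
  Summable (fun n : Fin d → ℤ => zNorm n ^ (2 * s) * ‖fCoef f n‖ ^ 2)
def tMemSob (s : ℝ) (f : Rd d → ℝ) : Prop :=
  Summable (fun n : Fin d → ℤ => (1 + zNorm n ^ 2) ^ s * ‖fCoef f n‖ ^ 2)

def tXnormSq (α m : ℝ) (h : Rd d → ℝ) (u : Rd d → Rd d) : ℝ :=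
  tSobSq m h + (∑ i, tSobSq (m + ((d : ℝ) - α) / 2) (fun x => u x i))
    + tHSobSq (-(((d : ℝ) - α) / 2)) h

def tXnorm (α m : ℝ) (h : Rd d → ℝ) (u : Rd d → Rd d) : ℝ :=
  Real.sqrt (tXnormSq α m h u)

def tMemXm (α m : ℝ) (h : Rd d → ℝ) (u : Rd d → Rd d) : Prop :=
  tMemSob m h ∧ (∀ i, tMemSob (m + ((d : ℝ) - α) / 2) (fun x => u x i))
    ∧ tMemHSob (-(((d : ℝ) - α) / 2)) h

def dvg (u : Rd d → Rd d) : Rd d → ℝ :=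
  fun x => ∑ i, fderiv ℝ (fun y => u y i) x (EuclideanSpace.single i 1)

def grad (f : Rd d → ℝ) : Rd d → Rd d := fun x => gradient f x

/-- the damped pressureless Euler–Riesz system on the torus -/
def tIsERSol (α : ℝ) (h : ℝ → Rd d → ℝ) (u : ℝ → Rd d → Rd d) (I : Set ℝ) : Prop :=
  (∀ t ∈ I, Per (h t) ∧ PerV (u t)) ∧
  ∀ t ∈ I, ∀ x : Rd d,
    deriv (fun s => h s x) t + dvg (fun y => h t y • u t y) x + dvg (u t) x = 0 ∧
    deriv (fun s => u s x) t + fderiv ℝ (u t) x (u t x)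
      = - u t x - grad (tFracLap (α - d) (h t)) x

def tContXm (α m : ℝ) (h : ℝ → Rd d → ℝ) (u : ℝ → Rd d → Rd d) (I : Set ℝ) : Prop :=
  (∀ t ∈ I, tMemXm α m (h t) (u t)) ∧
  ∀ t₀ ∈ I, Tendsto (fun t => tXnorm α m (fun x => h t x - h t₀ x) (fun x => u t x - u t₀ x))
      (nhdsWithin t₀ I) (nhds 0)

def SmoothFns (h : ℝ → Rd d → ℝ) (u : ℝ → Rd d → Rd d) : Prop :=
  ContDiff ℝ (⊤ : ℕ∞) (fun p : ℝ × Rd d => h p.1 p.2) ∧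
  ContDiff ℝ (⊤ : ℕ∞) (fun p : ℝ × Rd d => u p.1 p.2)

def tIsClassicalSol (α m : ℝ) (h : ℝ → Rd d → ℝ) (u : ℝ → Rd d → Rd d) (I : Set ℝ) : Prop :=
  tIsERSol α h u I ∧ tContXm α m h u I ∧ SmoothFns h u

/-- average of the momentum over the torus -/
def mc (h : ℝ → Rd d → ℝ) (u : ℝ → Rd d → Rd d) (t : ℝ) : Rd d :=
  (EuclideanSpace.equiv (Fin d) ℝ).symm (fun i => ∫ x in TdFund d, (1 + h t x) * u t x i)



/-! ### Weights on the integer lattice -/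

/-- integer vector as a real vector -/
def zvec (n : Fin d → ℤ) : Rd d := WithLp.toLp 2 (fun i => (n i : ℝ))

lemma zNorm_eq (n : Fin d → ℤ) : zNorm n = ‖zvec n‖ := by
  simp [zNorm, zvec, EuclideanSpace.norm_eq]

lemma zvec_sub (n k : Fin d → ℤ) : zvec (n - k) = zvec n - zvec k := by
  ext i; simp [zvec]

lemma zvec_neg (n : Fin d → ℤ) : zvec (-n) = -zvec n := by
  ext i; simp [zvec]

/-- the weight `max 1 |n|` -/
def Jw (n : Fin d → ℤ) : ℝ := max 1 (zNorm n)

lemma one_le_Jw (n : Fin d → ℤ) : 1 ≤ Jw n := le_max_left _ _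
lemma Jw_pos (n : Fin d → ℤ) : 0 < Jw n := lt_of_lt_of_le one_pos (one_le_Jw n)
lemma zNorm_le_Jw (n : Fin d → ℤ) : zNorm n ≤ Jw n := le_max_right _ _
lemma zNorm_nonneg (n : Fin d → ℤ) : 0 ≤ zNorm n := Real.sqrt_nonneg _
lemma zNorm_neg (n : Fin d → ℤ) : zNorm (-n) = zNorm n := by simp [zNorm]
lemma Jw_neg (n : Fin d → ℤ) : Jw (-n) = Jw n := by simp [Jw, zNorm_neg]
lemma Jw_sub_comm (n k : Fin d → ℤ) : Jw (n - k) = Jw (k - n) := by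
  rw [← Jw_neg, neg_sub]

lemma abs_le_zNorm (n : Fin d → ℤ) (j : Fin d) : |(n j : ℝ)| ≤ zNorm n := by
  rw [zNorm_eq]
  have := PiLp.norm_apply_le (zvec n) j
  simpa [zvec] using this

lemma abs_le_Jw (n : Fin d → ℤ) (j : Fin d) : |(n j : ℝ)| ≤ Jw n :=
  (abs_le_zNorm n j).trans (zNorm_le_Jw n)

lemma zNorm_zero : zNorm (0 : Fin d → ℤ) = 0 := by simp [zNorm]

lemma one_le_zNorm {n : Fin d → ℤ} (hn : n ≠ 0) : 1 ≤ zNorm n := by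
  obtain ⟨j, hj⟩ := Function.ne_iff.mp hn
  refine le_trans ?_ (abs_le_zNorm n j)
  have : (1 : ℤ) ≤ |n j| := Int.one_le_abs hj
  exact_mod_cast this

lemma Jw_eq {n : Fin d → ℤ} (hn : n ≠ 0) : Jw n = zNorm n := max_eq_right (one_le_zNorm hn)

lemma abs_Jw_sub_le (n k : Fin d → ℤ) : |Jw n - Jw k| ≤ Jw (n - k) := by
  have h1 : |Jw n - Jw k| ≤ |zNorm n - zNorm k| := by
    unfold Jw
    have := abs_max_sub_max_le_max 1 (zNorm n) 1 (zNorm k)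
    simpa using this
  refine h1.trans (le_trans ?_ (zNorm_le_Jw _))
  rw [zNorm_eq, zNorm_eq, zNorm_eq, zvec_sub]
  exact abs_norm_sub_norm_le _ _

lemma Jw_le_add (n k : Fin d → ℤ) : Jw n ≤ Jw (n - k) + Jw k := by
  have := (abs_le.mp (abs_Jw_sub_le n k)).2
  linarith

lemma Jw_le_mul (n k : Fin d → ℤ) : Jw n ≤ 2 * (Jw (n - k) * Jw k) := by
  have h1 := Jw_le_add n k
  nlinarith [one_le_Jw (n - k), one_le_Jw k]

lemma summable_Jw_rpow {r : ℝ} (hr : r < -(d : ℝ)) : Summable (fun n : Fin d → ℤ => Jw n ^ r) := by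
  let B := (EuclideanSpace.basisFun (Fin d) ℝ).toBasis
  let L := Submodule.span ℤ (Set.range B)
  have hrank : Module.finrank ℤ L = d := by
    rw [ZLattice.rank ℝ L]; simp
  have h := ZLattice.summable_norm_rpow L r (by rw [hrank]; exact hr)
  have hmem : ∀ n : Fin d → ℤ, zvec n ∈ L := by
    intro n
    rw [Module.Basis.mem_span_iff_repr_mem]
    intro i
    refine ⟨n i, ?_⟩
    simp [B, zvec]
  let f : (Fin d → ℤ) → L := fun n => ⟨zvec n, hmem n⟩
  have hf : Function.Injective f := by
    intro n k hnk
    have h1 : zvec n = zvec k := congrArg Subtype.val hnk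
    funext i
    have h2 : (zvec n) i = (zvec k) i := by rw [h1]
    simpa [zvec] using h2
  have h2 := h.comp_injective hf
  refine h2.congr_cofinite ?_
  have : ∀ᶠ n : Fin d → ℤ in cofinite, n ≠ 0 := by
    simp [Filter.eventually_cofinite]
  filter_upwards [this] with n hn
  simp only [Function.comp, f]
  rw [Jw_eq hn, zNorm_eq]; rfl

lemma rpow_add_le {y z s : ℝ} (hy : 0 ≤ y) (hz : 0 ≤ z) (hs : 0 ≤ s) :
    (y + z) ^ s ≤ 2 ^ s * (y ^ s + z ^ s) := by
  have h1 : y + z ≤ 2 * max y z := by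
    have := le_max_left y z; have := le_max_right y z; linarith
  calc (y + z) ^ s ≤ (2 * max y z) ^ s := Real.rpow_le_rpow (by positivity) h1 hs
    _ = 2 ^ s * (max y z) ^ s := Real.mul_rpow (by norm_num) (by positivity)
    _ ≤ _ := by
      have h2 : (0:ℝ) < 2 ^ s := by positivity
      apply mul_le_mul_of_nonneg_left _ h2.le
      have h3 : 0 ≤ y ^ s := by positivity
      have h4 : 0 ≤ z ^ s := by positivity
      rcases max_choice y z with h | h <;> rw [h] <;> linarith

lemma rpow_sub_le {x y s : ℝ} (hx : 0 < x) (hy : 0 < y) (hs : 1 ≤ s) :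
    x ^ s - y ^ s ≤ s * x ^ (s - 1) * (x - y) := by
  have h := one_add_mul_self_le_rpow_one_add (s := y / x - 1) (by
    have : 0 ≤ y / x := by positivity
    linarith) hs
  have e : 1 + (y / x - 1) = y / x := by ring
  rw [e, Real.div_rpow hy.le hx.le, le_div_iff₀ (by positivity)] at h
  have e2 : x ^ s = x ^ (s - 1) * x := by
    rw [← Real.rpow_add_one hx.ne']; ring_nf
  have e3 : (1 + s * (y / x - 1)) * x ^ s = x ^ s - s * x ^ (s - 1) * (x - y) := by
    rw [e2]; field_simp; ring
  linarith

lemma abs_rpow_sub_le {x y z s : ℝ} (hx : 1 ≤ x) (hy : 1 ≤ y) (hz : 1 ≤ z) (hs : 1 ≤ s)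
    (hxy : |x - y| ≤ z) :
    |x ^ s - y ^ s| ≤ s * 2 ^ (s - 1) * (z * y ^ (s - 1) + z ^ s) := by
  have key : |x ^ s - y ^ s| ≤ s * (y + z) ^ (s - 1) * z := by
    obtain ⟨h1, h2⟩ := abs_le.mp hxy
    rcases le_total y x with h | h
    · have hm : y ^ s ≤ x ^ s := Real.rpow_le_rpow (by linarith) h (by linarith)
      rw [abs_of_nonneg (by linarith)]
      refine (rpow_sub_le (by linarith) (by linarith) hs).trans ?_
      have : x ^ (s - 1) ≤ (y + z) ^ (s - 1) :=
        Real.rpow_le_rpow (by linarith) (by linarith) (by linarith)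
      gcongr
    · have hm : x ^ s ≤ y ^ s := Real.rpow_le_rpow (by linarith) h (by linarith)
      rw [abs_of_nonpos (by linarith)]
      have h3 := rpow_sub_le (x := y) (y := x) (by linarith) (by linarith) hs
      have : y ^ (s - 1) ≤ (y + z) ^ (s - 1) :=
        Real.rpow_le_rpow (by linarith) (by linarith) (by linarith)
      have h4 : s * y ^ (s - 1) * (y - x) ≤ s * (y + z) ^ (s - 1) * z := by
        gcongr
        linarith
      linarith
  refine key.trans ?_
  have h5 := rpow_add_le (y := y) (z := z) (s := s - 1) (by linarith) (by linarith) (by linarith)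
  have e : z ^ s = z ^ (s - 1) * z := by
    rw [← Real.rpow_add_one (by linarith)]; ring_nf
  calc s * (y + z) ^ (s - 1) * z ≤ s * (2 ^ (s - 1) * (y ^ (s - 1) + z ^ (s - 1))) * z := by gcongr
    _ = _ := by rw [e]; ring

/-- commutator multiplier -/
lemma mult_comm {s : ℝ} (hs : 1 ≤ s) (n k : Fin d → ℤ) :
    |Jw n ^ s - Jw k ^ s| * Jw k
      ≤ s * 2 ^ (s - 1) * (Jw (n - k) * Jw k ^ s + Jw (n - k) ^ s * Jw k) := by
  have h := abs_rpow_sub_le (one_le_Jw n) (one_le_Jw k) (one_le_Jw (n - k)) hs (abs_Jw_sub_le n k)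
  have e : Jw k ^ s = Jw k ^ (s - 1) * Jw k := by
    rw [← Real.rpow_add_one (Jw_pos k).ne']; ring_nf
  have := mul_le_mul_of_nonneg_right h (Jw_pos k).le
  refine this.trans (le_of_eq ?_)
  conv_rhs => rw [e]
  ring

/-- product multiplier -/
lemma mult_prod {s : ℝ} (hs : 0 ≤ s) (n k : Fin d → ℤ) :
    Jw n ^ s ≤ 2 ^ s * (Jw (n - k) ^ s + Jw k ^ s) :=
  (Real.rpow_le_rpow (Jw_pos n).le (Jw_le_add n k) hs).trans
    (rpow_add_le (Jw_pos _).le (Jw_pos _).le hs)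

lemma mult_D_aux {x y σ : ℝ} (hx : 1 ≤ x) (hxy : x ≤ y) (h0 : 0 < σ) (h1 : σ < 1) :
    x * (x ^ (-σ) - y ^ (-σ)) ≤ y - x := by
  have hx0 : 0 < x := by linarith
  have hy0 : 0 < y := by linarith
  have e : x ^ (-σ) - y ^ (-σ) = x ^ (-σ) * (1 - (x / y) ^ σ) := by
    rw [Real.div_rpow hx0.le hy0.le, Real.rpow_neg hx0.le, Real.rpow_neg hy0.le]
    have : 0 < x ^ σ := by positivity
    have : 0 < y ^ σ := by positivity
    field_simp
  have h2 : x / y ≤ (x / y) ^ σ := by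
    have : x / y ≤ 1 := by rw [div_le_one hy0]; exact hxy
    calc x / y = (x / y) ^ (1:ℝ) := by simp
      _ ≤ _ := Real.rpow_le_rpow_of_exponent_ge (by positivity) this h1.le
  have h3 : x ^ (-σ) ≤ 1 := Real.rpow_le_one_of_one_le_of_nonpos hx (by linarith)
  have h4 : 0 ≤ 1 - x / y := by
    have : x / y ≤ 1 := by rw [div_le_one hy0]; exact hxy
    linarith
  calc x * (x ^ (-σ) - y ^ (-σ)) ≤ x * (1 * (1 - x / y)) := by
        rw [e]
        have h5 : (x / y) ^ σ ≤ 1 := Real.rpow_le_one (by positivity) (by linarith) h0.le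
        gcongr
    _ = x * (y - x) / y := by field_simp
    _ ≤ y - x := by
      rw [div_le_iff₀ hy0]; nlinarith

lemma mult_D {σ : ℝ} (h0 : 0 < σ) (h1 : σ < 1) (n k : Fin d → ℤ) (j : Fin d) :
    |(n j : ℝ) * Jw n ^ (-σ) - (k j : ℝ) * Jw k ^ (-σ)| ≤ 2 * Jw (n - k) := by
  wlog h : Jw n ≤ Jw k generalizing n k with H
  · have := H k n (le_of_not_ge h)
    rw [abs_sub_comm, Jw_sub_comm]; exact this
  have e : (n j : ℝ) * Jw n ^ (-σ) - (k j : ℝ) * Jw k ^ (-σ)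
    = ((n - k) j : ℤ) * Jw k ^ (-σ) + (n j : ℝ) * (Jw n ^ (-σ) - Jw k ^ (-σ)) := by
    simp; ring
  rw [e]
  have hp : 0 ≤ Jw n ^ (-σ) - Jw k ^ (-σ) := by
    have := Real.rpow_le_rpow_of_nonpos (Jw_pos n) h (by linarith : -σ ≤ 0)
    linarith
  have a1 : |(((n - k) j : ℤ) : ℝ) * Jw k ^ (-σ)| ≤ Jw (n - k) := by
    rw [abs_mul]
    have h3 : Jw k ^ (-σ) ≤ 1 := Real.rpow_le_one_of_one_le_of_nonpos (one_le_Jw k) (by linarith)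
    have h4 : 0 ≤ Jw k ^ (-σ) := Real.rpow_nonneg (Jw_pos k).le _
    rw [abs_of_nonneg h4]
    calc _ ≤ Jw (n - k) * 1 := mul_le_mul (abs_le_Jw _ _) h3 h4 (Jw_pos _).le
      _ = _ := mul_one _
  have a2 : |(n j : ℝ) * (Jw n ^ (-σ) - Jw k ^ (-σ))| ≤ Jw (n - k) := by
    rw [abs_mul, abs_of_nonneg hp]
    calc _ ≤ Jw n * (Jw n ^ (-σ) - Jw k ^ (-σ)) := mul_le_mul_of_nonneg_right (abs_le_Jw _ _) hp
      _ ≤ Jw k - Jw n := mult_D_aux (one_le_Jw n) h h0 h1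
      _ ≤ _ := by
        have := (abs_le.mp (abs_Jw_sub_le n k)).1
        linarith
  refine (abs_add_le _ _).trans ?_
  linarith


/-! ### Real convolution inequalities -/

section young
variable {ι : Type*} [AddCommGroup ι]

lemma cs_tsum {ι : Type*} {f g : ι → ℝ} (hf : ∀ i, 0 ≤ f i) (hg : ∀ i, 0 ≤ g i)
    (hf2 : Summable fun i => f i ^ 2) (hg2 : Summable fun i => g i ^ 2) :
    (Summable fun i => f i * g i) ∧
      ∑' i, f i * g i ≤ √(∑' i, f i ^ 2) * √(∑' i, g i ^ 2) := by
  have h := Real.summable_and_inner_le_Lp_mul_Lq_tsum_of_nonneg Real.HolderConjugate.two_two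
    hf hg (by simpa using hf2) (by simpa using hg2)
  refine ⟨h.1, h.2.trans (le_of_eq ?_)⟩
  simp [Real.sqrt_eq_rpow]

lemma mink_tsum {ι : Type*} {f g : ι → ℝ} (hf : ∀ i, 0 ≤ f i) (hg : ∀ i, 0 ≤ g i)
    (hf2 : Summable fun i => f i ^ 2) (hg2 : Summable fun i => g i ^ 2) :
    (Summable fun i => (f i + g i) ^ 2) ∧
      √(∑' i, (f i + g i) ^ 2) ≤ √(∑' i, f i ^ 2) + √(∑' i, g i ^ 2) := by
  obtain ⟨h1, h2⟩ := cs_tsum hf hg hf2 hg2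
  have e : (fun i => (f i + g i) ^ 2) = fun i => f i ^ 2 + 2 * (f i * g i) + g i ^ 2 := by
    funext i; ring
  have hs := (hf2.add (h1.mul_left 2)).add hg2
  refine ⟨by rw [e]; exact hs, ?_⟩
  rw [e, (hf2.add (h1.mul_left 2)).tsum_add hg2, hf2.tsum_add (h1.mul_left 2), tsum_mul_left]
  apply Real.sqrt_le_iff.mpr
  refine ⟨by positivity, ?_⟩
  have a1 : √(∑' i, f i ^ 2) ^ 2 = ∑' i, f i ^ 2 := Real.sq_sqrt (tsum_nonneg (fun i => sq_nonneg (f i)))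
  have a2 : √(∑' i, g i ^ 2) ^ 2 = ∑' i, g i ^ 2 := Real.sq_sqrt (tsum_nonneg (fun i => sq_nonneg (g i)))
  nlinarith

/-- the shear `(n,k) ↦ (n-k,k)` -/
def shear (ι : Type*) [AddCommGroup ι] : ι × ι ≃ ι × ι where
  toFun p := (p.1 - p.2, p.2)
  invFun p := (p.1 + p.2, p.2)
  left_inv p := by simp
  right_inv p := by simp

lemma summable_shear {F G : ι → ℝ} (hF : ∀ i, 0 ≤ F i) (hG : ∀ i, 0 ≤ G i)
    (sF : Summable F) (sG : Summable G) :
    Summable (fun p : ι × ι => F (p.1 - p.2) * G p.2) := by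
  have h := sF.mul_of_nonneg sG hF hG
  exact (shear ι).summable_iff.mpr h

lemma tsum_shear {F G : ι → ℝ} (hF : ∀ i, 0 ≤ F i) (hG : ∀ i, 0 ≤ G i)
    (sF : Summable F) (sG : Summable G) :
    Summable (fun n => ∑' k, F (n - k) * G k) ∧
    ∑' n, ∑' k, F (n - k) * G k = (∑' n, F n) * ∑' n, G n := by
  have h := summable_shear hF hG sF sG
  refine ⟨h.prod, ?_⟩
  rw [← h.tsum_prod, sF.tsum_mul_tsum sG (sF.mul_of_nonneg sG hF hG)]
  exact (shear ι).tsum_eq (fun p : ι × ι => F p.1 * G p.2)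

lemma summable_sq_of_summable {ι : Type*} {G : ι → ℝ} (hG : ∀ i, 0 ≤ G i) (sG : Summable G) :
    Summable (fun n => G n ^ 2) := by
  have h : ∀ n, G n ^ 2 ≤ (∑' k, G k) * G n := fun n => by
    rw [sq]; exact mul_le_mul_of_nonneg_right (sG.le_tsum n (fun j _ => hG j)) (hG n)
  exact Summable.of_nonneg_of_le (fun n => sq_nonneg _) h (sG.mul_left _)

lemma young {F G : ι → ℝ} (hF : ∀ i, 0 ≤ F i) (hG : ∀ i, 0 ≤ G i)
    (sF : Summable F) (sG : Summable G) :
    (Summable fun n => (∑' k, F (n - k) * G k) ^ 2) ∧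
    √(∑' n, (∑' k, F (n - k) * G k) ^ 2) ≤ (∑' n, F n) * √(∑' n, G n ^ 2) := by
  have sG2 := summable_sq_of_summable hG sG
  have hpt : ∀ n, (∑' k, F (n - k) * G k) ^ 2 ≤ (∑' k, F k) * ∑' k, F (n - k) * G k ^ 2 := by
    intro n
    have h1 : Summable (fun k => F (n - k)) := (Equiv.subLeft n).summable_iff.mpr sF
    have h2 : Summable (fun k => F (n - k) * G k ^ 2) :=
      (summable_shear hF (fun i => sq_nonneg _) sF sG2).prod_factor n
    have h := (cs_tsum (f := fun k => √(F (n - k))) (g := fun k => √(F (n - k)) * G k)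
      (fun i => Real.sqrt_nonneg _) (fun i => mul_nonneg (Real.sqrt_nonneg _) (hG i))
      (by simpa only [Real.sq_sqrt (hF _)] using h1)
      (by simpa only [mul_pow, Real.sq_sqrt (hF _)] using h2)).2
    simp only [← mul_assoc, Real.mul_self_sqrt (hF _), mul_pow, Real.sq_sqrt (hF _)] at h
    have h3 : ∑' k, F (n - k) = ∑' k, F k := (Equiv.subLeft n).tsum_eq F
    rw [h3] at h
    calc _ ≤ (√(∑' i, F i) * √(∑' i, F (n - i) * G i ^ 2)) ^ 2 :=
          pow_le_pow_left₀ (tsum_nonneg fun k => mul_nonneg (hF _) (hG _)) h 2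
      _ = _ := by
          rw [mul_pow, Real.sq_sqrt (tsum_nonneg hF),
            Real.sq_sqrt (tsum_nonneg fun k => mul_nonneg (hF _) (sq_nonneg _))]
  obtain ⟨t1, t2⟩ := tsum_shear hF (fun i => sq_nonneg (G i)) sF sG2
  have hs : Summable fun n => (∑' k, F (n - k) * G k) ^ 2 :=
    Summable.of_nonneg_of_le (fun n => sq_nonneg _) hpt (t1.mul_left _)
  refine ⟨hs, ?_⟩
  have hle := hs.tsum_le_tsum hpt (t1.mul_left _)
  rw [tsum_mul_left, t2] at hle
  apply Real.sqrt_le_iff.mpr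
  have p1 : 0 ≤ ∑' n, F n := tsum_nonneg hF
  refine ⟨by positivity, ?_⟩
  rw [mul_pow, Real.sq_sqrt (tsum_nonneg fun i => sq_nonneg _)]
  linarith

lemma young' {F G : ι → ℝ} (hF : ∀ i, 0 ≤ F i) (hG : ∀ i, 0 ≤ G i)
    (sF : Summable F) (sG : Summable G) :
    (Summable fun n => (∑' k, F (n - k) * G k) ^ 2) ∧
    √(∑' n, (∑' k, F (n - k) * G k) ^ 2) ≤ √(∑' n, F n ^ 2) * ∑' n, G n := by
  have e : ∀ n, ∑' k, F (n - k) * G k = ∑' k, G (n - k) * F k := by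
    intro n
    rw [← (Equiv.subLeft n).tsum_eq (fun k => F (n - k) * G k)]
    simp [mul_comm]
  simp_rw [e]
  rw [mul_comm]
  exact young hG hF sG sF
end young


/-! ### Rapidly decaying sequences -/

open ComplexConjugate

abbrev Sq (d : ℕ) := (Fin d → ℤ) → ℂ

def Rapid (f : Sq d) : Prop := ∀ K : ℕ, ∃ C : ℝ, ∀ n, Jw n ^ K * ‖f n‖ ≤ C

def PolyB (w : Sq d) : Prop := ∃ K : ℕ, ∃ C : ℝ, 0 ≤ C ∧ ∀ n, ‖w n‖ ≤ C * Jw n ^ K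

lemma Rapid.mul {w f : Sq d} (hf : Rapid f) (hw : PolyB w) : Rapid (w * f) := by
  intro K
  obtain ⟨K', C', hC', h'⟩ := hw
  obtain ⟨C, h⟩ := hf (K + K')
  refine ⟨C' * C, fun n => ?_⟩
  have := Jw_pos n
  calc Jw n ^ K * ‖(w * f) n‖ = Jw n ^ K * (‖w n‖ * ‖f n‖) := by simp
    _ ≤ Jw n ^ K * (C' * Jw n ^ K' * ‖f n‖) := by gcongr; exact h' n
    _ = C' * (Jw n ^ (K + K') * ‖f n‖) := by rw [pow_add]; ring
    _ ≤ _ := by gcongr; exact h n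

lemma Rapid.add {f g : Sq d} (hf : Rapid f) (hg : Rapid g) : Rapid (f + g) := by
  intro K
  obtain ⟨C, h⟩ := hf K
  obtain ⟨C', h'⟩ := hg K
  refine ⟨C + C', fun n => ?_⟩
  have := Jw_pos n
  calc Jw n ^ K * ‖(f + g) n‖ ≤ Jw n ^ K * (‖f n‖ + ‖g n‖) := by
        gcongr; exact norm_add_le _ _
    _ ≤ _ := by rw [mul_add]; exact add_le_add (h n) (h' n)

lemma Rapid.neg {f : Sq d} (hf : Rapid f) : Rapid (-f) := by
  intro K
  obtain ⟨C, h⟩ := hf K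
  exact ⟨C, fun n => by simpa using h n⟩

lemma Rapid.sub {f g : Sq d} (hf : Rapid f) (hg : Rapid g) : Rapid (f - g) := by
  rw [sub_eq_add_neg]; exact hf.add hg.neg

lemma rapid_zero : Rapid (0 : Sq d) := fun K => ⟨0, fun n => by simp⟩

lemma rapid_sum {α : Type*} {f : α → Sq d} (s : Finset α) (hf : ∀ i, Rapid (f i)) :
    Rapid (∑ i ∈ s, f i) := by
  classical
  induction s using Finset.induction_on with
  | empty => simpa using rapid_zero
  | insert a s ha ih => rw [Finset.sum_insert ha]; exact (hf a).add ih

lemma Rapid.summable_norm {f : Sq d} (hf : Rapid f) : Summable (fun n => ‖f n‖) := by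
  obtain ⟨C, h⟩ := hf (d + 1)
  have hs : Summable (fun n : Fin d → ℤ => C * Jw n ^ (-((d:ℝ) + 1))) :=
    (summable_Jw_rpow (by linarith)).mul_left C
  refine Summable.of_nonneg_of_le (fun n => norm_nonneg _) (fun n => ?_) hs
  have hJ := Jw_pos n
  rw [Real.rpow_neg hJ.le, ← div_eq_mul_inv, le_div_iff₀ (by positivity), mul_comm]
  have := h n
  exact_mod_cast this

lemma Rapid.summable {f : Sq d} (hf : Rapid f) : Summable f := hf.summable_norm.of_norm

lemma Rapid.summable_sq {f : Sq d} (hf : Rapid f) : Summable (fun n => ‖f n‖ ^ 2) :=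
  summable_sq_of_summable (fun _ => norm_nonneg _) hf.summable_norm

lemma Rapid.bdd {f : Sq d} (hf : Rapid f) : ∃ C, 0 ≤ C ∧ ∀ n, ‖f n‖ ≤ C := by
  obtain ⟨C, h⟩ := hf 0
  exact ⟨C, (by simpa using (norm_nonneg (f 0)).trans (by simpa using h 0)), fun n => by simpa using h n⟩

def sN1 (f : Sq d) : ℝ := ∑' n, ‖f n‖
def sN2 (f : Sq d) : ℝ := √(∑' n, ‖f n‖ ^ 2)
def sconv (f g : Sq d) : Sq d := fun n => ∑' k, f (n - k) * g k
def sip (f g : Sq d) : ℂ := ∑' n, conj (f n) * g n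

lemma sN1_nonneg (f : Sq d) : 0 ≤ sN1 f := tsum_nonneg fun _ => norm_nonneg _
lemma sN2_nonneg (f : Sq d) : 0 ≤ sN2 f := Real.sqrt_nonneg _
lemma sN2_sq (f : Sq d) : sN2 f ^ 2 = ∑' n, ‖f n‖ ^ 2 :=
  Real.sq_sqrt (tsum_nonneg fun _ => sq_nonneg _)

lemma sN2_le {f g : Sq d} (hg : Rapid g) {C : ℝ} (hC : 0 ≤ C) (h : ∀ n, ‖f n‖ ≤ C * ‖g n‖) :
    sN2 f ≤ C * sN2 g := by
  unfold sN2
  apply Real.sqrt_le_iff.mpr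
  refine ⟨by positivity, ?_⟩
  rw [mul_pow, Real.sq_sqrt (tsum_nonneg fun _ => sq_nonneg _), ← tsum_mul_left]
  have h' : ∀ n, ‖f n‖ ^ 2 ≤ C ^ 2 * ‖g n‖ ^ 2 := fun n => by
    rw [← mul_pow]; exact pow_le_pow_left₀ (norm_nonneg _) (h n) 2
  exact (Summable.of_nonneg_of_le (fun _ => sq_nonneg _) h'
    (hg.summable_sq.mul_left _)).tsum_le_tsum h' (hg.summable_sq.mul_left _)

lemma sN1_le {f g : Sq d} (hg : Rapid g) {C : ℝ} (h : ∀ n, ‖f n‖ ≤ C * ‖g n‖) :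
    sN1 f ≤ C * sN1 g := by
  unfold sN1
  rw [← tsum_mul_left]
  exact (Summable.of_nonneg_of_le (fun _ => norm_nonneg _) h
    (hg.summable_norm.mul_left _)).tsum_le_tsum h (hg.summable_norm.mul_left _)

lemma sN1_add_le {f g : Sq d} (hf : Rapid f) (hg : Rapid g) : sN1 (f + g) ≤ sN1 f + sN1 g := by
  unfold sN1
  rw [← hf.summable_norm.tsum_add hg.summable_norm]
  exact (hf.add hg).summable_norm.tsum_le_tsum (fun n => norm_add_le _ _)
    (hf.summable_norm.add hg.summable_norm)

lemma sN1_sum_le {α : Type*} {f : α → Sq d} (s : Finset α) (hf : ∀ i, Rapid (f i)) :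
    sN1 (∑ i ∈ s, f i) ≤ ∑ i ∈ s, sN1 (f i) := by
  classical
  induction s using Finset.induction_on with
  | empty => simp [sN1]
  | insert a s ha ih =>
    rw [Finset.sum_insert ha, Finset.sum_insert ha]
    exact (sN1_add_le (hf a) (rapid_sum s hf)).trans (by linarith)

/-- universal bilinear estimate -/
lemma bilin_bound {F1 G1 F2 G2 : Sq d} (hF1 : Rapid F1) (hG1 : Rapid G1) (hF2 : Rapid F2)
    (hG2 : Rapid G2) {T : (Fin d → ℤ) → (Fin d → ℤ) → ℂ} {h : Sq d} {C : ℝ} (hC : 0 ≤ C)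
    (hT : ∀ n k, ‖T n k‖ ≤ C * (‖F1 (n - k)‖ * ‖G1 k‖ + ‖F2 (n - k)‖ * ‖G2 k‖))
    (hh : ∀ n, h n = ∑' k, T n k) :
    sN2 h ≤ C * (sN1 F1 * sN2 G1 + sN2 F2 * sN1 G2) := by
  have nn : ∀ (f : Sq d) n, 0 ≤ ‖f n‖ := fun f n => norm_nonneg _
  obtain ⟨s1, y1⟩ := young (nn F1) (nn G1) hF1.summable_norm hG1.summable_norm
  obtain ⟨s2, y2⟩ := young' (nn F2) (nn G2) hF2.summable_norm hG2.summable_norm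
  obtain ⟨s3, y3⟩ := mink_tsum
    (fun n => tsum_nonneg fun k => mul_nonneg (nn F1 (n - k)) (nn G1 k))
    (fun n => tsum_nonneg fun k => mul_nonneg (nn F2 (n - k)) (nn G2 k)) s1 s2
  have hpt : ∀ n, ‖h n‖ ≤ C * ((∑' k, ‖F1 (n - k)‖ * ‖G1 k‖) + ∑' k, ‖F2 (n - k)‖ * ‖G2 k‖) := by
    intro n
    have a1 := (summable_shear (nn F1) (nn G1) hF1.summable_norm hG1.summable_norm).prod_factor n
    have a2 := (summable_shear (nn F2) (nn G2) hF2.summable_norm hG2.summable_norm).prod_factor n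
    rw [hh, ← a1.tsum_add a2, ← tsum_mul_left]
    exact tsum_of_norm_bounded ((a1.add a2).mul_left C).hasSum (hT n)
  have hpt2 : ∀ n, ‖h n‖ ^ 2 ≤
      C ^ 2 * ((∑' k, ‖F1 (n - k)‖ * ‖G1 k‖) + ∑' k, ‖F2 (n - k)‖ * ‖G2 k‖) ^ 2 := fun n => by
    rw [← mul_pow]; exact pow_le_pow_left₀ (norm_nonneg _) (hpt n) 2
  have hle := (Summable.of_nonneg_of_le (fun _ => sq_nonneg _) hpt2
    (s3.mul_left _)).tsum_le_tsum hpt2 (s3.mul_left _)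
  rw [tsum_mul_left] at hle
  calc sN2 h ≤ √(C ^ 2 * ∑' n, ((∑' k, ‖F1 (n - k)‖ * ‖G1 k‖)
        + ∑' k, ‖F2 (n - k)‖ * ‖G2 k‖) ^ 2) := Real.sqrt_le_sqrt hle
    _ = C * √(∑' n, ((∑' k, ‖F1 (n - k)‖ * ‖G1 k‖)
        + ∑' k, ‖F2 (n - k)‖ * ‖G2 k‖) ^ 2) := by
        rw [Real.sqrt_mul (sq_nonneg C), Real.sqrt_sq hC]
    _ ≤ C * (sN1 F1 * sN2 G1 + sN2 F2 * sN1 G2) := by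
        apply mul_le_mul_of_nonneg_left _ hC
        exact y3.trans (add_le_add y1 y2)

lemma sconv_summable {f g : Sq d} (hf : Rapid f) (hg : Rapid g) (n : Fin d → ℤ) :
    Summable (fun k => f (n - k) * g k) := by
  obtain ⟨C, hC, h⟩ := hf.bdd
  refine Summable.of_norm_bounded (hg.summable_norm.mul_left C) fun k => ?_
  rw [norm_mul]
  exact mul_le_mul_of_nonneg_right (h _) (norm_nonneg _)

lemma Rapid.conv {f g : Sq d} (hf : Rapid f) (hg : Rapid g) : Rapid (sconv f g) := by
  intro K
  obtain ⟨C, h⟩ := hf K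
  have hC : 0 ≤ C := le_trans (by have := Jw_pos (0 : Fin d → ℤ); positivity) (h 0)
  have hw : PolyB (fun n : Fin d → ℤ => ((Jw n ^ K : ℝ) : ℂ)) :=
    ⟨K, 1, zero_le_one, fun n => by
      rw [Complex.norm_real, Real.norm_of_nonneg (pow_nonneg (Jw_pos n).le _), one_mul]⟩
  have hs := (hg.mul hw).summable_norm
  refine ⟨2 ^ K * C * ∑' k, ‖((fun n : Fin d → ℤ => ((Jw n ^ K : ℝ) : ℂ)) * g) k‖, fun n => ?_⟩
  have e : Jw n ^ K * ‖sconv f g n‖ = ‖∑' k, ((Jw n ^ K : ℝ) : ℂ) * (f (n - k) * g k)‖ := by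
    rw [tsum_mul_left, norm_mul, Complex.norm_real, Real.norm_of_nonneg (pow_nonneg (Jw_pos n).le _)]
    rfl
  rw [e, ← tsum_mul_left]
  refine tsum_of_norm_bounded (hs.mul_left _).hasSum fun k => ?_
  have h1 := Jw_pos n
  have h2 := Jw_pos k
  have h3 := Jw_pos (n - k)
  rw [norm_mul, Complex.norm_real, Real.norm_of_nonneg (by positivity), norm_mul]
  simp only [Pi.mul_apply, norm_mul, Complex.norm_real]
  rw [Real.norm_of_nonneg (by positivity)]
  calc Jw n ^ K * (‖f (n - k)‖ * ‖g k‖) ≤ (2 * (Jw (n - k) * Jw k)) ^ K * (‖f (n - k)‖ * ‖g k‖) := by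
        gcongr; exact Jw_le_mul n k
    _ = 2 ^ K * (Jw (n - k) ^ K * ‖f (n - k)‖) * (Jw k ^ K * ‖g k‖) := by
        rw [mul_pow, mul_pow]; ring
    _ ≤ _ := by gcongr; exact h _

lemma sconv_comm (f g : Sq d) : sconv f g = sconv g f := by
  funext n
  unfold sconv
  rw [← (Equiv.subLeft n).tsum_eq (fun k => f (n - k) * g k)]
  simp [mul_comm]

lemma sconv_add_right {f g h : Sq d} (hf : Rapid f) (hg : Rapid g) (hh : Rapid h) :
    sconv f (g + h) = sconv f g + sconv f h := by
  funext n
  simp only [sconv, Pi.add_apply, mul_add]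
  exact (sconv_summable hf hg n).tsum_add (sconv_summable hf hh n)

lemma sconv_neg_right {f g : Sq d} : sconv f (-g) = -sconv f g := by
  funext n
  simp [sconv, tsum_neg]

lemma sconv_sub_right {f g h : Sq d} (hf : Rapid f) (hg : Rapid g) (hh : Rapid h) :
    sconv f (g - h) = sconv f g - sconv f h := by
  rw [sub_eq_add_neg, sconv_add_right hf hg hh.neg, sconv_neg_right, sub_eq_add_neg]

lemma sN1_conv_le {f g : Sq d} (hf : Rapid f) (hg : Rapid g) :
    sN1 (sconv f g) ≤ sN1 f * sN1 g := by
  obtain ⟨h1, h2⟩ := tsum_shear (fun n => norm_nonneg (f n)) (fun n => norm_nonneg (g n))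
    hf.summable_norm hg.summable_norm
  unfold sN1
  rw [← h2]
  refine (hf.conv hg).summable_norm.tsum_le_tsum (fun n => ?_) h1
  refine tsum_of_norm_bounded (Summable.hasSum ?_) (fun k => by rw [norm_mul])
  exact (summable_shear (fun n => norm_nonneg (f n)) (fun n => norm_nonneg (g n))
    hf.summable_norm hg.summable_norm).prod_factor n

lemma sN2_conv_le {f g : Sq d} (hf : Rapid f) (hg : Rapid g) :
    sN2 (sconv f g) ≤ sN1 f * sN2 g := by
  have := bilin_bound hf hg rapid_zero rapid_zero (h := sconv f g)
    (T := fun n k => f (n - k) * g k) zero_le_one (fun n k => by simp) (fun n => rfl)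
  simpa [sN1] using this

/-! inner product -/

lemma sip_summable {f g : Sq d} (hf : Rapid f) (hg : Rapid g) :
    Summable (fun n => conj (f n) * g n) := by
  obtain ⟨C, hC, h⟩ := hf.bdd
  refine Summable.of_norm_bounded (hg.summable_norm.mul_left C) fun k => ?_
  rw [norm_mul, RCLike.norm_conj]
  exact mul_le_mul_of_nonneg_right (h _) (norm_nonneg _)

lemma sip_add_right {f g h : Sq d} (hf : Rapid f) (hg : Rapid g) (hh : Rapid h) :
    sip f (g + h) = sip f g + sip f h := by
  simp only [sip, Pi.add_apply, mul_add]
  exact (sip_summable hf hg).tsum_add (sip_summable hf hh)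

lemma sip_neg_right {f g : Sq d} : sip f (-g) = -sip f g := by
  simp [sip, tsum_neg]

lemma sip_sub_right {f g h : Sq d} (hf : Rapid f) (hg : Rapid g) (hh : Rapid h) :
    sip f (g - h) = sip f g - sip f h := by
  rw [sub_eq_add_neg, sip_add_right hf hg hh.neg, sip_neg_right, sub_eq_add_neg]

lemma sip_conj (f g : Sq d) : conj (sip f g) = sip g f := by
  unfold sip
  rw [Complex.conj_tsum]
  simp [mul_comm]

lemma sip_re_comm (f g : Sq d) : (sip f g).re = (sip g f).re := by
  rw [← sip_conj g f, Complex.conj_re]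

lemma sip_add_left {f g h : Sq d} (hf : Rapid f) (hg : Rapid g) (hh : Rapid h) :
    sip (g + h) f = sip g f + sip h f := by
  rw [← sip_conj, sip_add_right hf hg hh, map_add, sip_conj, sip_conj]

lemma sip_sum_right {α : Type*} {f : Sq d} {g : α → Sq d} (s : Finset α) (hf : Rapid f)
    (hg : ∀ i, Rapid (g i)) : sip f (∑ i ∈ s, g i) = ∑ i ∈ s, sip f (g i) := by
  classical
  induction s using Finset.induction_on with
  | empty => simp [sip]
  | insert a s ha ih =>
    rw [Finset.sum_insert ha, Finset.sum_insert ha, sip_add_right hf (hg a) (rapid_sum s hg), ih]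

lemma sip_le {f g : Sq d} (hf : Rapid f) (hg : Rapid g) : ‖sip f g‖ ≤ sN2 f * sN2 g := by
  obtain ⟨h1, h2⟩ := cs_tsum (fun n => norm_nonneg (f n)) (fun n => norm_nonneg (g n))
    hf.summable_sq hg.summable_sq
  refine le_trans ?_ h2
  exact tsum_of_norm_bounded h1.hasSum (fun n => by rw [norm_mul, RCLike.norm_conj])

lemma sip_re_le {f g : Sq d} (hf : Rapid f) (hg : Rapid g) : |(sip f g).re| ≤ sN2 f * sN2 g :=
  (Complex.abs_re_le_norm _).trans (sip_le hf hg)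

lemma sip_self (f : Sq d) : sip f f = ((sN2 f ^ 2 : ℝ) : ℂ) := by
  rw [sN2_sq, sip, Complex.ofReal_tsum]
  congr 1; funext n
  rw [mul_comm, Complex.mul_conj, Complex.normSq_eq_norm_sq]

lemma sip_self_re (f : Sq d) : (sip f f).re = sN2 f ^ 2 := by rw [sip_self, Complex.ofReal_re]

/-- hermitian sequences -/
def Herm (f : Sq d) : Prop := ∀ n, f (-n) = conj (f n)

/-- moving a skew multiplier -/
lemma sip_skew {w : Sq d} (hw : ∀ n, conj (w n) = -w n) (f g : Sq d) :
    sip f (w * g) = -sip (w * f) g := by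
  unfold sip
  rw [← tsum_neg]
  congr 1; funext n
  simp only [Pi.mul_apply, map_mul, hw]; ring

lemma sip_conv {a f g : Sq d} (ha : Rapid a) (hf : Rapid f) (hg : Rapid g) (hH : Herm a) :
    sip f (sconv a g) = sip (sconv a f) g := by
  obtain ⟨C, hC, h⟩ := ha.bdd
  have hs : Summable (Function.uncurry
      (fun n k : Fin d → ℤ => conj (f n) * (a (n - k) * g k))) := by
    refine Summable.of_norm_bounded (((hf.summable_norm.mul_of_nonneg hg.summable_norm
      (fun _ => norm_nonneg _) (fun _ => norm_nonneg _))).mul_left C) fun p => ?_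
    simp only [Function.uncurry, norm_mul, RCLike.norm_conj]
    calc ‖f p.1‖ * (‖a (p.1 - p.2)‖ * ‖g p.2‖) ≤ ‖f p.1‖ * (C * ‖g p.2‖) := by gcongr; exact h _
      _ = _ := by ring
  unfold sip sconv
  simp only [← tsum_mul_left]
  rw [← hs.tsum_comm]
  congr 1; funext k
  rw [Complex.conj_tsum, ← tsum_mul_right]
  congr 1; funext n
  have : a (n - k) = conj (a (k - n)) := by rw [← hH, neg_sub]
  rw [this, map_mul]; ring

lemma Herm.conv {a b : Sq d} (ha : Herm a) (hb : Herm b) : Herm (sconv a b) := by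
  intro n
  unfold sconv
  rw [Complex.conj_tsum, ← (Equiv.neg (Fin d → ℤ)).tsum_eq]
  congr 1; funext k
  simp only [Equiv.neg_apply, map_mul]
  rw [← ha, ← hb]; congr 2; abel

lemma sconv_assoc {a b g : Sq d} (ha : Rapid a) (hb : Rapid b) (hg : Rapid g) :
    sconv a (sconv b g) = sconv (sconv a b) g := by
  funext n
  obtain ⟨C, hC, h⟩ := ha.bdd
  unfold sconv
  have hs : Summable (Function.uncurry
      (fun k l : Fin d → ℤ => a (n - k) * (b (k - l) * g l))) := by
    refine Summable.of_norm_bounded ((summable_shear (fun _ => norm_nonneg _)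
      (fun _ => norm_nonneg _) hb.summable_norm hg.summable_norm).mul_left C) fun p => ?_
    simp only [Function.uncurry, norm_mul]
    gcongr; exact h _
  simp only [← tsum_mul_left]
  rw [← hs.tsum_comm]
  congr 1; funext l
  rw [← tsum_mul_right, ← (Equiv.addRight l).tsum_eq]
  congr 1; funext k
  simp only [Equiv.coe_addRight, add_sub_cancel_right]
  rw [mul_assoc]; congr 2; abel


/-! ### Multiplier operators and static estimates -/

open ComplexConjugate

def Wm (s : ℝ) : Sq d := fun n => ((Jw n ^ s : ℝ) : ℂ)
def dj (j : Fin d) : Sq d := fun n => 2 * π * Complex.I * (n j : ℂ)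
def Dj (σ : ℝ) (j : Fin d) : Sq d := dj j * Wm (-σ)
def Sj (σ : ℝ) (j : Fin d) : Sq d := fun n => (-(1 / (4 * π ^ 2)) : ℝ) * (dj j n * Wm (σ - 2) n)

lemma norm_Wm (s : ℝ) (n : Fin d → ℤ) : ‖(Wm s : Sq d) n‖ = Jw n ^ s := by
  rw [Wm, Complex.norm_real, Real.norm_of_nonneg (Real.rpow_nonneg (Jw_pos n).le _)]

lemma norm_dj (j : Fin d) (n : Fin d → ℤ) : ‖dj j n‖ = 2 * π * |(n j : ℝ)| := by
  simp [dj, abs_of_pos Real.pi_pos]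

lemma norm_dj_le (j : Fin d) (n : Fin d → ℤ) : ‖dj j n‖ ≤ 2 * π * Jw n := by
  rw [norm_dj]
  have := Real.pi_pos
  gcongr
  exact abs_le_Jw n j

lemma Wm_mul (s t : ℝ) : (Wm s * Wm t : Sq d) = Wm (s + t) := by
  funext n
  simp only [Wm, Pi.mul_apply, ← Complex.ofReal_mul, ← Real.rpow_add (Jw_pos n)]

lemma Jw_rpow_mono (n : Fin d → ℤ) {s t : ℝ} (h : s ≤ t) : Jw n ^ s ≤ Jw n ^ t :=
  Real.rpow_le_rpow_of_exponent_le (one_le_Jw n) h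

lemma polyB_Wm (s : ℝ) : PolyB (Wm s : Sq d) := by
  obtain ⟨K, hK⟩ := exists_nat_ge s
  refine ⟨K, 1, zero_le_one, fun n => ?_⟩
  rw [norm_Wm, one_mul, ← Real.rpow_natCast]
  exact Jw_rpow_mono n hK

lemma polyB_dj (j : Fin d) : PolyB (dj j) :=
  ⟨1, 2 * π, by positivity, fun n => by simpa using norm_dj_le j n⟩

lemma PolyB.mul {w v : Sq d} (hw : PolyB w) (hv : PolyB v) : PolyB (w * v) := by
  obtain ⟨K, C, hC, h⟩ := hw
  obtain ⟨K', C', hC', h'⟩ := hv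
  refine ⟨K + K', C * C', by positivity, fun n => ?_⟩
  have := Jw_pos n
  rw [Pi.mul_apply, norm_mul, pow_add]
  calc ‖w n‖ * ‖v n‖ ≤ (C * Jw n ^ K) * (C' * Jw n ^ K') := by
        gcongr
        · exact h n
        · exact h' n
    _ = _ := by ring

lemma polyB_Dj (σ : ℝ) (j : Fin d) : PolyB (Dj σ j) := (polyB_dj j).mul (polyB_Wm _)

lemma norm_Sj_le {σ : ℝ} (h1 : σ < 1) (j : Fin d) (n : Fin d → ℤ) : ‖Sj σ j n‖ ≤ 1 := by
  unfold Sj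
  rw [norm_mul, norm_mul, norm_Wm, norm_dj, Complex.norm_real, Real.norm_eq_abs, abs_neg,
    abs_of_pos (by positivity)]
  have e : Jw n ^ (σ - 2) ≤ (Jw n)⁻¹ := by
    rw [← Real.rpow_neg_one]; exact Jw_rpow_mono n (by linarith)
  have hp := Real.pi_pos
  have h3 := Real.pi_gt_three
  have hJ := Jw_pos n
  calc 1 / (4 * π ^ 2) * (2 * π * |(n j : ℝ)| * Jw n ^ (σ - 2))
      ≤ 1 / (4 * π ^ 2) * (2 * π * Jw n * (Jw n)⁻¹) := by
        gcongr; exact abs_le_Jw n j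
    _ = 1 / (2 * π) := by field_simp; norm_num
    _ ≤ 1 := by rw [div_le_one (by positivity)]; linarith

lemma polyB_Sj {σ : ℝ} (h1 : σ < 1) (j : Fin d) : PolyB (Sj σ j) :=
  ⟨0, 1, zero_le_one, fun n => by simpa using norm_Sj_le h1 j n⟩

lemma dj_skew (j : Fin d) (n : Fin d → ℤ) : conj (dj j n) = -dj j n := by
  simp only [dj, map_mul, Complex.conj_I, Complex.conj_ofReal, map_ofNat, map_intCast]; ring

lemma Dj_skew (σ : ℝ) (j : Fin d) (n : Fin d → ℤ) : conj (Dj σ j n) = -Dj σ j n := by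
  simp [Dj, Wm, dj_skew]

lemma norm_DS_le (σ : ℝ) (i j : Fin d) (n : Fin d → ℤ) : ‖Dj σ j n * Sj σ i n‖ ≤ 1 := by
  simp only [Dj, Sj, Pi.mul_apply]
  rw [norm_mul, norm_mul, norm_mul, norm_mul, norm_Wm, norm_Wm, norm_dj, norm_dj, Complex.norm_real,
    Real.norm_eq_abs, abs_neg, abs_of_pos (by positivity : (0:ℝ) < 1 / (4 * π ^ 2))]
  have e : Jw n ^ (-σ) * Jw n ^ (σ - 2) = (Jw n ^ 2)⁻¹ := by
    rw [← Real.rpow_add (Jw_pos n), ← Real.rpow_natCast, ← Real.rpow_neg (Jw_pos n).le]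
    congr 1; push_cast; ring
  have hp := Real.pi_pos
  have hJ := Jw_pos n
  calc 2 * π * |(n j : ℝ)| * Jw n ^ (-σ) * (1 / (4 * π ^ 2) * (2 * π * |(n i : ℝ)| * Jw n ^ (σ - 2)))
      = (|(n j : ℝ)| * |(n i : ℝ)|) * (Jw n ^ (-σ) * Jw n ^ (σ - 2)) := by field_simp; ring
    _ ≤ (Jw n * Jw n) * (Jw n ^ 2)⁻¹ := by
        rw [e]; gcongr
        · exact abs_le_Jw n j
        · exact abs_le_Jw n i
    _ = 1 := by field_simp

lemma sum_SD {σ : ℝ} {A : Sq d} (hA : A 0 = 0) : ∑ i, Sj σ i * (Dj σ i * A) = A := by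
  funext n
  rw [Finset.sum_apply]
  by_cases hn : n = 0
  · subst hn; simp [hA]
  have e : Jw n ^ (-σ) * Jw n ^ (σ - 2) = (zNorm n ^ 2)⁻¹ := by
    rw [← Real.rpow_add (Jw_pos n), ← Jw_eq hn, ← Real.rpow_natCast, ← Real.rpow_neg (Jw_pos n).le]
    congr 1; push_cast; ring
  have e2 : zNorm n ^ 2 = ∑ i, (n i : ℝ) ^ 2 := Real.sq_sqrt (Finset.sum_nonneg fun i _ => sq_nonneg _)
  have hz : zNorm n ^ 2 ≠ 0 := by have := one_le_zNorm hn; positivity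
  have hp := Real.pi_ne_zero
  have : ∀ i, (Sj σ i * (Dj σ i * A)) n = ((((n i : ℝ) ^ 2 * (zNorm n ^ 2)⁻¹ : ℝ)) : ℂ) * A n := by
    intro i
    rw [← e]
    simp only [Sj, Dj, Wm, dj, Pi.mul_apply]
    push_cast
    have hp' : (π : ℂ) ≠ 0 := by exact_mod_cast hp
    field_simp
    rw [Complex.I_sq]; ring
  simp_rw [this]
  rw [← Finset.sum_mul, ← Complex.ofReal_sum, ← Finset.sum_mul, ← e2, mul_inv_cancel₀ hz]
  simp

lemma leibniz {f g : Sq d} (hf : Rapid f) (hg : Rapid g) (j : Fin d) :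
    dj j * sconv f g = sconv (dj j * f) g + sconv f (dj j * g) := by
  funext n
  simp only [sconv, Pi.mul_apply, Pi.add_apply]
  have s1 := sconv_summable (hf.mul (polyB_dj j)) hg n
  have s2 := sconv_summable hf (hg.mul (polyB_dj j)) n
  simp only [Pi.mul_apply] at s1 s2
  rw [← s1.tsum_add s2, ← tsum_mul_left]
  congr 1; funext k
  simp only [dj, Pi.sub_apply]; push_cast; ring

lemma sN1_dj_le {g : Sq d} (hg : Rapid g) (j : Fin d) : sN1 (dj j * g) ≤ 2 * π * sN1 (Wm 1 * g) := by
  refine sN1_le (hg.mul (polyB_Wm 1)) fun n => ?_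
  rw [Pi.mul_apply, Pi.mul_apply, norm_mul, norm_mul, norm_Wm, Real.rpow_one, ← mul_assoc]
  exact mul_le_mul_of_nonneg_right (norm_dj_le j n) (norm_nonneg _)

lemma sN1_le_W {g : Sq d} (hg : Rapid g) : sN1 g ≤ sN1 (Wm 1 * g) := by
  have := sN1_le (f := g) (hg.mul (polyB_Wm 1)) (C := 1) fun n => ?_
  · simpa using this
  rw [Pi.mul_apply, norm_mul, norm_Wm, Real.rpow_one, one_mul]
  exact le_mul_of_one_le_left (norm_nonneg _) (one_le_Jw n)

lemma sN2_W_mono {g : Sq d} (hg : Rapid g) {s t : ℝ} (h : s ≤ t) : sN2 (Wm s * g) ≤ sN2 (Wm t * g) := by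
  have := sN2_le (f := Wm s * g) (hg.mul (polyB_Wm t)) (C := 1) zero_le_one fun n => ?_
  · simpa using this
  simp only [Pi.mul_apply, norm_mul, norm_Wm, one_mul]
  exact mul_le_mul_of_nonneg_right (Jw_rpow_mono n h) (norm_nonneg _)

lemma transport {g F : Sq d} (hg : Rapid g) (hF : Rapid F) (hH : Herm g) (j : Fin d) :
    |(sip F (sconv g (dj j * F))).re| ≤ π * sN1 (Wm 1 * g) * sN2 F ^ 2 := by
  have hdF := hF.mul (polyB_dj j)
  have hdg := hg.mul (polyB_dj j)
  have e : sip F (sconv g (dj j * F))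
      = -(sip (sconv (dj j * g) F) F + sip (sconv g (dj j * F)) F) := by
    rw [sip_conv hg hF hdF hH, sip_skew (dj_skew j), leibniz hg hF,
      sip_add_left hF (hdg.conv hF) (hg.conv hdF)]
  have e2 := congrArg Complex.re e
  rw [Complex.neg_re, Complex.add_re, sip_re_comm (sconv g (dj j * F)) F] at e2
  have e3 : (sip F (sconv g (dj j * F))).re = -(1 / 2) * (sip (sconv (dj j * g) F) F).re := by linarith
  rw [e3, abs_mul]
  have b1 := sip_re_le (hdg.conv hF) hF
  have b2 := sN2_conv_le hdg hF
  have b3 := sN1_dj_le hg j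
  have n1 := sN2_nonneg F
  have n2 := sN1_nonneg (dj j * g)
  calc |-(1 / 2 : ℝ)| * |(sip (sconv (dj j * g) F) F).re|
      ≤ 1 / 2 * (2 * π * sN1 (Wm 1 * g) * sN2 F * sN2 F) := by
        rw [abs_neg, abs_of_pos (by norm_num : (0:ℝ) < 1 / 2)]
        gcongr
        refine b1.trans ?_
        gcongr
        refine b2.trans ?_
        gcongr
    _ = _ := by ring

lemma comm1 {f g : Sq d} (hf : Rapid f) (hg : Rapid g) {p : ℝ} (hp : 1 ≤ p) (j : Fin d) :
    sN2 (Wm p * sconv f (dj j * g) - sconv f (dj j * (Wm p * g)))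
      ≤ 2 * π * (p * 2 ^ (p - 1)) *
        (sN1 (Wm 1 * f) * sN2 (Wm p * g) + sN2 (Wm p * f) * sN1 (Wm 1 * g)) := by
  refine bilin_bound (T := fun n k => (Wm p n - Wm p k) * dj j k * f (n - k) * g k)
    (hf.mul (polyB_Wm 1)) (hg.mul (polyB_Wm p)) (hf.mul (polyB_Wm p)) (hg.mul (polyB_Wm 1))
    (by positivity) (fun n k => ?_) (fun n => ?_)
  · simp only [Pi.mul_apply, norm_mul, norm_Wm, Real.rpow_one]
    have e : ‖(Wm p n - Wm p k : ℂ)‖ = |Jw n ^ p - Jw k ^ p| := by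
      rw [Wm, Wm, ← Complex.ofReal_sub, Complex.norm_real, Real.norm_eq_abs]
    rw [e]
    have h := mult_comm hp n k
    have hpi := Real.pi_pos
    calc |Jw n ^ p - Jw k ^ p| * ‖dj j k‖ * ‖f (n - k)‖ * ‖g k‖
        ≤ |Jw n ^ p - Jw k ^ p| * (2 * π * Jw k) * ‖f (n - k)‖ * ‖g k‖ := by
          gcongr; exact norm_dj_le j k
      _ = 2 * π * (|Jw n ^ p - Jw k ^ p| * Jw k) * ‖f (n - k)‖ * ‖g k‖ := by ring
      _ ≤ 2 * π * (p * 2 ^ (p - 1) * (Jw (n - k) * Jw k ^ p + Jw (n - k) ^ p * Jw k))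
          * ‖f (n - k)‖ * ‖g k‖ := by gcongr
      _ = _ := by ring
  · have s1 := sconv_summable hf (hg.mul (polyB_dj j)) n
    have s2 := sconv_summable hf ((hg.mul (polyB_Wm p)).mul (polyB_dj j)) n
    simp only [Pi.sub_apply, Pi.mul_apply, sconv] at s1 s2 ⊢
    rw [← tsum_mul_left, ← (s1.mul_left _).tsum_sub s2]
    congr 1; funext k; ring

lemma comm2 {f g : Sq d} (hf : Rapid f) (hg : Rapid g) {σ : ℝ} (h0 : 0 < σ) (h1 : σ < 1) (j : Fin d) :
    sN2 (Dj σ j * sconv f g - sconv f (Dj σ j * g)) ≤ 4 * π * (sN1 (Wm 1 * f) * sN2 g) := by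
  have := bilin_bound (T := fun n k => (Dj σ j n - Dj σ j k) * f (n - k) * g k)
    (h := Dj σ j * sconv f g - sconv f (Dj σ j * g)) (C := 4 * π)
    (hf.mul (polyB_Wm 1)) hg rapid_zero rapid_zero
    (by positivity) (fun n k => ?_) (fun n => ?_)
  · simpa [sN1] using this
  · simp only [Pi.mul_apply, norm_mul, norm_Wm, Real.rpow_one, Pi.zero_apply, norm_zero, mul_zero, add_zero]
    have e : ‖Dj σ j n - Dj σ j k‖ = 2 * π * |(n j : ℝ) * Jw n ^ (-σ) - (k j : ℝ) * Jw k ^ (-σ)| := by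
      have : Dj σ j n - Dj σ j k = 2 * π * Complex.I *
        (((n j : ℝ) * Jw n ^ (-σ) - (k j : ℝ) * Jw k ^ (-σ) : ℝ) : ℂ) := by
        simp only [Dj, dj, Wm, Pi.mul_apply]; push_cast; ring
      rw [this, norm_mul, Complex.norm_real, Real.norm_eq_abs]
      simp [abs_of_pos Real.pi_pos]
    rw [e]
    have h := mult_D h0 h1 n k j
    have hpi := Real.pi_pos
    calc _ ≤ 2 * π * (2 * Jw (n - k)) * ‖f (n - k)‖ * ‖g k‖ := by gcongr
      _ = _ := by ring
  · have s1 := sconv_summable hf hg n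
    have s2 := sconv_summable hf (hg.mul (polyB_Dj σ j)) n
    simp only [Pi.sub_apply, Pi.mul_apply, sconv] at s1 s2 ⊢
    rw [← tsum_mul_left, ← (s1.mul_left _).tsum_sub s2]
    congr 1; funext k; ring

lemma prod1 {f g : Sq d} (hf : Rapid f) (hg : Rapid g) {p : ℝ} (hp : 0 ≤ p) :
    sN2 (Wm p * sconv f g) ≤ 2 ^ p * (sN1 f * sN2 (Wm p * g) + sN2 (Wm p * f) * sN1 g) := by
  refine bilin_bound (T := fun n k => Wm p n * (f (n - k) * g k))
    hf (hg.mul (polyB_Wm p)) (hf.mul (polyB_Wm p)) hg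
    (by positivity) (fun n k => ?_) (fun n => ?_)
  · simp only [Pi.mul_apply, norm_mul, norm_Wm]
    calc Jw n ^ p * (‖f (n - k)‖ * ‖g k‖) ≤ 2 ^ p * (Jw (n - k) ^ p + Jw k ^ p) * (‖f (n - k)‖ * ‖g k‖) := by
          gcongr; exact mult_prod hp n k
      _ = _ := by ring
  · simp only [Pi.mul_apply, sconv]
    rw [← tsum_mul_left]

lemma bilin_bound1 {F G h : Sq d} (hF : Rapid F) (hG : Rapid G) (hh : Rapid h)
    {T : (Fin d → ℤ) → (Fin d → ℤ) → ℂ} {C : ℝ}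
    (hT : ∀ n k, ‖T n k‖ ≤ C * (‖F (n - k)‖ * ‖G k‖))
    (hh' : ∀ n, h n = ∑' k, T n k) :
    sN1 h ≤ C * (sN1 F * sN1 G) := by
  have hF1 : ∀ n, 0 ≤ ‖F n‖ := fun n => norm_nonneg _
  have hG1 : ∀ n, 0 ≤ ‖G n‖ := fun n => norm_nonneg _
  have hs2 := summable_shear hF1 hG1 hF.summable_norm hG.summable_norm
  obtain ⟨h1, h2⟩ := tsum_shear hF1 hG1 hF.summable_norm hG.summable_norm
  have key : ∀ n, ‖h n‖ ≤ C * ∑' k, ‖F (n - k)‖ * ‖G k‖ := by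
    intro n
    have hs : Summable (fun k => ‖F (n - k)‖ * ‖G k‖) := hs2.prod_factor n
    rw [hh' n]
    exact tsum_of_norm_bounded (hs.hasSum.mul_left C) (fun k => hT n k)
  unfold sN1
  rw [← h2, ← tsum_mul_left]
  exact hh.summable_norm.tsum_le_tsum key (h1.mul_left C)

lemma sN1_W_conv {f g : Sq d} (hf : Rapid f) (hg : Rapid g) :
    sN1 (Wm 1 * sconv f g) ≤ 2 * (sN1 (Wm 1 * f) * sN1 (Wm 1 * g)) := by
  refine bilin_bound1 (T := fun n k => (Wm 1 : Sq d) n * (f (n - k) * g k))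
    (hf.mul (polyB_Wm 1)) (hg.mul (polyB_Wm 1)) ((hf.conv hg).mul (polyB_Wm 1)) (fun n k => ?_)
    (fun n => ?_)
  · simp only [Pi.mul_apply, norm_mul, norm_Wm, Real.rpow_one]
    calc Jw n * (‖f (n - k)‖ * ‖g k‖) ≤ 2 * (Jw (n - k) * Jw k) * (‖f (n - k)‖ * ‖g k‖) := by
          gcongr; exact Jw_le_mul n k
      _ = _ := by ring
  · simp only [Pi.mul_apply, sconv]
    rw [← tsum_mul_left]


/-! ### The Fourier-side system and its static estimates -/

open ComplexConjugate

def Lq (a : Sq d) (b : Fin d → Sq d) : ℝ := sN1 (Wm 1 * a) + ∑ i, sN1 (Wm 1 * b i)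
def Eq2 (σ s : ℝ) (a : Sq d) (b : Fin d → Sq d) : ℝ :=
  sN2 (Wm s * a) ^ 2 + ∑ i, sN2 (Wm (s + σ) * b i) ^ 2
def Fa (a : Sq d) (b : Fin d → Sq d) : Sq d := -(∑ j, dj j * (b j + sconv a (b j)))
def Fb (σ : ℝ) (a : Sq d) (b : Fin d → Sq d) (i : Fin d) : Sq d :=
  -b i - dj i * (Wm (-2 * σ) * a) - ∑ j, sconv (b j) (dj j * b i)

structure Good (a : Sq d) (b : Fin d → Sq d) : Prop where
  ra : Rapid a
  rb : ∀ i, Rapid (b i)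
  ha : Herm a
  hb : ∀ i, Herm (b i)

section
variable {a : Sq d} {b : Fin d → Sq d} {σ s : ℝ}

lemma Lq_nonneg : 0 ≤ Lq a b :=
  add_nonneg (sN1_nonneg _) (Finset.sum_nonneg fun _ _ => sN1_nonneg _)
lemma La_le : sN1 (Wm 1 * a) ≤ Lq a b :=
  le_add_of_nonneg_right (Finset.sum_nonneg fun _ _ => sN1_nonneg _)
lemma Lb_le (i : Fin d) : sN1 (Wm 1 * b i) ≤ Lq a b := by
  have := Finset.single_le_sum (f := fun i => sN1 (Wm 1 * b i)) (fun i _ => sN1_nonneg _) (Finset.mem_univ i)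
  have h2 := sN1_nonneg (Wm 1 * a)
  unfold Lq
  linarith
lemma Eq2_nonneg : 0 ≤ Eq2 σ s a b :=
  add_nonneg (sq_nonneg _) (Finset.sum_nonneg fun _ _ => sq_nonneg _)
lemma Na_le : sN2 (Wm s * a) ≤ √(Eq2 σ s a b) :=
  Real.le_sqrt_of_sq_le (le_add_of_nonneg_right (Finset.sum_nonneg fun _ _ => sq_nonneg _))
lemma Nb_le (i : Fin d) : sN2 (Wm (s + σ) * b i) ≤ √(Eq2 σ s a b) := by
  refine Real.le_sqrt_of_sq_le ?_
  have := Finset.single_le_sum (f := fun i => sN2 (Wm (s + σ) * b i) ^ 2) (fun i _ => sq_nonneg _) (Finset.mem_univ i)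
  have h2 := sq_nonneg (sN2 (Wm s * a))
  unfold Eq2
  linarith

lemma Good.rFa (h : Good a b) : Rapid (Fa a b) :=
  (rapid_sum _ fun j => ((h.rb j).add (h.ra.conv (h.rb j))).mul (polyB_dj j)).neg
lemma Good.rFb (h : Good a b) (i : Fin d) : Rapid (Fb σ a b i) :=
  ((h.rb i).neg.sub ((h.ra.mul (polyB_Wm _)).mul (polyB_dj i))).sub
    (rapid_sum _ fun j => (h.rb j).conv ((h.rb i).mul (polyB_dj j)))

lemma W_dj_b (i j : Fin d) : Wm s * (dj j * b i) = Dj σ j * (Wm (s + σ) * b i) := by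
  have : (Wm s : Sq d) = Wm (-σ) * Wm (s + σ) := by rw [Wm_mul]; congr 1; ring
  rw [this, Dj]; ring

lemma W_dj_a (i : Fin d) : Wm (s + σ) * (dj i * (Wm (-2 * σ) * a)) = Dj σ i * (Wm s * a) := by
  have : (Wm (-σ) * Wm s : Sq d) = Wm (s + σ) * Wm (-2 * σ) := by rw [Wm_mul, Wm_mul]; congr 1; ring
  calc _ = (Wm (s + σ) * Wm (-2 * σ)) * (dj i * a) := by ring
    _ = _ := by rw [← this, Dj]; ring

lemma sN2_add_le {f g : Sq d} (hf : Rapid f) (hg : Rapid g) : sN2 (f + g) ≤ sN2 f + sN2 g := by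
  have h1 := sip_self_re (f + g)
  rw [sip_add_right (hf.add hg) hf hg, sip_add_left hf hf hg, sip_add_left hg hf hg] at h1
  simp only [Complex.add_re, sip_self_re] at h1
  have h2 := sip_re_le hf hg
  have h3 := sip_re_le hg hf
  have := abs_le_of_sq_le_sq (a := sN2 (f + g)) (b := sN2 f + sN2 g)
    (by nlinarith [le_abs_self (sip f g).re, le_abs_self (sip g f).re])
    (add_nonneg (sN2_nonneg _) (sN2_nonneg _))
  exact (le_abs_self _).trans this

lemma sN2_neg (f : Sq d) : sN2 (-f) = sN2 f := by simp [sN2]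

lemma sN2_sum_le {α : Type*} {f : α → Sq d} (s : Finset α) (hf : ∀ i, Rapid (f i)) :
    sN2 (∑ i ∈ s, f i) ≤ ∑ i ∈ s, sN2 (f i) := by
  classical
  induction s using Finset.induction_on with
  | empty => simp [sN2]
  | insert i s hi ih =>
    rw [Finset.sum_insert hi, Finset.sum_insert hi]
    exact (sN2_add_le (hf i) (rapid_sum s hf)).trans (by gcongr)

/-- structure of the top-order equation for `a` -/
lemma Fa_dec (hs : 1 ≤ s) (hσ : 0 < σ) (h : Good a b) : ∃ R : Fin d → Sq d, (∀ j, Rapid (R j)) ∧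
    (∀ j, sN2 (R j) ≤ 8 * π * (s * 2 ^ (s - 1)) * (Lq a b * √(Eq2 σ s a b))) ∧
    Wm s * Fa a b = -(∑ j, (Dj σ j * (Wm (s + σ) * b j) + sconv a (Dj σ j * (Wm (s + σ) * b j))
      + sconv (b j) (dj j * (Wm s * a)) + R j)) := by
  have hpi := Real.pi_pos
  have ra := h.ra
  have rb := h.rb
  have rWa := ra.mul (polyB_Wm s)
  have rWb := fun j => (rb j).mul (polyB_Wm s)
  have r1 := fun j => (((rb j).conv (ra.mul (polyB_dj j))).mul (polyB_Wm s)).sub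
    ((rb j).conv (rWa.mul (polyB_dj j)))
  have r2 := fun j => ((ra.conv ((rb j).mul (polyB_dj j))).mul (polyB_Wm s)).sub
    (ra.conv ((rWb j).mul (polyB_dj j)))
  refine ⟨fun j => (Wm s * sconv (b j) (dj j * a) - sconv (b j) (dj j * (Wm s * a)))
    + (Wm s * sconv a (dj j * b j) - sconv a (dj j * (Wm s * b j))),
    fun j => (r1 j).add (r2 j), fun j => ?_, ?_⟩
  · refine (sN2_add_le (r1 j) (r2 j)).trans ?_
    have c1 := comm1 (rb j) ra hs j
    have c2 := comm1 ra (rb j) hs j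
    have l1 : sN1 (Wm 1 * a) ≤ Lq a b := La_le
    have l2 : sN1 (Wm 1 * b j) ≤ Lq a b := Lb_le j
    have n1 : sN2 (Wm s * a) ≤ √(Eq2 σ s a b) := Na_le
    have n2 : sN2 (Wm s * b j) ≤ √(Eq2 σ s a b) := (sN2_W_mono (rb j) (by linarith)).trans (Nb_le j)
    have p0 := sN2_nonneg (Wm s * a)
    have p1 := sN2_nonneg (Wm s * b j)
    have p2 : 0 ≤ Lq a b := Lq_nonneg
    have k1 : sN1 (Wm 1 * a) * sN2 (Wm s * b j) ≤ Lq a b * √(Eq2 σ s a b) := by gcongr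
    have k2 : sN1 (Wm 1 * b j) * sN2 (Wm s * a) ≤ Lq a b * √(Eq2 σ s a b) := by gcongr
    have hc : 0 ≤ 2 * π * (s * 2 ^ (s - 1)) := by positivity
    nlinarith [mul_le_mul_of_nonneg_left k1 hc, mul_le_mul_of_nonneg_left k2 hc]
  · rw [Fa, mul_neg, Finset.mul_sum]
    congr 1
    refine Finset.sum_congr rfl fun j _ => ?_
    rw [mul_add, mul_add, leibniz ra (rb j), sconv_comm (dj j * a), mul_add, W_dj_b (σ := σ)]
    have : dj j * (Wm s * b j) = Dj σ j * (Wm (s + σ) * b j) := by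
      rw [← W_dj_b]; ring
    simp only [this]; ring

lemma Fb_dec (hs : 1 ≤ s) (hσ : 0 < σ) (h : Good a b) (i : Fin d) :
    ∃ R : Fin d → Sq d, (∀ j, Rapid (R j)) ∧
    (∀ j, sN2 (R j) ≤ 4 * π * ((s + σ) * 2 ^ (s + σ - 1)) * (Lq a b * √(Eq2 σ s a b))) ∧
    Wm (s + σ) * Fb σ a b i = -(Wm (s + σ) * b i) - Dj σ i * (Wm s * a)
      - ∑ j, (sconv (b j) (dj j * (Wm (s + σ) * b i)) + R j) := by
  have hpi := Real.pi_pos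
  have ra := h.ra
  have rb := h.rb
  refine ⟨fun j => Wm (s + σ) * sconv (b j) (dj j * b i) - sconv (b j) (dj j * (Wm (s + σ) * b i)),
    fun j => (((rb j).conv ((rb i).mul (polyB_dj j))).mul (polyB_Wm _)).sub
      ((rb j).conv (((rb i).mul (polyB_Wm _)).mul (polyB_dj j))), fun j => ?_, ?_⟩
  · refine (comm1 (rb j) (rb i) (by linarith : 1 ≤ s + σ) j).trans ?_
    have l1 : sN1 (Wm 1 * b i) ≤ Lq a b := Lb_le i
    have l2 : sN1 (Wm 1 * b j) ≤ Lq a b := Lb_le j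
    have n1 : sN2 (Wm (s + σ) * b i) ≤ √(Eq2 σ s a b) := Nb_le i
    have n2 : sN2 (Wm (s + σ) * b j) ≤ √(Eq2 σ s a b) := Nb_le j
    have p0 := sN2_nonneg (Wm (s + σ) * b i)
    have p1 := sN1_nonneg (Wm 1 * b i)
    have p2 : 0 ≤ Lq a b := Lq_nonneg
    have : 0 < s := by linarith
    calc _ ≤ 2 * π * ((s + σ) * 2 ^ (s + σ - 1)) * (Lq a b * √(Eq2 σ s a b) + √(Eq2 σ s a b) * Lq a b) := by
          gcongr
      _ = _ := by ring
  · rw [Fb, mul_sub, mul_sub, W_dj_a, Finset.mul_sum, mul_neg]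
    congr 1
    refine Finset.sum_congr rfl fun j _ => ?_
    ring

lemma sN1_Fa_le (h : Good a b) : sN1 (Fa a b) ≤ d * (2 * π * (Lq a b + 2 * Lq a b ^ 2)) := by
  have hpi := Real.pi_pos
  have ra := h.ra
  have rb := h.rb
  have e : sN1 (Fa a b) = sN1 (∑ j, dj j * (b j + sconv a (b j))) := by simp [sN1, Fa]
  rw [e]
  refine (sN1_sum_le _ fun j => ((rb j).add (ra.conv (rb j))).mul (polyB_dj j)).trans ?_
  have : ∀ j ∈ (Finset.univ : Finset (Fin d)), sN1 (dj j * (b j + sconv a (b j))) ≤ 2 * π * (Lq a b + 2 * Lq a b ^ 2) := by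
    intro j _
    refine (sN1_dj_le ((rb j).add (ra.conv (rb j))) j).trans ?_
    gcongr
    rw [mul_add]
    refine (sN1_add_le ((rb j).mul (polyB_Wm 1)) ((ra.conv (rb j)).mul (polyB_Wm 1))).trans ?_
    have := sN1_W_conv ra (rb j)
    have l1 : sN1 (Wm 1 * a) ≤ Lq a b := La_le
    have l2 : sN1 (Wm 1 * b j) ≤ Lq a b := Lb_le j
    have p1 := sN1_nonneg (Wm 1 * b j)
    have p2 : 0 ≤ Lq a b := Lq_nonneg
    have : sN1 (Wm 1 * a) * sN1 (Wm 1 * b j) ≤ Lq a b * Lq a b := by gcongr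
    nlinarith
  refine (Finset.sum_le_sum this).trans (le_of_eq ?_)
  simp

end


/-! ### Top order energy estimate -/

open ComplexConjugate

section
variable {a : Sq d} {b : Fin d → Sq d} {σ s : ℝ}

lemma D_move (i : Fin d) (f g : Sq d) :
    (sip f (Dj σ i * g)).re = -(sip g (Dj σ i * f)).re := by
  rw [sip_skew (Dj_skew σ i), Complex.neg_re, sip_re_comm]

def topQ (σ s : ℝ) (a : Sq d) (b : Fin d → Sq d) : ℝ :=
  (sip (Wm s * a) (Wm s * Fa a b)).re
    + ∑ i, ((sip (Wm (s + σ) * b i) (Wm (s + σ) * Fb σ a b i)).re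
      + (sip (sconv a (Wm (s + σ) * b i)) (Wm (s + σ) * Fb σ a b i)).re
      + 1 / 2 * (sip (Wm (s + σ) * b i) (sconv (Fa a b) (Wm (s + σ) * b i))).re)

def K1 (s : ℝ) : ℝ := 8 * π * (s * 2 ^ (s - 1))
def K2 (σ s : ℝ) : ℝ := 4 * π * ((s + σ) * 2 ^ (s + σ - 1))

lemma top_a (hs : 1 ≤ s) (hσ : 0 < σ) (h : Good a b) :
    (sip (Wm s * a) (Wm s * Fa a b)).re ≤
      ∑ j : Fin d, (-(sip (Wm s * a) (Dj σ j * (Wm (s + σ) * b j))).re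
        - (sip (Wm s * a) (sconv a (Dj σ j * (Wm (s + σ) * b j)))).re
        + (π + K1 s) * (Lq a b * Eq2 σ s a b)) := by
  obtain ⟨R, hR, hRb, e⟩ := Fa_dec hs hσ h
  have ra := h.ra
  have rb := h.rb
  have rA := ra.mul (polyB_Wm s)
  have rB := fun j => (rb j).mul (polyB_Wm (s + σ))
  have rDB := fun j => (rB j).mul (polyB_Dj σ j)
  have r3 := fun j => (rb j).conv (rA.mul (polyB_dj j))
  have r2 := fun j => ra.conv (rDB j)
  rw [e, sip_neg_right, sip_sum_right _ rA (fun j => (((rDB j).add (r2 j)).add (r3 j)).add (hR j)),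
    Complex.neg_re, Complex.re_sum, ← Finset.sum_neg_distrib]
  refine Finset.sum_le_sum fun j _ => ?_
  rw [sip_add_right rA (((rDB j).add (r2 j)).add (r3 j)) (hR j),
    sip_add_right rA ((rDB j).add (r2 j)) (r3 j), sip_add_right rA (rDB j) (r2 j)]
  simp only [Complex.add_re]
  have t := transport (rb j) rA (h.hb j) j
  have u := sip_re_le rA (hR j)
  have n1 : sN2 (Wm s * a) ≤ √(Eq2 σ s a b) := Na_le
  have l2 : sN1 (Wm 1 * b j) ≤ Lq a b := Lb_le j
  have p0 := sN2_nonneg (Wm s * a)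
  have p1 := sN1_nonneg (Wm 1 * b j)
  have p2 : 0 ≤ Lq a b := Lq_nonneg
  have hE : √(Eq2 σ s a b) ^ 2 = Eq2 σ s a b := Real.sq_sqrt Eq2_nonneg
  have hpi := Real.pi_pos
  have t2 : π * sN1 (Wm 1 * b j) * sN2 (Wm s * a) ^ 2 ≤ π * (Lq a b * Eq2 σ s a b) := by
    rw [← hE, mul_assoc]; gcongr
  have u2 : sN2 (Wm s * a) * sN2 (R j) ≤ K1 s * (Lq a b * Eq2 σ s a b) := by
    calc sN2 (Wm s * a) * sN2 (R j) ≤ √(Eq2 σ s a b) * (K1 s * (Lq a b * √(Eq2 σ s a b))) := by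
          have := sN2_nonneg (R j)
          have := hRb j
          unfold K1
          gcongr
      _ = K1 s * (Lq a b * √(Eq2 σ s a b) ^ 2) := by ring
      _ = _ := by rw [hE]
  have t3 := neg_abs_le (sip (Wm s * a) (sconv (b j) (dj j * (Wm s * a)))).re
  have u3 := neg_abs_le (sip (Wm s * a) (R j)).re
  linarith

lemma K2_nonneg (hs : 1 ≤ s) (hσ : 0 < σ) : 0 ≤ K2 σ s := by
  have hpi := Real.pi_pos
  have : 0 < s := by linarith
  unfold K2; positivity

lemma top_b (hs : 1 ≤ s) (hσ : 0 < σ) (h : Good a b) (i : Fin d) :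
    (sip (Wm (s + σ) * b i) (Wm (s + σ) * Fb σ a b i)).re
      + (sip (sconv a (Wm (s + σ) * b i)) (Wm (s + σ) * Fb σ a b i)).re
    ≤ (sip (Wm s * a) (Dj σ i * (Wm (s + σ) * b i))).re
      + (sip (Wm s * a) (Dj σ i * sconv a (Wm (s + σ) * b i))).re
      + (Lq a b * Eq2 σ s a b)
      + d * ((3 * π + 2 * K2 σ s) * ((Lq a b + Lq a b ^ 2) * Eq2 σ s a b)) := by
  obtain ⟨R, hR, hRb, e⟩ := Fb_dec hs hσ h i
  have ra := h.ra
  have rb := h.rb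
  have rA := ra.mul (polyB_Wm s)
  have rB := (rb i).mul (polyB_Wm (s + σ))
  have raB := ra.conv rB
  have rDA := rA.mul (polyB_Dj σ i)
  have r3 := fun j => (rb j).conv (rB.mul (polyB_dj j))
  have rS := rapid_sum Finset.univ (fun j => (r3 j).add (hR j))
  have hE : √(Eq2 σ s a b) ^ 2 = Eq2 σ s a b := Real.sq_sqrt Eq2_nonneg
  have hpi := Real.pi_pos
  have hK2 := K2_nonneg hs hσ
  have p2 : 0 ≤ Lq a b := Lq_nonneg
  have pE : 0 ≤ Eq2 σ s a b := Eq2_nonneg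
  have l1 : sN1 a ≤ Lq a b := (sN1_le_W ra).trans La_le
  have l1' : sN1 (Wm 1 * a) ≤ Lq a b := La_le
  have n2 : sN2 (Wm (s + σ) * b i) ≤ √(Eq2 σ s a b) := Nb_le i
  have p0 := sN2_nonneg (Wm (s + σ) * b i)
  have naB : sN2 (sconv a (Wm (s + σ) * b i)) ≤ Lq a b * √(Eq2 σ s a b) := by
    refine (sN2_conv_le ra rB).trans ?_
    gcongr
  -- generic expansion
  have ex : ∀ f : Sq d, Rapid f → (sip f (Wm (s + σ) * Fb σ a b i)).re =
      -(sip f (Wm (s + σ) * b i)).re + (sip (Wm s * a) (Dj σ i * f)).re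
      - ∑ j, ((sip f (sconv (b j) (dj j * (Wm (s + σ) * b i)))).re + (sip f (R j)).re) := by
    intro f hf
    rw [e, sip_sub_right hf (rB.neg.sub rDA) rS, sip_sub_right hf rB.neg rDA, sip_neg_right,
      sip_sum_right _ hf (fun j => (r3 j).add (hR j)), Complex.sub_re, Complex.sub_re, Complex.neg_re,
      Complex.re_sum, D_move, sub_neg_eq_add]
    congr 1
    refine Finset.sum_congr rfl fun j _ => ?_
    rw [sip_add_right hf (r3 j) (hR j), Complex.add_re]
  rw [ex _ rB, ex _ raB]
  have q1 : 0 ≤ (sip (Wm (s + σ) * b i) (Wm (s + σ) * b i)).re := by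
    rw [sip_self_re]; positivity
  have q2 : -(sip (sconv a (Wm (s + σ) * b i)) (Wm (s + σ) * b i)).re ≤ Lq a b * Eq2 σ s a b := by
    have := sip_re_le raB rB
    have h2 := neg_abs_le (sip (sconv a (Wm (s + σ) * b i)) (Wm (s + σ) * b i)).re
    have : sN2 (sconv a (Wm (s + σ) * b i)) * sN2 (Wm (s + σ) * b i) ≤ Lq a b * Eq2 σ s a b := by
      rw [← hE, sq, ← mul_assoc]; gcongr
    linarith
  have hG : ∀ j : Fin d, -((3 * π + 2 * K2 σ s) * ((Lq a b + Lq a b ^ 2) * Eq2 σ s a b)) ≤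
      ((sip (Wm (s + σ) * b i) (sconv (b j) (dj j * (Wm (s + σ) * b i)))).re
        + (sip (Wm (s + σ) * b i) (R j)).re) +
      ((sip (sconv a (Wm (s + σ) * b i)) (sconv (b j) (dj j * (Wm (s + σ) * b i)))).re
        + (sip (sconv a (Wm (s + σ) * b i)) (R j)).re) := by
    intro j
    have l2 : sN1 (Wm 1 * b j) ≤ Lq a b := Lb_le j
    have p1 := sN1_nonneg (Wm 1 * b j)
    have hRj : sN2 (R j) ≤ K2 σ s * (Lq a b * √(Eq2 σ s a b)) := hRb j
    have pR := sN2_nonneg (R j)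
    have t1 := transport (rb j) rB (h.hb j) j
    have t1' : π * sN1 (Wm 1 * b j) * sN2 (Wm (s + σ) * b i) ^ 2 ≤ π * (Lq a b * Eq2 σ s a b) := by
      rw [← hE, mul_assoc]; gcongr
    have t2 := sip_re_le rB (hR j)
    have t2' : sN2 (Wm (s + σ) * b i) * sN2 (R j) ≤ K2 σ s * (Lq a b * Eq2 σ s a b) := by
      calc _ ≤ √(Eq2 σ s a b) * (K2 σ s * (Lq a b * √(Eq2 σ s a b))) := by gcongr
        _ = K2 σ s * (Lq a b * √(Eq2 σ s a b) ^ 2) := by ring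
        _ = _ := by rw [hE]
    have t3 := transport (ra.conv (rb j)) rB (h.ha.conv (h.hb j)) j
    rw [← sconv_assoc ra (rb j) (rB.mul (polyB_dj j)), sip_conv ra rB (r3 j) h.ha] at t3
    have t3' : π * sN1 (Wm 1 * sconv a (b j)) * sN2 (Wm (s + σ) * b i) ^ 2
        ≤ 2 * π * (Lq a b ^ 2 * Eq2 σ s a b) := by
      have := sN1_W_conv ra (rb j)
      have p3 := sN1_nonneg (Wm 1 * sconv a (b j))
      calc _ ≤ π * (2 * (Lq a b * Lq a b)) * √(Eq2 σ s a b) ^ 2 := by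
            gcongr
            refine this.trans ?_
            gcongr
        _ = _ := by rw [hE]; ring
    have t4 := sip_re_le raB (hR j)
    have t4' : sN2 (sconv a (Wm (s + σ) * b i)) * sN2 (R j) ≤ K2 σ s * (Lq a b ^ 2 * Eq2 σ s a b) := by
      calc _ ≤ (Lq a b * √(Eq2 σ s a b)) * (K2 σ s * (Lq a b * √(Eq2 σ s a b))) := by gcongr
        _ = K2 σ s * (Lq a b ^ 2 * √(Eq2 σ s a b) ^ 2) := by ring
        _ = _ := by rw [hE]
    have a1 := neg_abs_le (sip (Wm (s + σ) * b i) (sconv (b j) (dj j * (Wm (s + σ) * b i)))).re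
    have a2 := neg_abs_le (sip (Wm (s + σ) * b i) (R j)).re
    have a3 := neg_abs_le (sip (sconv a (Wm (s + σ) * b i)) (sconv (b j) (dj j * (Wm (s + σ) * b i)))).re
    have a4 := neg_abs_le (sip (sconv a (Wm (s + σ) * b i)) (R j)).re
    have z1 : 0 ≤ π * (Lq a b * Eq2 σ s a b) := by positivity
    have z2 : 0 ≤ π * (Lq a b ^ 2 * Eq2 σ s a b) := by positivity
    have z3 : 0 ≤ K2 σ s * (Lq a b * Eq2 σ s a b) := by positivity
    have z4 : 0 ≤ K2 σ s * (Lq a b ^ 2 * Eq2 σ s a b) := by positivity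
    have ee : (3 * π + 2 * K2 σ s) * ((Lq a b + Lq a b ^ 2) * Eq2 σ s a b) =
      3 * (π * (Lq a b * Eq2 σ s a b)) + 3 * (π * (Lq a b ^ 2 * Eq2 σ s a b))
       + 2 * (K2 σ s * (Lq a b * Eq2 σ s a b)) + 2 * (K2 σ s * (Lq a b ^ 2 * Eq2 σ s a b)) := by ring
    rw [ee]
    linarith
  have hsum := Finset.sum_le_sum (s := Finset.univ) fun j (_ : j ∈ Finset.univ) => hG j
  rw [Finset.sum_add_distrib, Finset.sum_const, Finset.card_univ, Fintype.card_fin, nsmul_eq_mul] at hsum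
  linarith

lemma top_est (hs : 1 ≤ s) (hσ : 0 < σ) (hσ1 : σ < 1) (h : Good a b) :
    topQ σ s a b ≤ (d * (1 + 7 * π + K1 s + d * (5 * π + 2 * K2 σ s)))
      * ((Lq a b + Lq a b ^ 2) * Eq2 σ s a b) := by
  have ra := h.ra
  have rA := ra.mul (polyB_Wm s)
  have rB := fun i => (h.rb i).mul (polyB_Wm (s + σ))
  have hpi := Real.pi_pos
  have hK2 := K2_nonneg hs hσ
  have hK1 : 0 ≤ K1 s := by unfold K1; positivity
  have p2 : 0 ≤ Lq a b := Lq_nonneg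
  have pE : 0 ≤ Eq2 σ s a b := Eq2_nonneg
  have hE : √(Eq2 σ s a b) ^ 2 = Eq2 σ s a b := Real.sq_sqrt Eq2_nonneg
  unfold topQ
  refine (add_le_add_left (top_a hs hσ h) _).trans ?_
  rw [← Finset.sum_add_distrib]
  refine (Finset.sum_le_card_nsmul _ _ ((1 + 7 * π + K1 s + d * (5 * π + 2 * K2 σ s))
      * ((Lq a b + Lq a b ^ 2) * Eq2 σ s a b)) ?_).trans (le_of_eq ?_)
  · intro i _
    have tb := top_b hs hσ h i
    have c := comm2 ra (rB i) hσ hσ1 i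
    have rD1 := (ra.conv (rB i)).mul (polyB_Dj σ i)
    have rD2 := ra.conv ((rB i).mul (polyB_Dj σ i))
    have c2 := sip_re_le rA (rD1.sub rD2)
    rw [sip_sub_right rA rD1 rD2, Complex.sub_re] at c2
    have n1 : sN2 (Wm s * a) ≤ √(Eq2 σ s a b) := Na_le
    have n2 : sN2 (Wm (s + σ) * b i) ≤ √(Eq2 σ s a b) := Nb_le i
    have p0 := sN2_nonneg (Wm (s + σ) * b i)
    have p1 := sN2_nonneg (Wm s * a)
    have l1 : sN1 (Wm 1 * a) ≤ Lq a b := La_le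
    have c3 : sN2 (Wm s * a) * sN2 (Dj σ i * sconv a (Wm (s + σ) * b i)
        - sconv a (Dj σ i * (Wm (s + σ) * b i))) ≤ 4 * π * (Lq a b * Eq2 σ s a b) := by
      calc _ ≤ √(Eq2 σ s a b) * (4 * π * (Lq a b * √(Eq2 σ s a b))) := by
            have := sN2_nonneg (Dj σ i * sconv a (Wm (s + σ) * b i)
              - sconv a (Dj σ i * (Wm (s + σ) * b i)))
            gcongr
            refine c.trans ?_
            gcongr
        _ = 4 * π * (Lq a b * √(Eq2 σ s a b) ^ 2) := by ring
        _ = _ := by rw [hE]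
    have c4 := le_abs_self ((sip (Wm s * a) (Dj σ i * sconv a (Wm (s + σ) * b i))).re
      - (sip (Wm s * a) (sconv a (Dj σ i * (Wm (s + σ) * b i)))).re)
    have f1 := sip_re_le (rB i) (h.rFa.conv (rB i))
    have f2 : sN2 (Wm (s + σ) * b i) * sN2 (sconv (Fa a b) (Wm (s + σ) * b i))
        ≤ d * (2 * π * (Lq a b + 2 * Lq a b ^ 2)) * Eq2 σ s a b := by
      calc _ ≤ √(Eq2 σ s a b) * (d * (2 * π * (Lq a b + 2 * Lq a b ^ 2)) * √(Eq2 σ s a b)) := by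
            have := sN2_nonneg (sconv (Fa a b) (Wm (s + σ) * b i))
            gcongr
            refine (sN2_conv_le h.rFa (rB i)).trans ?_
            have := sN1_Fa_le h
            gcongr
        _ = d * (2 * π * (Lq a b + 2 * Lq a b ^ 2)) * √(Eq2 σ s a b) ^ 2 := by ring
        _ = _ := by rw [hE]
    have f3 := le_abs_self (sip (Wm (s + σ) * b i) (sconv (Fa a b) (Wm (s + σ) * b i))).re
    have z1 : 0 ≤ π * (Lq a b * Eq2 σ s a b) := by positivity
    have z2 : 0 ≤ π * (Lq a b ^ 2 * Eq2 σ s a b) := by positivity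
    have z3 : 0 ≤ K1 s * (Lq a b ^ 2 * Eq2 σ s a b) := by positivity
    have z4 : 0 ≤ Lq a b ^ 2 * Eq2 σ s a b := by positivity
    have z5 : 0 ≤ d * π * (Lq a b * Eq2 σ s a b) := by positivity
    have z6 : 0 ≤ d * π * (Lq a b ^ 2 * Eq2 σ s a b) := by positivity
    ring_nf at *
    linarith
  · simp; ring

end


/-! ### Lower order dissipative estimate -/

open ComplexConjugate

section
variable {a : Sq d} {b : Fin d → Sq d} {σ s r : ℝ}

def Kr (r : ℝ) : ℝ := 8 * π * 2 ^ (r + 1)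

lemma sN2_dj_le {g : Sq d} (hg : Rapid g) (p : ℝ) (j : Fin d) :
    sN2 (Wm p * (dj j * g)) ≤ 2 * π * sN2 (Wm (p + 1) * g) := by
  refine sN2_le (hg.mul (polyB_Wm (p + 1))) (by positivity) fun n => ?_
  simp only [Pi.mul_apply, norm_mul, norm_Wm]
  rw [Real.rpow_add (Jw_pos n), Real.rpow_one]
  have := norm_dj_le j n
  have h2 := Real.rpow_nonneg (Jw_pos n).le p
  calc Jw n ^ p * (‖dj j n‖ * ‖g n‖) ≤ Jw n ^ p * (2 * π * Jw n * ‖g n‖) := by gcongr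
    _ = _ := by ring

lemma Fa_low (hr : 0 ≤ r) (hσ : 0 < σ) (h : Good a b) : ∃ P : Sq d, Rapid P ∧
    sN2 P ≤ d * (Kr r * (Lq a b * √(Eq2 σ (r + 1) a b))) ∧
    Wm r * Fa a b = -(∑ j, Dj σ j * (Wm (r + σ) * b j)) - P := by
  have hpi := Real.pi_pos
  have ra := h.ra
  have rb := h.rb
  have rP := fun j => ((ra.conv (rb j)).mul (polyB_dj j)).mul (polyB_Wm r)
  refine ⟨∑ j, Wm r * (dj j * sconv a (b j)), rapid_sum _ rP, ?_, ?_⟩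
  · refine (sN2_sum_le _ rP).trans ?_
    refine (Finset.sum_le_card_nsmul _ _ (Kr r * (Lq a b * √(Eq2 σ (r + 1) a b))) ?_).trans (le_of_eq (by simp))
    intro j _
    refine (sN2_dj_le (ra.conv (rb j)) r j).trans ?_
    have := prod1 ra (rb j) (by linarith : 0 ≤ r + 1)
    have l1 : sN1 a ≤ Lq a b := (sN1_le_W ra).trans La_le
    have l2 : sN1 (b j) ≤ Lq a b := (sN1_le_W (rb j)).trans (Lb_le j)
    have n1 : sN2 (Wm (r + 1) * a) ≤ √(Eq2 σ (r + 1) a b) := Na_le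
    have n2 : sN2 (Wm (r + 1) * b j) ≤ √(Eq2 σ (r + 1) a b) :=
      (sN2_W_mono (rb j) (by linarith)).trans (Nb_le j)
    have p0 := sN2_nonneg (Wm (r + 1) * a)
    have p1 := sN2_nonneg (Wm (r + 1) * b j)
    have p2 : 0 ≤ Lq a b := Lq_nonneg
    have p3 := sN1_nonneg (b j)
    calc _ ≤ 2 * π * (2 ^ (r + 1) * (Lq a b * √(Eq2 σ (r + 1) a b) + √(Eq2 σ (r + 1) a b) * Lq a b)) := by
          gcongr
          refine this.trans ?_
          gcongr
      _ = 1 / 2 * (Kr r * (Lq a b * √(Eq2 σ (r + 1) a b))) := by unfold Kr; ring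
      _ ≤ _ := by
          have : 0 ≤ Kr r * (Lq a b * √(Eq2 σ (r + 1) a b)) := by unfold Kr; positivity
          linarith
  · rw [Fa, mul_neg, Finset.mul_sum, ← neg_add', ← Finset.sum_add_distrib]
    congr 1
    refine Finset.sum_congr rfl fun j _ => ?_
    rw [mul_add, mul_add, W_dj_b (σ := σ)]

lemma Fb_low (hr : 0 ≤ r) (hσ : 0 < σ) (hσ1 : σ < 1) (h : Good a b) (i : Fin d) : ∃ P : Sq d, Rapid P ∧
    sN2 P ≤ d * (Kr r * (Lq a b * √(Eq2 σ (r + 1) a b))) ∧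
    Wm (r + σ) * Fb σ a b i = -(Wm (r + σ) * b i) - Dj σ i * (Wm r * a) - P := by
  have hpi := Real.pi_pos
  have ra := h.ra
  have rb := h.rb
  have rP := fun j => ((rb j).conv ((rb i).mul (polyB_dj j))).mul (polyB_Wm (r + σ))
  refine ⟨∑ j, Wm (r + σ) * sconv (b j) (dj j * b i), rapid_sum _ rP, ?_, ?_⟩
  · refine (sN2_sum_le _ rP).trans ?_
    refine (Finset.sum_le_card_nsmul _ _ (Kr r * (Lq a b * √(Eq2 σ (r + 1) a b))) ?_).trans (le_of_eq (by simp))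
    intro j _
    refine (prod1 (rb j) ((rb i).mul (polyB_dj j)) (by linarith : 0 ≤ r + σ)).trans ?_
    have l1 : sN1 (dj j * b i) ≤ 2 * π * Lq a b :=
      (sN1_dj_le (rb i) j).trans (by gcongr; exact Lb_le i)
    have l2 : sN1 (b j) ≤ Lq a b := (sN1_le_W (rb j)).trans (Lb_le j)
    have n1 : sN2 (Wm (r + σ) * (dj j * b i)) ≤ 2 * π * √(Eq2 σ (r + 1) a b) := by
      refine (sN2_dj_le (rb i) _ j).trans ?_
      gcongr
      have : r + σ + 1 = r + 1 + σ := by ring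
      rw [this]; exact Nb_le i
    have n2 : sN2 (Wm (r + σ) * b j) ≤ √(Eq2 σ (r + 1) a b) :=
      (sN2_W_mono (rb j) (by linarith)).trans (Nb_le j)
    have p0 := sN2_nonneg (Wm (r + σ) * (dj j * b i))
    have p2 : 0 ≤ Lq a b := Lq_nonneg
    have p3 := sN1_nonneg (dj j * b i)
    have p5 := sN1_nonneg (b j)
    have p6 := sN2_nonneg (Wm (r + σ) * b j)
    have p4 : (2:ℝ) ^ (r + σ) ≤ 2 ^ (r + 1) := Real.rpow_le_rpow_of_exponent_le (by norm_num) (by linarith)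
    calc _ ≤ 2 ^ (r + 1) * (Lq a b * (2 * π * √(Eq2 σ (r + 1) a b))
          + √(Eq2 σ (r + 1) a b) * (2 * π * Lq a b)) := by gcongr
      _ = 1 / 2 * (Kr r * (Lq a b * √(Eq2 σ (r + 1) a b))) := by unfold Kr; ring
      _ ≤ _ := by
          have : 0 ≤ Kr r * (Lq a b * √(Eq2 σ (r + 1) a b)) := by unfold Kr; positivity
          linarith
  · rw [Fb, mul_sub, mul_sub, W_dj_a, Finset.mul_sum, mul_neg]

def lowE (σ r : ℝ) (a : Sq d) (b : Fin d → Sq d) : ℝ :=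
  2 * (sip (Wm r * a) (Wm r * Fa a b)).re
    + ∑ i, 2 * (sip (Wm (r + σ) * b i) (Wm (r + σ) * Fb σ a b i)).re

def Xc (σ r : ℝ) (a : Sq d) (b : Fin d → Sq d) : ℝ :=
  ∑ i, (sip (Wm r * a) (Sj σ i * (Wm (r + σ) * b i))).re

def lowX (σ r : ℝ) (a : Sq d) (b : Fin d → Sq d) : ℝ :=
  ∑ i, ((sip (Wm r * Fa a b) (Sj σ i * (Wm (r + σ) * b i))).re
    + (sip (Wm r * a) (Sj σ i * (Wm (r + σ) * Fb σ a b i))).re)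

lemma lowE_est (hr : 0 ≤ r) (hσ : 0 < σ) (hσ1 : σ < 1) (h : Good a b) :
    lowE σ r a b ≤ -2 * ∑ i, sN2 (Wm (r + σ) * b i) ^ 2
      + 2 * (1 + d) * (d * (Kr r * (Lq a b * √(Eq2 σ (r + 1) a b)))) * √(Eq2 σ r a b) := by
  have ra := h.ra
  have rb := h.rb
  have rA := ra.mul (polyB_Wm r)
  have rB := fun j => (rb j).mul (polyB_Wm (r + σ))
  have rDA := fun i => rA.mul (polyB_Dj σ i)
  have rDB := fun i => (rB i).mul (polyB_Dj σ i)
  obtain ⟨P, hP, hPb, eP⟩ := Fa_low hr hσ h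
  choose Q hQ hQb eQ using fun i => Fb_low hr hσ hσ1 h i
  set M := d * (Kr r * (Lq a b * √(Eq2 σ (r + 1) a b))) with hM
  set N := √(Eq2 σ r a b) with hN
  have hN0 : 0 ≤ N := Real.sqrt_nonneg _
  have nA : sN2 (Wm r * a) ≤ N := Na_le
  have nB : ∀ i, sN2 (Wm (r + σ) * b i) ≤ N := fun i => Nb_le i
  have e1 : (sip (Wm r * a) (Wm r * Fa a b)).re ≤
      ∑ i, -(sip (Wm r * a) (Dj σ i * (Wm (r + σ) * b i))).re + M * N := by
    rw [eP, sip_sub_right rA (rapid_sum _ rDB).neg hP, sip_neg_right, sip_sum_right _ rA rDB]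
    simp only [Complex.sub_re, Complex.neg_re, Complex.re_sum, Finset.sum_neg_distrib]
    have h1 := sip_re_le rA hP
    have h2 := neg_abs_le (sip (Wm r * a) P).re
    have h3 : sN2 (Wm r * a) * sN2 P ≤ N * M := by
      have := sN2_nonneg P
      gcongr
    linarith
  have e2 : ∀ i ∈ (Finset.univ : Finset (Fin d)), 2 * (sip (Wm (r + σ) * b i) (Wm (r + σ) * Fb σ a b i)).re ≤
      -2 * sN2 (Wm (r + σ) * b i) ^ 2 + 2 * (sip (Wm r * a) (Dj σ i * (Wm (r + σ) * b i))).re + 2 * (M * N) := by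
    intro i _
    rw [eQ, sip_sub_right (rB i) ((rB i).neg.sub (rDA i)) (hQ i), sip_sub_right (rB i) (rB i).neg (rDA i),
      sip_neg_right]
    simp only [Complex.sub_re, Complex.neg_re, sip_self_re]
    rw [D_move i (Wm (r + σ) * b i)]
    have h1 := sip_re_le (rB i) (hQ i)
    have h2 := neg_abs_le (sip (Wm (r + σ) * b i) (Q i)).re
    have h3 : sN2 (Wm (r + σ) * b i) * sN2 (Q i) ≤ N * M := by
      have := sN2_nonneg (Q i)
      have := nB i
      have := hQb i
      gcongr
    linarith
  have e3 := Finset.sum_le_sum e2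
  unfold lowE
  simp only [Finset.sum_add_distrib, ← Finset.mul_sum, Finset.sum_neg_distrib, Finset.sum_const,
    Finset.card_univ, Fintype.card_fin, nsmul_eq_mul] at e1 e3 ⊢
  linarith

lemma S_le (hσ1 : σ < 1) {f : Sq d} (hf : Rapid f) (i : Fin d) : sN2 (Sj σ i * f) ≤ sN2 f := by
  have := sN2_le (f := Sj σ i * f) hf zero_le_one fun n => ?_
  · simpa using this
  rw [Pi.mul_apply, norm_mul]
  exact mul_le_mul_of_nonneg_right (norm_Sj_le hσ1 i n) (norm_nonneg _)

lemma cross_le (hd : 0 < d) (x : ℝ) (y : Fin d → ℝ) :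
    ∑ i, x * y i ≤ 1 / 2 * x ^ 2 + d / 2 * ∑ i, y i ^ 2 := by
  have hd' : (0:ℝ) < d := by exact_mod_cast hd
  have : ∀ i ∈ (Finset.univ : Finset (Fin d)), x * y i ≤ 1 / (2 * d) * x ^ 2 + d / 2 * y i ^ 2 := by
    intro i _
    have := sq_nonneg (x - d * y i)
    rw [← sub_nonneg]
    have e : 1 / (2 * d) * x ^ 2 + d / 2 * y i ^ 2 - x * y i = 1 / (2 * d) * (x - d * y i) ^ 2 := by
      field_simp; ring
    rw [e]; positivity
  refine (Finset.sum_le_sum this).trans (le_of_eq ?_)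
  rw [Finset.sum_add_distrib, Finset.sum_const, Finset.card_univ, Fintype.card_fin, nsmul_eq_mul,
    ← Finset.mul_sum]
  congr 1
  field_simp

lemma Xc_le (hd : 0 < d) (hσ1 : σ < 1) (h : Good a b) : |Xc σ r a b| ≤ d / 2 * Eq2 σ r a b := by
  have rA := h.ra.mul (polyB_Wm r)
  have rB := fun j => (h.rb j).mul (polyB_Wm (r + σ))
  unfold Xc
  refine (Finset.abs_sum_le_sum_abs _ _).trans ?_
  have : ∀ i ∈ (Finset.univ : Finset (Fin d)), |(sip (Wm r * a) (Sj σ i * (Wm (r + σ) * b i))).re| ≤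
      sN2 (Wm r * a) * sN2 (Wm (r + σ) * b i) := by
    intro i _
    refine (sip_re_le rA ((rB i).mul (polyB_Sj hσ1 i))).trans ?_
    exact mul_le_mul_of_nonneg_left (S_le hσ1 (rB i) i) (sN2_nonneg _)
  refine (Finset.sum_le_sum this).trans ((cross_le hd _ _).trans ?_)
  unfold Eq2
  have h1 : (1:ℝ) ≤ d := by exact_mod_cast hd
  nlinarith [sq_nonneg (sN2 (Wm r * a))]

lemma lowX_est (hd : 0 < d) (hr : 0 ≤ r) (hσ : 0 < σ) (hσ1 : σ < 1) (h : Good a b) (h0 : a 0 = 0) :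
    lowX σ r a b ≤ 3 / 2 * d * ∑ i, sN2 (Wm (r + σ) * b i) ^ 2 - 1 / 2 * sN2 (Wm r * a) ^ 2
      + 2 * d * (d * (Kr r * (Lq a b * √(Eq2 σ (r + 1) a b)))) * √(Eq2 σ r a b) := by
  have ra := h.ra
  have rb := h.rb
  have rA := ra.mul (polyB_Wm r)
  have rB := fun j => (rb j).mul (polyB_Wm (r + σ))
  have rDA := fun i => rA.mul (polyB_Dj σ i)
  have rDB := fun i => (rB i).mul (polyB_Dj σ i)
  have rSB := fun i => (rB i).mul (polyB_Sj hσ1 i)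
  have rSDA := fun i => (rDA i).mul (polyB_Sj hσ1 i)
  obtain ⟨P, hP, hPb, eP⟩ := Fa_low hr hσ h
  choose Q hQ hQb eQ using fun i => Fb_low hr hσ hσ1 h i
  have rSQ := fun i => (hQ i).mul (polyB_Sj hσ1 i)
  set M := d * (Kr r * (Lq a b * √(Eq2 σ (r + 1) a b))) with hM
  set N := √(Eq2 σ r a b) with hN
  have hN0 : 0 ≤ N := Real.sqrt_nonneg _
  have hM0 : 0 ≤ M := (sN2_nonneg P).trans hPb
  have nA : sN2 (Wm r * a) ≤ N := Na_le
  have nB : ∀ i, sN2 (Wm (r + σ) * b i) ≤ N := fun i => Nb_le i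
  have nSB : ∀ i, sN2 (Sj σ i * (Wm (r + σ) * b i)) ≤ sN2 (Wm (r + σ) * b i) := fun i => S_le hσ1 (rB i) i
  -- first half
  have e1 : ∀ i ∈ (Finset.univ : Finset (Fin d)), (sip (Wm r * Fa a b) (Sj σ i * (Wm (r + σ) * b i))).re ≤
      (∑ j, 1 / 2 * (sN2 (Wm (r + σ) * b i) ^ 2 + sN2 (Wm (r + σ) * b j) ^ 2)) + M * N := by
    intro i _
    rw [sip_re_comm, eP, sip_sub_right (rSB i) (rapid_sum _ rDB).neg hP, sip_neg_right,
      sip_sum_right _ (rSB i) rDB]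
    simp only [Complex.sub_re, Complex.neg_re, Complex.re_sum]
    have h1 := sip_re_le (rSB i) hP
    have h2 := neg_abs_le (sip (Sj σ i * (Wm (r + σ) * b i)) P).re
    have h3 : sN2 (Sj σ i * (Wm (r + σ) * b i)) * sN2 P ≤ N * M := by
      have := sN2_nonneg P
      have := (nSB i).trans (nB i)
      gcongr
    have h4 : -∑ j, (sip (Sj σ i * (Wm (r + σ) * b i)) (Dj σ j * (Wm (r + σ) * b j))).re ≤
        ∑ j, 1 / 2 * (sN2 (Wm (r + σ) * b i) ^ 2 + sN2 (Wm (r + σ) * b j) ^ 2) := by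
      rw [← Finset.sum_neg_distrib]
      refine Finset.sum_le_sum fun j _ => ?_
      rw [D_move, neg_neg]
      have k1 := sip_re_le (rB j) ((rSB i).mul (polyB_Dj σ j))
      have k2 : sN2 (Dj σ j * (Sj σ i * (Wm (r + σ) * b i))) ≤ sN2 (Wm (r + σ) * b i) := by
        have := sN2_le (f := Dj σ j * (Sj σ i * (Wm (r + σ) * b i))) (rB i) zero_le_one fun n => ?_
        · simpa using this
        rw [← mul_assoc, Pi.mul_apply, norm_mul]
        exact mul_le_mul_of_nonneg_right (norm_DS_le σ i j n) (norm_nonneg _)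
      have k3 := mul_le_mul_of_nonneg_left k2 (sN2_nonneg (Wm (r + σ) * b j))
      have k4 := le_abs_self (sip (Wm (r + σ) * b j) (Dj σ j * (Sj σ i * (Wm (r + σ) * b i)))).re
      nlinarith [sq_nonneg (sN2 (Wm (r + σ) * b i) - sN2 (Wm (r + σ) * b j))]
    linarith
  have e2 : ∀ i ∈ (Finset.univ : Finset (Fin d)),
      (sip (Wm r * a) (Sj σ i * (Wm (r + σ) * Fb σ a b i))).re ≤
      sN2 (Wm r * a) * sN2 (Wm (r + σ) * b i)
        - (sip (Wm r * a) (Sj σ i * (Dj σ i * (Wm r * a)))).re + M * N := by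
    intro i _
    rw [eQ, mul_sub, mul_sub, mul_neg, sip_sub_right rA ((rSB i).neg.sub (rSDA i)) (rSQ i),
      sip_sub_right rA (rSB i).neg (rSDA i), sip_neg_right]
    simp only [Complex.sub_re, Complex.neg_re]
    have h1 := sip_re_le rA (rSQ i)
    have h2 := neg_abs_le (sip (Wm r * a) (Sj σ i * Q i)).re
    have h3 : sN2 (Wm r * a) * sN2 (Sj σ i * Q i) ≤ N * M := by
      have := sN2_nonneg (Sj σ i * Q i)
      have := (S_le hσ1 (hQ i) i).trans (hQb i)
      gcongr
    have h4 := sip_re_le rA (rSB i)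
    have h5 := neg_abs_le (sip (Wm r * a) (Sj σ i * (Wm (r + σ) * b i))).re
    have h6 := mul_le_mul_of_nonneg_left (nSB i) (sN2_nonneg (Wm r * a))
    linarith
  have e3 := Finset.sum_le_sum e1
  have e4 := Finset.sum_le_sum e2
  have e5 : ∑ i, (sip (Wm r * a) (Sj σ i * (Dj σ i * (Wm r * a)))).re = sN2 (Wm r * a) ^ 2 := by
    rw [← Complex.re_sum, ← sip_sum_right _ rA rSDA, sum_SD (by simp [h0]), sip_self_re]
  have e6 := cross_le hd (sN2 (Wm r * a)) (fun i => sN2 (Wm (r + σ) * b i))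
  unfold lowX
  rw [Finset.sum_add_distrib]
  simp only [Finset.sum_add_distrib, Finset.sum_sub_distrib, e5, ← Finset.mul_sum, Finset.sum_const,
    Finset.card_univ, Fintype.card_fin, nsmul_eq_mul] at e3 e4 e6 ⊢
  linarith

lemma low_est (hd : 0 < d) (hr : 0 ≤ r) (hσ : 0 < σ) (hσ1 : σ < 1) (h : Good a b) (h0 : a 0 = 0) :
    lowE σ r a b + 1 / (2 * d) * lowX σ r a b ≤ -(1 / (4 * d)) * Eq2 σ r a b
      + ((3 + 2 * d) * d * Kr r) * (Lq a b * √(Eq2 σ (r + 1) a b) * √(Eq2 σ r a b)) := by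
  have hd' : (1:ℝ) ≤ d := by exact_mod_cast hd
  have h1 := lowE_est hr hσ hσ1 h
  have h2 := lowX_est hd hr hσ hσ1 h h0
  have h3 := mul_le_mul_of_nonneg_left h2 (by positivity : (0:ℝ) ≤ 1 / (2 * d))
  have hB : 0 ≤ ∑ i, sN2 (Wm (r + σ) * b i) ^ 2 := Finset.sum_nonneg fun _ _ => sq_nonneg _
  refine (add_le_add h1 h3).trans ?_
  unfold Eq2 at *
  set SB := ∑ i, sN2 (Wm (r + σ) * b i) ^ 2
  set NA := sN2 (Wm r * a) ^ 2
  have hq : (1:ℝ) / (4 * d) * SB ≤ 1 / 4 * SB := by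
    gcongr
    linarith
  have e : ∀ Z : ℝ, (1:ℝ) / (2 * d) * (3 / 2 * d * SB - 1 / 2 * NA + Z) = 3 / 4 * SB - 1 / (4 * d) * NA + 1 / (2 * d) * Z := by
    intro Z; field_simp; ring
  have e2 : ∀ x y : ℝ, 1 / (2 * d) * (2 * d * x * y) = x * y := by
    intro x y; field_simp
  rw [e, e2]
  linarith

lemma Y_equiv (hd : 0 < d) (hσ1 : σ < 1) (h : Good a b) :
    3 / 4 * Eq2 σ r a b ≤ Eq2 σ r a b + 1 / (2 * d) * Xc σ r a b ∧
    Eq2 σ r a b + 1 / (2 * d) * Xc σ r a b ≤ 5 / 4 * Eq2 σ r a b := by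
  have hd' : (0:ℝ) < d := by exact_mod_cast hd
  have h1 := Xc_le (r := r) hd hσ1 h
  have h2 : 1 / (2 * d) * |Xc σ r a b| ≤ 1 / 4 * Eq2 σ r a b := by
    calc _ ≤ 1 / (2 * d) * (d / 2 * Eq2 σ r a b) := by gcongr
      _ = _ := by field_simp; ring
  have h3 : 1 / (2 * d) * Xc σ r a b ≤ 1 / (2 * d) * |Xc σ r a b| := by gcongr; exact le_abs_self _
  have h4 : -(1 / (2 * d) * |Xc σ r a b|) ≤ 1 / (2 * d) * Xc σ r a b := by
    rw [← mul_neg]; gcongr; exact neg_abs_le _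
  constructor <;> linarith

/-- modified top order energy -/
def Et (σ s : ℝ) (a : Sq d) (b : Fin d → Sq d) : ℝ :=
  1 / 2 * sN2 (Wm s * a) ^ 2 + ∑ i, (1 / 2 * sN2 (Wm (s + σ) * b i) ^ 2
    + 1 / 2 * (sip (Wm (s + σ) * b i) (sconv a (Wm (s + σ) * b i))).re)

lemma Et_equiv (h : Good a b) : |Et σ s a b - 1 / 2 * Eq2 σ s a b| ≤ 1 / 2 * Lq a b * Eq2 σ s a b := by
  have rB := fun j => (h.rb j).mul (polyB_Wm (s + σ))
  have e : Et σ s a b - 1 / 2 * Eq2 σ s a b =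
      ∑ i, 1 / 2 * (sip (Wm (s + σ) * b i) (sconv a (Wm (s + σ) * b i))).re := by
    unfold Et Eq2
    rw [Finset.sum_add_distrib, ← Finset.mul_sum]; ring
  rw [e]
  refine (Finset.abs_sum_le_sum_abs _ _).trans ?_
  have : ∀ i ∈ (Finset.univ : Finset (Fin d)),
      |1 / 2 * (sip (Wm (s + σ) * b i) (sconv a (Wm (s + σ) * b i))).re| ≤
      1 / 2 * Lq a b * sN2 (Wm (s + σ) * b i) ^ 2 := by
    intro i _
    rw [abs_mul, abs_of_pos (by norm_num : (0:ℝ) < 1 / 2)]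
    have h1 := sip_re_le (rB i) (h.ra.conv (rB i))
    have h2 := sN2_conv_le h.ra (rB i)
    have l1 : sN1 a ≤ Lq a b := (sN1_le_W h.ra).trans La_le
    have p := sN2_nonneg (Wm (s + σ) * b i)
    have h3 : sN2 (Wm (s + σ) * b i) * sN2 (sconv a (Wm (s + σ) * b i)) ≤
        sN2 (Wm (s + σ) * b i) * (Lq a b * sN2 (Wm (s + σ) * b i)) := by
      gcongr
      refine h2.trans ?_
      gcongr
    nlinarith
  refine (Finset.sum_le_sum this).trans ?_
  rw [← Finset.mul_sum]
  unfold Eq2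
  have : 0 ≤ Lq a b := Lq_nonneg
  have := sq_nonneg (sN2 (Wm s * a))
  gcongr
  linarith

lemma cs_Jw (p : ℝ) (hp : 2 * p < -d) : ∃ S : ℝ, 0 ≤ S ∧ ∀ G : Sq d, Rapid G →
    ∑' n, Jw n ^ p * ‖G n‖ ≤ S * sN2 G := by
  have hsum : Summable (fun n : Fin d → ℤ => (Jw n ^ p) ^ 2) := by
    have := summable_Jw_rpow (d := d) (r := 2 * p) hp
    refine this.congr fun n => ?_
    rw [← Real.rpow_natCast, ← Real.rpow_mul (Jw_pos n).le]; congr 1; push_cast; ring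
  refine ⟨√(∑' n : Fin d → ℤ, (Jw n ^ p) ^ 2), Real.sqrt_nonneg _, fun G hG => ?_⟩
  have h1 : ∀ n : Fin d → ℤ, 0 ≤ Jw n ^ p := fun n => Real.rpow_nonneg (Jw_pos n).le _
  have h2 : ∀ n, 0 ≤ ‖G n‖ := fun n => norm_nonneg _
  exact (cs_tsum h1 h2 hsum hG.summable_sq).2

/-- Sobolev embedding -/
lemma Lq_le (hr : (d : ℝ) / 2 + 1 < r) (hσ : 0 < σ) : ∃ C : ℝ, 0 < C ∧ ∀ (a : Sq d) (b : Fin d → Sq d), Good a b →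
    Lq a b ≤ C * √(Eq2 σ r a b) := by
  obtain ⟨S, hS0, hS⟩ := cs_Jw (d := d) (1 - r) (by linarith)
  have key : ∀ f : Sq d, Rapid f → sN1 (Wm 1 * f) ≤ S * sN2 (Wm r * f) := by
    intro f hf
    refine le_trans (le_of_eq ?_) (hS _ (hf.mul (polyB_Wm r)))
    unfold sN1
    congr 1; funext n
    simp only [Pi.mul_apply, norm_mul, norm_Wm]
    rw [← mul_assoc, ← Real.rpow_add (Jw_pos n)]
    congr 2; ring
  refine ⟨S + d * S + 1, by positivity, fun a b h => ?_⟩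
  have n1 : sN2 (Wm r * a) ≤ √(Eq2 σ r a b) := Na_le
  have h1 : sN1 (Wm 1 * a) ≤ S * √(Eq2 σ r a b) := (key a h.ra).trans (by gcongr)
  have h2 : ∑ i, sN1 (Wm 1 * b i) ≤ d * (S * √(Eq2 σ r a b)) := by
    refine (Finset.sum_le_card_nsmul _ _ (S * √(Eq2 σ r a b)) fun i _ => ?_).trans (le_of_eq (by simp))
    refine (key _ (h.rb i)).trans ?_
    gcongr
    exact (sN2_W_mono (h.rb i) (by linarith)).trans (Nb_le i)
  unfold Lq
  have := Real.sqrt_nonneg (Eq2 σ r a b)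
  nlinarith

end


/-! ### Time dependent sequences -/

open ComplexConjugate

def LRapid (f : ℝ → Sq d) : Prop :=
  ∀ T : ℝ, ∃ g : Sq d, Rapid g ∧ ∀ t ∈ Set.Icc (0:ℝ) T, ∀ n, ‖f t n‖ ≤ ‖g n‖

lemma rapid_of_le {f g : Sq d} (hg : Rapid g) (h : ∀ n, ‖f n‖ ≤ ‖g n‖) : Rapid f := by
  intro K
  obtain ⟨C, hC⟩ := hg K
  refine ⟨C, fun n => le_trans ?_ (hC n)⟩
  have := Jw_pos n
  gcongr
  exact h n

def nrm (f : Sq d) : Sq d := fun n => ((‖f n‖ : ℝ) : ℂ)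
lemma norm_nrm (f : Sq d) (n) : ‖nrm f n‖ = ‖f n‖ := by simp [nrm]
lemma Rapid.nrm {f : Sq d} (h : Rapid f) : Rapid (nrm f) :=
  rapid_of_le h fun n => (norm_nrm f n).le

lemma LRapid.rapid {f : ℝ → Sq d} (h : LRapid f) {t : ℝ} (ht : 0 ≤ t) : Rapid (f t) := by
  obtain ⟨g, hg, hb⟩ := h t
  exact rapid_of_le hg (hb t ⟨ht, le_rfl⟩)

lemma LRapid.mul {f : ℝ → Sq d} (h : LRapid f) {w : Sq d} (hw : PolyB w) : LRapid (fun t => w * f t) := by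
  intro T
  obtain ⟨g, hg, hb⟩ := h T
  refine ⟨w * g, hg.mul hw, fun t ht n => ?_⟩
  simp only [Pi.mul_apply, norm_mul]
  gcongr
  exact hb t ht n

lemma LRapid.add {f g : ℝ → Sq d} (hf : LRapid f) (hg : LRapid g) : LRapid (fun t => f t + g t) := by
  intro T
  obtain ⟨F, hF, hFb⟩ := hf T
  obtain ⟨G, hG, hGb⟩ := hg T
  refine ⟨nrm F + nrm G, hF.nrm.add hG.nrm, fun t ht n => ?_⟩
  refine (norm_add_le _ _).trans ((add_le_add (hFb t ht n) (hGb t ht n)).trans (le_of_eq ?_))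
  simp only [nrm, Pi.add_apply, ← Complex.ofReal_add, Complex.norm_real]
  rw [Real.norm_of_nonneg (by positivity)]

lemma LRapid.neg {f : ℝ → Sq d} (hf : LRapid f) : LRapid (fun t => - f t) := by
  intro T
  obtain ⟨F, hF, hFb⟩ := hf T
  exact ⟨F, hF, fun t ht n => by simpa using hFb t ht n⟩

lemma LRapid.sub {f g : ℝ → Sq d} (hf : LRapid f) (hg : LRapid g) : LRapid (fun t => f t - g t) := by
  simp only [sub_eq_add_neg]; exact hf.add hg.neg

lemma lrapid_sum {α : Type*} {f : α → ℝ → Sq d} (s : Finset α) (hf : ∀ i, LRapid (f i)) :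
    LRapid (fun t => ∑ i ∈ s, f i t) := by
  classical
  induction s using Finset.induction_on with
  | empty => intro T; exact ⟨0, rapid_zero, by simp⟩
  | insert i s hi ih => simp only [Finset.sum_insert hi]; exact (hf i).add ih

lemma LRapid.conv {f g : ℝ → Sq d} (hf : LRapid f) (hg : LRapid g) : LRapid (fun t => sconv (f t) (g t)) := by
  intro T
  obtain ⟨F, hF, hFb⟩ := hf T
  obtain ⟨G, hG, hGb⟩ := hg T
  refine ⟨sconv (nrm F) (nrm G), hF.nrm.conv hG.nrm, fun t ht n => ?_⟩
  have hs := (sconv_summable hF.nrm hG.nrm n)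
  have e : sconv (nrm F) (nrm G) n = ((∑' k, ‖F (n - k)‖ * ‖G k‖ : ℝ) : ℂ) := by
    rw [Complex.ofReal_tsum]; simp [sconv, nrm]
  have hs' : Summable (fun k => ‖F (n - k)‖ * ‖G k‖) := by
    have := hs.norm
    simpa [norm_nrm] using this
  rw [e, Complex.norm_real, Real.norm_of_nonneg (by positivity)]
  refine tsum_of_norm_bounded hs'.hasSum fun k => ?_
  rw [norm_mul]
  gcongr
  · exact hFb t ht _
  · exact hGb t ht _

structure Smth (f f' : ℝ → Sq d) : Prop where
  l : LRapid f
  l' : LRapid f'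
  hd : ∀ t, 0 < t → ∀ n, HasDerivAt (fun t => f t n) (f' t n) t
  hc : ∀ n, ContinuousOn (fun t => f t n) (Set.Ici 0)

lemma Smth.mul {f f' : ℝ → Sq d} (h : Smth f f') {w : Sq d} (hw : PolyB w) :
    Smth (fun t => w * f t) (fun t => w * f' t) where
  l := h.l.mul hw
  l' := h.l'.mul hw
  hd t ht n := (h.hd t ht n).const_mul (w n)
  hc n := continuousOn_const.mul (h.hc n)

/-- differentiation of a bilinear series -/
lemma hasDerivAt_tsum_bil {F F' : ℝ → Sq d} {u : (Fin d → ℤ) → ℝ} (hu : Summable u) {T t : ℝ}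
    (ht : t ∈ Set.Ioo 0 T) (hF : ∀ n, ∀ s ∈ Set.Ioo 0 T, HasDerivAt (fun s => F s n) (F' s n) s)
    (hb : ∀ n, ∀ s ∈ Set.Ioo 0 T, ‖F' s n‖ ≤ u n) (hs : Summable (F t)) :
    HasDerivAt (fun s => ∑' n, F s n) (∑' n, F' t n) t :=
  hasDerivAt_tsum_of_isPreconnected (g := fun n s => F s n) (g' := fun n s => F' s n)
    hu isOpen_Ioo isPreconnected_Ioo hF hb ht hs ht

lemma Smth.conv {f f' g g' : ℝ → Sq d} (hf : Smth f f') (hg : Smth g g') :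
    Smth (fun t => sconv (f t) (g t)) (fun t => sconv (f' t) (g t) + sconv (f t) (g' t)) where
  l := hf.l.conv hg.l
  l' := (hf.l'.conv hg.l).add (hf.l.conv hg.l')
  hd t ht n := by
    obtain ⟨F, hF, hFb⟩ := hf.l (t + 1)
    obtain ⟨F', hF', hFb'⟩ := hf.l' (t + 1)
    obtain ⟨G, hG, hGb⟩ := hg.l (t + 1)
    obtain ⟨G', hG', hGb'⟩ := hg.l' (t + 1)
    have s1 := (sconv_summable hF' hG n).norm
    have s2 := (sconv_summable hF hG' n).norm
    have rf := hf.l.rapid ht.le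
    have rf' := hf.l'.rapid ht.le
    have rg := hg.l.rapid ht.le
    have rg' := hg.l'.rapid ht.le
    have := hasDerivAt_tsum_bil (F := fun s k => f s (n - k) * g s k)
      (F' := fun s k => f' s (n - k) * g s k + f s (n - k) * g' s k) (s1.add s2)
      (T := t + 1) (t := t) ⟨ht, by linarith⟩
      (fun k s hs => (hf.hd s hs.1 _).mul (hg.hd s hs.1 _))
      (fun k s hs => by
        have hs' : s ∈ Set.Icc 0 (t + 1) := ⟨hs.1.le, hs.2.le⟩
        refine (norm_add_le _ _).trans ?_
        simp only [norm_mul]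
        gcongr
        · exact hFb' s hs' _
        · exact hGb s hs' _
        · exact hFb s hs' _
        · exact hGb' s hs' _)
      (sconv_summable rf rg n)
    rw [(sconv_summable rf' rg n).tsum_add (sconv_summable rf rg' n)] at this
    exact this
  hc n := by
    intro t ht
    have ht0 : 0 ≤ t := ht
    obtain ⟨F, hF, hFb⟩ := hf.l (t + 1)
    obtain ⟨G, hG, hGb⟩ := hg.l (t + 1)
    have s1 := (sconv_summable hF hG n).norm
    have hsub : Set.Icc 0 (t + 1) ⊆ Set.Ici (0:ℝ) := Set.Icc_subset_Ici_self
    have : ContinuousOn (fun s => ∑' k, f s (n - k) * g s k) (Set.Icc 0 (t + 1)) := by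
      refine continuousOn_tsum (fun k => ((hf.hc _).mono hsub).mul ((hg.hc _).mono hsub)) s1 ?_
      intro k s hs
      simp only [norm_mul]
      gcongr
      · exact hFb s hs _
      · exact hGb s hs _
    have h2 := this t ⟨ht0, by linarith⟩
    refine h2.mono_of_mem_nhdsWithin ?_
    exact mem_nhdsWithin.mpr ⟨Set.Iio (t + 1), isOpen_Iio, by simp, fun x hx => ⟨hx.2, le_of_lt hx.1⟩⟩

lemma Smth.sip_deriv {f f' g g' : ℝ → Sq d} (hf : Smth f f') (hg : Smth g g') {t : ℝ} (ht : 0 < t) :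
    HasDerivAt (fun t => (sip (f t) (g t)).re) ((sip (f' t) (g t)).re + (sip (f t) (g' t)).re) t := by
  obtain ⟨F, hF, hFb⟩ := hf.l (t + 1)
  obtain ⟨F', hF', hFb'⟩ := hf.l' (t + 1)
  obtain ⟨G, hG, hGb⟩ := hg.l (t + 1)
  obtain ⟨G', hG', hGb'⟩ := hg.l' (t + 1)
  have s1 := (sip_summable hF' hG).norm
  have s2 := (sip_summable hF hG').norm
  have rf := hf.l.rapid ht.le
  have rf' := hf.l'.rapid ht.le
  have rg := hg.l.rapid ht.le
  have rg' := hg.l'.rapid ht.le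
  have := hasDerivAt_tsum_bil (F := fun s k => conj (f s k) * g s k)
    (F' := fun s k => conj (f' s k) * g s k + conj (f s k) * g' s k) (s1.add s2)
    (T := t + 1) (t := t) ⟨ht, by linarith⟩
    (fun k s hs => by
      have h1 : HasDerivAt (fun s => conj (f s k)) (conj (f' s k)) s := (hf.hd s hs.1 k).star
      exact h1.mul (hg.hd s hs.1 _))
    (fun k s hs => by
      have hs' : s ∈ Set.Icc 0 (t + 1) := ⟨hs.1.le, hs.2.le⟩
      refine (norm_add_le _ _).trans ?_
      simp only [norm_mul, RCLike.norm_conj]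
      gcongr
      · exact hFb' s hs' _
      · exact hGb s hs' _
      · exact hFb s hs' _
      · exact hGb' s hs' _)
    (sip_summable rf rg)
  rw [(sip_summable rf' rg).tsum_add (sip_summable rf rg')] at this
  have h3 := Complex.reCLM.hasFDerivAt.comp_hasDerivAt t this
  exact h3

lemma Smth.sip_cont {f f' g g' : ℝ → Sq d} (hf : Smth f f') (hg : Smth g g') :
    ContinuousOn (fun t => (sip (f t) (g t)).re) (Set.Ici 0) := by
  intro t ht
  have ht0 : 0 ≤ t := ht
  obtain ⟨F, hF, hFb⟩ := hf.l (t + 1)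
  obtain ⟨G, hG, hGb⟩ := hg.l (t + 1)
  have s1 := (sip_summable hF hG).norm
  have hsub : Set.Icc 0 (t + 1) ⊆ Set.Ici (0:ℝ) := Set.Icc_subset_Ici_self
  have : ContinuousOn (fun s => ∑' k, conj (f s k) * g s k) (Set.Icc 0 (t + 1)) := by
    refine continuousOn_tsum (fun k => ?_) s1 ?_
    · have h1 := (hf.hc k).mono hsub
      exact (Complex.continuous_conj.comp_continuousOn h1).mul ((hg.hc _).mono hsub)
    intro k s hs
    simp only [norm_mul, RCLike.norm_conj]
    gcongr
    · exact hFb s hs _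
    · exact hGb s hs _
  have h2 := (Complex.continuous_re.comp_continuousOn this) t ⟨ht0, by linarith⟩
  refine ContinuousWithinAt.mono_of_mem_nhdsWithin h2 ?_
  exact mem_nhdsWithin.mpr ⟨Set.Iio (t + 1), isOpen_Iio, by simp, fun x hx => ⟨hx.2, le_of_lt hx.1⟩⟩

structure Sol (σ : ℝ) (a : ℝ → Sq d) (b : ℝ → Fin d → Sq d) : Prop where
  sa : Smth a (fun t => Fa (a t) (b t))
  sb : ∀ i, Smth (fun t => b t i) (fun t => Fb σ (a t) (b t) i)
  ha : ∀ t, 0 ≤ t → Herm (a t)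
  hb : ∀ t, 0 ≤ t → ∀ i, Herm (b t i)
  a0 : ∀ t, 0 ≤ t → a t 0 = 0

section
variable {a : ℝ → Sq d} {b : ℝ → Fin d → Sq d} {σ s r : ℝ}

lemma Sol.good (h : Sol σ a b) {t : ℝ} (ht : 0 ≤ t) : Good (a t) (b t) :=
  ⟨h.sa.l.rapid ht, fun i => (h.sb i).l.rapid ht, h.ha t ht, h.hb t ht⟩

lemma Sol.E_deriv (h : Sol σ a b) {t : ℝ} (ht : 0 < t) :
    HasDerivAt (fun t => Eq2 σ r (a t) (b t)) (lowE σ r (a t) (b t)) t := by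
  unfold Eq2 lowE
  simp only [← sip_self_re]
  have sA := h.sa.mul (polyB_Wm r)
  have sB := fun i => (h.sb i).mul (polyB_Wm (r + σ))
  refine HasDerivAt.add ?_ (HasDerivAt.fun_sum fun i _ => ?_)
  · refine (sA.sip_deriv sA ht).congr_deriv ?_
    rw [sip_re_comm]; ring
  · refine ((sB i).sip_deriv (sB i) ht).congr_deriv ?_
    rw [sip_re_comm]; ring

lemma Sol.E_cont (h : Sol σ a b) : ContinuousOn (fun t => Eq2 σ r (a t) (b t)) (Set.Ici 0) := by
  unfold Eq2
  simp only [← sip_self_re]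
  have sA := h.sa.mul (polyB_Wm r)
  have sB := fun i => (h.sb i).mul (polyB_Wm (r + σ))
  exact (sA.sip_cont sA).add (continuousOn_finsetSum _ fun i _ => (sB i).sip_cont (sB i))

lemma Sol.X_deriv (h : Sol σ a b) (hσ1 : σ < 1) {t : ℝ} (ht : 0 < t) :
    HasDerivAt (fun t => Xc σ r (a t) (b t)) (lowX σ r (a t) (b t)) t := by
  unfold Xc lowX
  have sA := h.sa.mul (polyB_Wm r)
  have sB := fun i => ((h.sb i).mul (polyB_Wm (r + σ))).mul (polyB_Sj hσ1 i)
  exact HasDerivAt.fun_sum fun i _ => sA.sip_deriv (sB i) ht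

lemma Sol.X_cont (h : Sol σ a b) (hσ1 : σ < 1) :
    ContinuousOn (fun t => Xc σ r (a t) (b t)) (Set.Ici 0) := by
  unfold Xc
  have sA := h.sa.mul (polyB_Wm r)
  have sB := fun i => ((h.sb i).mul (polyB_Wm (r + σ))).mul (polyB_Sj hσ1 i)
  exact continuousOn_finsetSum _ fun i _ => sA.sip_cont (sB i)

lemma Sol.Et_deriv (h : Sol σ a b) {t : ℝ} (ht : 0 < t) :
    HasDerivAt (fun t => Et σ s (a t) (b t)) (topQ σ s (a t) (b t)) t := by
  unfold Et topQ
  simp only [← sip_self_re]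
  have sA := h.sa.mul (polyB_Wm s)
  have sB := fun i => (h.sb i).mul (polyB_Wm (s + σ))
  have g := h.good ht.le
  refine HasDerivAt.add ?_ (HasDerivAt.fun_sum fun i _ => ?_)
  · refine ((sA.sip_deriv sA ht).const_mul (1 / 2)).congr_deriv ?_
    rw [sip_re_comm]; ring
  · refine ((((sB i).sip_deriv (sB i) ht).const_mul (1 / 2)).add
      (((sB i).sip_deriv (h.sa.conv (sB i)) ht).const_mul (1 / 2))).congr_deriv ?_
    have rB := (g.rb i).mul (polyB_Wm (s + σ))
    have rB' := (g.rFb (σ := σ) i).mul (polyB_Wm (s + σ))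
    rw [sip_add_right rB (g.rFa.conv rB) (g.ra.conv rB'), sip_conv g.ra rB rB' g.ha,
      sip_re_comm (Wm (s + σ) * Fb σ (a t) (b t) i) (Wm (s + σ) * b t i),
      sip_re_comm (Wm (s + σ) * Fb σ (a t) (b t) i)]
    rw [Complex.add_re]
    ring

lemma Sol.Et_cont (h : Sol σ a b) : ContinuousOn (fun t => Et σ s (a t) (b t)) (Set.Ici 0) := by
  unfold Et
  simp only [← sip_self_re]
  have sA := h.sa.mul (polyB_Wm s)
  have sB := fun i => (h.sb i).mul (polyB_Wm (s + σ))
  exact (continuousOn_const.mul (sA.sip_cont sA)).add (continuousOn_finsetSum _ fun i _ =>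
    (continuousOn_const.mul ((sB i).sip_cont (sB i))).add
    (continuousOn_const.mul ((sB i).sip_cont (h.sa.conv (sB i)))))

end


/-! ### Bootstrap argument -/

lemma gron {f f' g g' : ℝ → ℝ} {T : ℝ} (hT : 0 ≤ T) (hf : ContinuousOn f (Set.Icc 0 T))
    (hf' : ∀ t ∈ Set.Ioo 0 T, HasDerivAt f (f' t) t) (hg : ∀ t, HasDerivAt g (g' t) t)
    (h : ∀ t ∈ Set.Ioo 0 T, f' t ≤ g' t * f t) :
    f T * Real.exp (-g T) ≤ f 0 * Real.exp (-g 0) := by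
  have hgc : Continuous g := continuous_iff_continuousAt.mpr fun t => (hg t).continuousAt
  have hd : ∀ t ∈ Set.Ioo 0 T, HasDerivAt (fun t => f t * Real.exp (-g t))
      (f' t * Real.exp (-g t) + f t * (Real.exp (-g t) * -g' t)) t := fun t ht =>
    (hf' t ht).mul (hg t).neg.exp
  have := antitoneOn_of_deriv_nonpos (convex_Icc 0 T) (f := fun t => f t * Real.exp (-g t))
    (hf.mul (Real.continuous_exp.comp hgc.neg).continuousOn)
    (by
      rw [interior_Icc]
      exact fun t ht => (hd t ht).differentiableAt.differentiableWithinAt)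
    (by
      rw [interior_Icc]
      intro t ht
      rw [(hd t ht).deriv]
      have := h t ht
      have he := Real.exp_pos (-g t)
      nlinarith)
  exact this ⟨le_rfl, hT⟩ ⟨hT, le_rfl⟩ hT

section
variable {a : ℝ → Sq d} {b : ℝ → Fin d → Sq d} {σ s r : ℝ}

lemma Eq2_mono {a : Sq d} {b : Fin d → Sq d} (h : Good a b) {p q : ℝ} (hpq : p ≤ q) :
    Eq2 σ p a b ≤ Eq2 σ q a b := by
  unfold Eq2
  refine add_le_add ?_ (Finset.sum_le_sum fun i _ => ?_)
  · exact pow_le_pow_left₀ (sN2_nonneg _) (sN2_W_mono h.ra hpq) 2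
  · exact pow_le_pow_left₀ (sN2_nonneg _) (sN2_W_mono (h.rb i) (by linarith)) 2

/-- exponential decay of the low order energy as long as the high order energy is small -/
lemma low_decay (hd : 0 < d) (hσ : 0 < σ) (hσ1 : σ < 1) (hr : 0 ≤ r) {CL δ : ℝ} (hCL : 0 < CL)
    (hL : ∀ (a : Sq d) (b : Fin d → Sq d), Good a b → Lq a b ≤ CL * √(Eq2 σ r a b))
    (hδ : ((3 + 2 * d) * d * Kr r) * CL * δ ≤ 1 / (8 * d)) (hδ0 : 0 ≤ δ)
    (h : Sol σ a b) {T : ℝ} (hT : 0 ≤ T)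
    (hE : ∀ t ∈ Set.Ico 0 T, √(Eq2 σ (r + 1) (a t) (b t)) ≤ δ) :
    Eq2 σ r (a T) (b T) ≤ 4 * Eq2 σ r (a 0) (b 0) * Real.exp (-(1 / (10 * d)) * T) := by
  have hd' : (0:ℝ) < d := by exact_mod_cast hd
  have hK : 0 ≤ ((3 + 2 * d) * d * Kr r) := by have := Real.pi_pos; unfold Kr; positivity
  have key := gron (f := fun t => Eq2 σ r (a t) (b t) + 1 / (2 * d) * Xc σ r (a t) (b t))
    (f' := fun t => lowE σ r (a t) (b t) + 1 / (2 * d) * lowX σ r (a t) (b t))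
    (g := fun t => -(1 / (10 * d)) * t) (g' := fun t => -(1 / (10 * d))) hT
    ((h.E_cont.add (continuousOn_const.mul (h.X_cont hσ1))).mono Set.Icc_subset_Ici_self)
    (fun t ht => (h.E_deriv ht.1).add ((h.X_deriv hσ1 ht.1).const_mul _))
    (fun t => by simpa using (hasDerivAt_id t).const_mul (-(1 / (10 * (d:ℝ)))))
    (fun t ht => by
      have g := h.good ht.1.le
      have h1 := low_est hd hr hσ hσ1 g (h.a0 t ht.1.le)
      have h2 := hL _ _ g
      have h3 := hE t ⟨ht.1.le, ht.2⟩
      have h4 := (Y_equiv (r := r) hd hσ1 g).2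
      have hE0 : 0 ≤ Eq2 σ r (a t) (b t) := Eq2_nonneg
      have hsq : √(Eq2 σ r (a t) (b t)) * √(Eq2 σ r (a t) (b t)) = Eq2 σ r (a t) (b t) := Real.mul_self_sqrt hE0
      have h5 : ((3 + 2 * d) * d * Kr r) * (Lq (a t) (b t) * √(Eq2 σ (r + 1) (a t) (b t)) * √(Eq2 σ r (a t) (b t)))
          ≤ 1 / (8 * d) * Eq2 σ r (a t) (b t) := by
        calc _ ≤ ((3 + 2 * d) * d * Kr r) * (CL * √(Eq2 σ r (a t) (b t)) * δ * √(Eq2 σ r (a t) (b t))) := by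
              gcongr
          _ = ((3 + 2 * d) * d * Kr r) * CL * δ * (√(Eq2 σ r (a t) (b t)) * √(Eq2 σ r (a t) (b t))) := by ring
          _ ≤ _ := by rw [hsq]; gcongr
      have h6 : 1 / (10 * d) * (Eq2 σ r (a t) (b t) + 1 / (2 * d) * Xc σ r (a t) (b t)) ≤
          1 / (8 * d) * Eq2 σ r (a t) (b t) := by
        calc _ ≤ 1 / (10 * d) * (5 / 4 * Eq2 σ r (a t) (b t)) := by gcongr
          _ = _ := by field_simp; ring
      have h7 : 1 / (4 * d) * Eq2 σ r (a t) (b t) = 2 * (1 / (8 * d) * Eq2 σ r (a t) (b t)) := by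
        field_simp; ring
      linarith)
  simp only [mul_zero, neg_zero, Real.exp_zero, mul_one] at key
  have y1 := (Y_equiv (r := r) hd hσ1 (h.good hT)).1
  have y2 := (Y_equiv (r := r) hd hσ1 (h.good le_rfl)).2
  have hE0 : 0 ≤ Eq2 σ r (a 0) (b 0) := Eq2_nonneg
  have he := Real.exp_pos (-(1 / (10 * d)) * T)
  have he2 : Real.exp (-(-(1 / (10 * d)) * T)) * Real.exp (-(1 / (10 * d)) * T) = 1 := by
    rw [← Real.exp_add]; simp
  have k2 := mul_le_mul_of_nonneg_right key he.le
  rw [mul_assoc, he2, mul_one] at k2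
  have k3 := mul_le_mul_of_nonneg_right y2 he.le
  have k4 := mul_nonneg hE0 he.le
  nlinarith

lemma top_growth (hσ : 0 < σ) (hσ1 : σ < 1) (hs : 1 ≤ s) (h : Sol σ a b) {T : ℝ} (hT : 0 ≤ T)
    {Λ lam : ℝ} (hlam : 0 < lam) (hΛ : 0 ≤ Λ)
    (hL : ∀ t ∈ Set.Icc 0 T, Lq (a t) (b t) ≤ Λ * Real.exp (-lam * t))
    (hL2 : ∀ t ∈ Set.Icc 0 T, Lq (a t) (b t) ≤ 1 / 2) :
    Eq2 σ s (a T) (b T) ≤ 3 * Eq2 σ s (a 0) (b 0) *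
      Real.exp (6 * (d * (1 + 7 * π + K1 s + d * (5 * π + 2 * K2 σ s))) * Λ / lam) := by
  set K := (d * (1 + 7 * π + K1 s + d * (5 * π + 2 * K2 σ s))) with hKd
  have hK : 0 ≤ K := by
    have hpi := Real.pi_pos
    have hK2 := K2_nonneg hs hσ
    have hK1 : 0 ≤ K1 s := by unfold K1; positivity
    positivity
  have eqv : ∀ t ∈ Set.Icc 0 T, 1 / 4 * Eq2 σ s (a t) (b t) ≤ Et σ s (a t) (b t) ∧
      Et σ s (a t) (b t) ≤ 3 / 4 * Eq2 σ s (a t) (b t) := by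
    intro t ht
    have e := Et_equiv (σ := σ) (s := s) (h.good ht.1)
    have hl := hL2 t ht
    have hE0 : 0 ≤ Eq2 σ s (a t) (b t) := Eq2_nonneg
    have h1 : 1 / 2 * Lq (a t) (b t) * Eq2 σ s (a t) (b t) ≤ 1 / 4 * Eq2 σ s (a t) (b t) := by
      nlinarith
    rw [abs_le] at e
    constructor <;> linarith [e.1, e.2]
  have key := gron (f := fun t => Et σ s (a t) (b t)) (f' := fun t => topQ σ s (a t) (b t))
    (g := fun t => -(6 * K * Λ / lam) * Real.exp (-lam * t))
    (g' := fun t => 6 * K * Λ * Real.exp (-lam * t)) hT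
    (h.Et_cont.mono Set.Icc_subset_Ici_self) (fun t ht => h.Et_deriv ht.1)
    (fun t => by
      have h1 : HasDerivAt (fun t : ℝ => -lam * t) (-lam) t := by
        simpa using (hasDerivAt_id t).const_mul (-lam)
      refine (h1.exp.const_mul (-(6 * K * Λ / lam))).congr_deriv ?_
      field_simp)
    (fun t ht => by
      have ht' : t ∈ Set.Icc 0 T := ⟨ht.1.le, ht.2.le⟩
      have h1 := top_est (s := s) hs hσ hσ1 (h.good ht.1.le)
      have hE0 : 0 ≤ Eq2 σ s (a t) (b t) := Eq2_nonneg
      have hl := hL2 t ht'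
      have hl2 := hL t ht'
      have hl0 : 0 ≤ Lq (a t) (b t) := Lq_nonneg
      have e := (eqv t ht').1
      refine h1.trans ?_
      have h2 : (Lq (a t) (b t) + Lq (a t) (b t) ^ 2) ≤ 3 / 2 * (Λ * Real.exp (-lam * t)) := by nlinarith
      calc K * ((Lq (a t) (b t) + Lq (a t) (b t) ^ 2) * Eq2 σ s (a t) (b t))
          ≤ K * ((3 / 2 * (Λ * Real.exp (-lam * t))) * (4 * Et σ s (a t) (b t))) := by
            gcongr
            linarith
        _ = _ := by ring)
  simp only [mul_zero, Real.exp_zero, mul_one, neg_neg] at key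
  have e1 := (eqv T ⟨hT, le_rfl⟩).1
  have e2 := (eqv 0 ⟨le_rfl, hT⟩).2
  have p1 : 0 ≤ Et σ s (a T) (b T) := le_trans (mul_nonneg (by norm_num) Eq2_nonneg) e1
  have p2 : 1 ≤ Real.exp (-(-(6 * K * Λ / lam) * Real.exp (-lam * T))) := by
    apply Real.one_le_exp
    rw [neg_mul, neg_neg]; positivity
  have p3 : Et σ s (a T) (b T) ≤ Et σ s (a 0) (b 0) * Real.exp (6 * K * Λ / lam) := by
    refine le_trans ?_ key
    exact le_mul_of_one_le_right p1 p2
  have p4 := mul_le_mul_of_nonneg_right e2 (Real.exp_pos (6 * K * Λ / lam)).le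
  linarith

lemma interp {a : Sq d} {b : Fin d → Sq d} (h : Good a b) :
    Eq2 σ (r + 1) a b ≤ (1 + d) * (√(Eq2 σ r a b) * √(Eq2 σ (r + 2) a b)) := by
  have key : ∀ (f : Sq d) (p : ℝ), Rapid f → sN2 (Wm (p + 1) * f) ^ 2 ≤ sN2 (Wm p * f) * sN2 (Wm (p + 2) * f) := by
    intro f p hf
    have e : sip (Wm (p + 1) * f) (Wm (p + 1) * f) = sip (Wm p * f) (Wm (p + 2) * f) := by
      unfold sip
      congr 1; funext n
      have e1 : (Wm (p + 1) n * Wm (p + 1) n : ℂ) = Wm p n * Wm (p + 2) n := by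
        have h1 := congrFun (Wm_mul (d := d) (p + 1) (p + 1)) n
        have h2 := congrFun (Wm_mul (d := d) p (p + 2)) n
        simp only [Pi.mul_apply] at h1 h2
        rw [h1, h2]; congr 1; ring
      have e2 : ∀ q : ℝ, (starRingEnd ℂ) ((Wm q : Sq d) n) = Wm q n := fun q => by simp [Wm]
      simp only [Pi.mul_apply, map_mul, e2]
      linear_combination (starRingEnd ℂ (f n) * f n) * e1
    rw [← sip_self_re, e]
    exact (le_abs_self _).trans (sip_re_le (hf.mul (polyB_Wm _)) (hf.mul (polyB_Wm _)))
  have k1 : sN2 (Wm (r + 1) * a) ^ 2 ≤ √(Eq2 σ r a b) * √(Eq2 σ (r + 2) a b) := by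
    refine (key a r h.ra).trans ?_
    have n1 : sN2 (Wm r * a) ≤ √(Eq2 σ r a b) := Na_le
    have n2 : sN2 (Wm (r + 2) * a) ≤ √(Eq2 σ (r + 2) a b) := Na_le
    have := sN2_nonneg (Wm (r + 2) * a)
    gcongr
  have k2 : ∑ i, sN2 (Wm (r + 1 + σ) * b i) ^ 2 ≤ d * (√(Eq2 σ r a b) * √(Eq2 σ (r + 2) a b)) := by
    refine (Finset.sum_le_card_nsmul _ _ (√(Eq2 σ r a b) * √(Eq2 σ (r + 2) a b)) fun i _ => ?_).trans (le_of_eq (by simp))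
    have e : r + 1 + σ = r + σ + 1 := by ring
    rw [e]
    refine (key (b i) (r + σ) (h.rb i)).trans ?_
    have n1 : sN2 (Wm (r + σ) * b i) ≤ √(Eq2 σ r a b) := Nb_le i
    have n2 : sN2 (Wm (r + σ + 2) * b i) ≤ √(Eq2 σ (r + 2) a b) := by
      have e : r + σ + 2 = r + 2 + σ := by ring
      rw [e]; exact Nb_le i
    have := sN2_nonneg (Wm (r + σ + 2) * b i)
    gcongr
  unfold Eq2 at *
  linarith

end

theorem decay_fourier (hd : 0 < d) {σ r : ℝ} (hσ : 0 < σ) (hσ1 : σ < 1) (hr : (d : ℝ) / 2 + 1 < r) :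
    ∃ ε : ℝ, 0 < ε ∧ ∀ (a : ℝ → Sq d) (b : ℝ → Fin d → Sq d), Sol σ a b →
      Eq2 σ (r + 1) (a 0) (b 0) < ε →
      ∃ C lam : ℝ, 0 < C ∧ 0 < lam ∧ ∀ t, 0 ≤ t → Eq2 σ (r + 1) (a t) (b t) ≤ C * Real.exp (-lam * t) := by
  have hd' : (0:ℝ) < d := by exact_mod_cast hd
  have hr0 : 0 ≤ r := by linarith
  obtain ⟨CL, hCL, hL⟩ := Lq_le (d := d) hr hσ
  have hpi := Real.pi_pos
  set K := (d * (1 + 7 * π + K1 (r + 1) + d * (5 * π + 2 * K2 σ (r + 1)))) with hKd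
  have hK : 0 ≤ K := by
    have hK2 := K2_nonneg (s := r + 1) (by linarith) hσ
    have hK1 : 0 ≤ K1 (r + 1) := by unfold K1; positivity
    positivity
  set K3 := ((3 + 2 * d) * d * Kr r) with hK3d
  have hK3 : 0 ≤ K3 := by rw [hK3d]; unfold Kr; positivity
  obtain ⟨δ, hδ, hδ1, hδ2⟩ : ∃ δ : ℝ, 0 < δ ∧ K3 * CL * δ ≤ 1 / (8 * d) ∧ CL * δ ≤ 1 / 2 := by
    have p : 0 < K3 * CL + 1 := by positivity
    refine ⟨min (1 / (8 * d) / (K3 * CL + 1)) (1 / 2 / CL), by positivity, ?_, ?_⟩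
    · calc _ ≤ (K3 * CL + 1) * (1 / (8 * d) / (K3 * CL + 1)) := by
            gcongr
            · linarith
            · exact min_le_left _ _
        _ = _ := by field_simp
    · calc _ ≤ CL * (1 / 2 / CL) := by gcongr; exact min_le_right _ _
        _ = _ := by field_simp
  obtain ⟨δ1, hδ1p, hδ1a, hδ1b⟩ : ∃ δ1 : ℝ, 0 < δ1 ∧ δ1 ≤ δ / 4 ∧
      6 * K * (2 * CL * δ1) / (1 / (20 * d)) ≤ 1 := by
    have p : 0 < 6 * K * (2 * CL) * (20 * d) + 1 := by positivity
    refine ⟨min (δ / 4) (1 / (6 * K * (2 * CL) * (20 * d) + 1)), by positivity, min_le_left _ _, ?_⟩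
    calc _ = (6 * K * (2 * CL) * (20 * d)) * min (δ / 4) (1 / (6 * K * (2 * CL) * (20 * d) + 1)) := by
            rw [div_div_eq_mul_div, div_one]; ring
      _ ≤ (6 * K * (2 * CL) * (20 * d) + 1) * (1 / (6 * K * (2 * CL) * (20 * d) + 1)) := by
            gcongr
            · linarith
            · exact min_le_right _ _
      _ = 1 := by field_simp
  refine ⟨δ1 ^ 2, by positivity, fun a b h h0 => ?_⟩
  set δ0 := √(Eq2 σ (r + 1) (a 0) (b 0)) with hδ0
  have hδ0p : 0 ≤ δ0 := Real.sqrt_nonneg _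
  have hδ0l : δ0 < δ1 := by
    rw [hδ0, Real.sqrt_lt' hδ1p]; exact h0
  have hE00 : 0 ≤ Eq2 σ (r + 1) (a 0) (b 0) := Eq2_nonneg
  have hδ0s : δ0 ^ 2 = Eq2 σ (r + 1) (a 0) (b 0) := Real.sq_sqrt hE00
  have low : ∀ T, 0 ≤ T → (∀ t ∈ Set.Ico 0 T, √(Eq2 σ (r + 1) (a t) (b t)) ≤ δ) →
      √(Eq2 σ r (a T) (b T)) ≤ 2 * δ0 * Real.exp (-(1 / (20 * d)) * T) := by
    intro T hT hE
    have h1 := low_decay hd hσ hσ1 hr0 hCL hL hδ1 hδ.le h hT hE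
    have h2 := Eq2_mono (σ := σ) (h.good le_rfl) (show r ≤ r + 1 by linarith)
    refine Real.sqrt_le_iff.mpr ⟨by positivity, ?_⟩
    have e : (2 * δ0 * Real.exp (-(1 / (20 * d)) * T)) ^ 2 =
        4 * Eq2 σ (r + 1) (a 0) (b 0) * Real.exp (-(1 / (10 * d)) * T) := by
      rw [mul_pow, mul_pow, hδ0s, ← Real.exp_nat_mul]
      congr 1
      · norm_num
      · congr 1; push_cast; field_simp; ring
    rw [e]
    refine h1.trans ?_
    gcongr
  have lowL : ∀ T, 0 ≤ T → (∀ t ∈ Set.Ico 0 T, √(Eq2 σ (r + 1) (a t) (b t)) ≤ δ) →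
      Lq (a T) (b T) ≤ 2 * CL * δ0 * Real.exp (-(1 / (20 * d)) * T) ∧ Lq (a T) (b T) ≤ 1 / 2 := by
    intro T hT hE
    have h1 : Lq (a T) (b T) ≤ 2 * CL * δ0 * Real.exp (-(1 / (20 * d)) * T) := by
      refine (hL _ _ (h.good hT)).trans ?_
      calc _ ≤ CL * (2 * δ0 * Real.exp (-(1 / (20 * d)) * T)) := by gcongr; exact low T hT hE
        _ = _ := by ring
    refine ⟨h1, h1.trans ?_⟩
    have e1 : Real.exp (-(1 / (20 * d)) * T) ≤ 1 := by
      rw [Real.exp_le_one_iff, neg_mul]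
      have : 0 ≤ 1 / (20 * (d:ℝ)) * T := by positivity
      linarith
    have e2 : 2 * CL * δ0 ≤ 1 / 2 := by nlinarith
    calc _ ≤ 1 / 2 * (1:ℝ) := by gcongr
      _ = _ := by norm_num
  have step : ∀ T, 0 ≤ T → (∀ t ∈ Set.Ico 0 T, √(Eq2 σ (r + 1) (a t) (b t)) ≤ δ) →
      √(Eq2 σ (r + 1) (a T) (b T)) < δ := by
    intro T hT hE
    have hsub : ∀ t ∈ Set.Icc 0 T, ∀ s ∈ Set.Ico 0 t, √(Eq2 σ (r + 1) (a s) (b s)) ≤ δ :=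
      fun t ht s hs => hE s ⟨hs.1, lt_of_lt_of_le hs.2 ht.2⟩
    have h1 := top_growth (s := r + 1) hσ hσ1 (by linarith) h hT (Λ := 2 * CL * δ0)
      (lam := 1 / (20 * d)) (by positivity) (by positivity)
      (fun t ht => (lowL t ht.1 (hsub t ht)).1) (fun t ht => (lowL t ht.1 (hsub t ht)).2)
    have h2 : 6 * K * (2 * CL * δ0) / (1 / (20 * d)) ≤ 1 := by
      refine le_trans ?_ hδ1b
      gcongr
    have h3 : Real.exp (6 * K * (2 * CL * δ0) / (1 / (20 * d))) ≤ 3 :=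
      (Real.exp_le_exp.mpr h2).trans (by have := Real.exp_one_lt_d9; linarith)
    rw [Real.sqrt_lt' hδ]
    calc _ ≤ 3 * Eq2 σ (r + 1) (a 0) (b 0) * 3 := h1.trans (by gcongr)
      _ = 9 * δ0 ^ 2 := by rw [hδ0s]; ring
      _ < δ ^ 2 := by nlinarith
  have all : ∀ t, 0 ≤ t → √(Eq2 σ (r + 1) (a t) (b t)) ≤ δ := by
    by_contra hcon
    push Not at hcon
    obtain ⟨t1, ht1, hb1⟩ := hcon
    set S := {t : ℝ | 0 ≤ t ∧ δ < √(Eq2 σ (r + 1) (a t) (b t))} with hS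
    have hne : S.Nonempty := ⟨t1, ht1, hb1⟩
    have hbd : BddBelow S := ⟨0, fun t ht => ht.1⟩
    have hT0 : 0 ≤ sInf S := le_csInf hne fun t ht => ht.1
    have hlt := step (sInf S) hT0 (fun t ht => by
      by_contra hc
      exact absurd (csInf_le hbd (show t ∈ S from ⟨ht.1, not_le.mp hc⟩)) (not_le.mpr ht.2))
    have hcont : ContinuousWithinAt (fun t => √(Eq2 σ (r + 1) (a t) (b t))) (Set.Ici 0) (sInf S) :=
      (h.E_cont (r := r + 1) (sInf S) hT0).sqrt
    have hev := hcont.eventually (eventually_lt_nhds hlt)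
    rw [eventually_nhdsWithin_iff, Metric.eventually_nhds_iff] at hev
    obtain ⟨η, hη, hev⟩ := hev
    obtain ⟨t2, ht2, ht2l⟩ := exists_lt_of_csInf_lt hne (show sInf S < sInf S + η by linarith)
    have hge := csInf_le hbd ht2
    have := hev (y := t2) (by rw [Real.dist_eq, abs_lt]; constructor <;> linarith) ht2.1
    exact absurd ht2.2 (not_lt.mpr this.le)
  have allI : ∀ T, 0 ≤ T → (∀ t ∈ Set.Ico 0 T, √(Eq2 σ (r + 1) (a t) (b t)) ≤ δ) :=
    fun T hT t ht => all t ht.1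
  obtain ⟨B, hB, hBt⟩ : ∃ B : ℝ, 0 ≤ B ∧ ∀ t, 0 ≤ t → Eq2 σ (r + 2) (a t) (b t) ≤ B := by
    refine ⟨_, ?_, fun T hT => top_growth (s := r + 2) hσ hσ1 (by linarith) h hT (Λ := 2 * CL * δ0)
      (lam := 1 / (20 * d)) (by positivity) (by positivity)
      (fun t ht => (lowL t ht.1 (allI t ht.1)).1) (fun t ht => (lowL t ht.1 (allI t ht.1)).2)⟩
    have : 0 ≤ Eq2 σ (r + 2) (a 0) (b 0) := Eq2_nonneg
    positivity
  refine ⟨(1 + d) * (2 * δ0 * √B) + 1, 1 / (20 * d), by positivity, by positivity, fun t ht => ?_⟩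
  refine (interp (h.good ht)).trans ?_
  have l1 := low t ht (allI t ht)
  have l2 := Real.sqrt_le_sqrt (hBt t ht)
  have he := Real.exp_pos (-(1 / (20 * d)) * t)
  calc _ ≤ (1 + d) * ((2 * δ0 * Real.exp (-(1 / (20 * d)) * t)) * √B) := by gcongr
    _ = ((1 + d) * (2 * δ0 * √B)) * Real.exp (-(1 / (20 * d)) * t) := by ring
    _ ≤ _ := by gcongr; linarith


/-! ### Fourier analysis of smooth periodic functions -/

/-- integral over the torus -/
def tI (f : Rd d → ℂ) : ℂ := ∫ x in TdFund d, f x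

def PerC (f : Rd d → ℂ) : Prop := ∀ (x : Rd d) (i : Fin d), f (x + EuclideanSpace.single i 1) = f x

/-- characters -/
def eN (n : Fin d → ℤ) (x : Rd d) : ℂ := eTheta (∑ i, (n i : ℝ) * x i)

lemma eTheta_add (s t : ℝ) : eTheta (s + t) = eTheta s * eTheta t := by
  unfold eTheta; rw [← Complex.exp_add]; congr 1; push_cast; ring

lemma norm_eTheta (t : ℝ) : ‖eTheta t‖ = 1 := by
  unfold eTheta
  have : (2 * π * Complex.I * t : ℂ) = ((2 * π * t : ℝ) : ℂ) * Complex.I := by push_cast; ring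
  rw [this, Complex.norm_exp_ofReal_mul_I]

lemma conj_eTheta (t : ℝ) : (starRingEnd ℂ) (eTheta t) = eTheta (-t) := by
  unfold eTheta
  rw [← Complex.exp_conj]; congr 1; simp [Complex.conj_ofNat]

lemma eTheta_int (k : ℤ) : eTheta k = 1 := by
  unfold eTheta
  rw [Complex.exp_eq_one_iff]
  exact ⟨k, by push_cast; ring⟩

lemma eN_add (m n : Fin d → ℤ) (x : Rd d) : eN (m + n) x = eN m x * eN n x := by
  unfold eN
  rw [← eTheta_add, ← Finset.sum_add_distrib]
  congr 1
  exact Finset.sum_congr rfl fun i _ => by simp; ring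

lemma norm_eN (n : Fin d → ℤ) (x : Rd d) : ‖eN n x‖ = 1 := norm_eTheta _

lemma conj_eN (n : Fin d → ℤ) (x : Rd d) : (starRingEnd ℂ) (eN n x) = eN (-n) x := by
  unfold eN; rw [conj_eTheta]; simp

lemma eN_zero (x : Rd d) : eN 0 x = 1 := by
  unfold eN; simp [eTheta]

lemma perC_eN (n : Fin d → ℤ) : PerC (eN n) := by
  intro x i
  unfold eN
  have : ∑ j, (n j : ℝ) * (x + EuclideanSpace.single i (1:ℝ)) j = (∑ j, (n j : ℝ) * x j) + ((n i : ℤ) : ℝ) := by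
    simp [mul_add, Finset.sum_add_distrib]
  rw [this, eTheta_add, eTheta_int, mul_one]

lemma contDiff_eN (n : Fin d → ℤ) : ContDiff ℝ (⊤ : ℕ∞) (eN n) := by
  have h1 : ContDiff ℝ (⊤ : ℕ∞) (fun x : Rd d => ∑ i, (n i : ℝ) * x i) := by fun_prop
  have h2 : ContDiff ℝ (⊤ : ℕ∞) (fun x : Rd d => ((∑ i, (n i : ℝ) * x i : ℝ) : ℂ)) :=
    Complex.ofRealCLM.contDiff.comp h1
  unfold eN eTheta
  exact (contDiff_const.mul h2).cexp

lemma fCoef_eq (f : Rd d → ℝ) (n : Fin d → ℤ) : fCoef f n = tI (fun x => (f x : ℂ) * eN (-n) x) := by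
  unfold fCoef tI eN
  simp

/-- descent to the torus -/
lemma descent {f : Rd d → ℂ} (hc : Continuous f) (hp : PerC f) :
    ∃ F : C(UnitAddTorus (Fin d), ℂ), ∀ x : Fin d → ℝ, F (fun i => (x i : UnitAddCircle)) = f (WithLp.toLp 2 x) := by
  let g : (Fin d → ℝ) → ℂ := fun x => f (WithLp.toLp 2 x)
  have hg : Continuous g := hc.comp (PiLp.continuous_toLp 2 _)
  have hq : IsOpenQuotientMap (Pi.map (fun (_ : Fin d) (x : ℝ) => (x : UnitAddCircle))) :=
    IsOpenQuotientMap.piMap fun _ => QuotientAddGroup.isOpenQuotientMap_mk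
  have hper1 : ∀ (x : Rd d) (i : Fin d) (k : ℤ), f (x + EuclideanSpace.single i (k:ℝ)) = f x := by
    intro x i k
    have hs : ∀ a b : ℝ, EuclideanSpace.single i a + EuclideanSpace.single i b =
        EuclideanSpace.single i (a + b) := fun a b => by ext j; simp; split_ifs <;> simp
    have h0 : EuclideanSpace.single i (0:ℝ) = (0 : Rd d) := by ext j; simp
    induction k using Int.induction_on with
    | zero => simp [h0]
    | succ k ih =>
      have := hp (x + EuclideanSpace.single i (k:ℝ)) i
      rw [← ih, Int.cast_natCast, ← this]; congr 1
      rw [add_assoc, hs]; simp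
    | pred k ih =>
      have := hp (x + EuclideanSpace.single i (((-k - 1 : ℤ)) : ℝ)) i
      rw [← this, ← ih]; congr 1
      rw [add_assoc, hs]; simp
  have hper2 : ∀ (s : Finset (Fin d)) (k : Fin d → ℤ) (x : Rd d),
      f (x + ∑ i ∈ s, EuclideanSpace.single i (k i : ℝ)) = f x := by
    classical
    intro s k x
    induction s using Finset.induction_on with
    | empty => simp
    | insert i s hi ih =>
      rw [Finset.sum_insert hi, add_comm (EuclideanSpace.single _ _), ← add_assoc, hper1, ih]
  have hfac : ∀ x y : Fin d → ℝ, Pi.map (fun (_ : Fin d) (x : ℝ) => (x : UnitAddCircle)) x =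
      Pi.map (fun (_ : Fin d) (x : ℝ) => (x : UnitAddCircle)) y → g x = g y := by
    intro x y hxy
    have h1 : ∀ i, ∃ k : ℤ, x i = y i + k := by
      intro i
      have h2 := congrFun hxy i
      simp only [Pi.map_apply] at h2
      rw [← sub_eq_zero, ← AddCircle.coe_sub, AddCircle.coe_eq_zero_iff] at h2
      obtain ⟨k, hk⟩ := h2
      refine ⟨k, ?_⟩
      rw [zsmul_eq_mul, mul_one] at hk
      linarith
    choose k hk using h1
    have h3 := hper2 Finset.univ k (WithLp.toLp 2 y)
    show f _ = f _
    rw [← h3]; congr 1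
    ext i
    simp [hk, Pi.single_apply]
  have hF : ∀ x, g (Function.surjInv hq.surjective (Pi.map (fun (_ : Fin d) (x : ℝ) => (x : UnitAddCircle)) x)) = g x :=
    fun x => hfac _ _ (Function.surjInv_eq hq.surjective _)
  refine ⟨⟨fun z => g (Function.surjInv hq.surjective z), ?_⟩, fun x => hF x⟩
  rw [hq.isQuotientMap.continuous_iff]
  exact hg.congr fun x => (hF x).symm

lemma mFourier_eq (n : Fin d → ℤ) (x : Fin d → ℝ) :
    UnitAddTorus.mFourier n (fun i => (x i : UnitAddCircle)) = eN n (WithLp.toLp 2 x) := by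
  simp only [UnitAddTorus.mFourier, ContinuousMap.coe_mk, fourier_coe_apply, eN, eTheta]
  rw [← Complex.exp_sum]; congr 1
  push_cast
  rw [Finset.mul_sum]
  exact Finset.sum_congr rfl fun i _ => by simp; ring

lemma tI_eq_Ioc (f : Rd d → ℂ) :
    tI f = ∫ x in {x : Fin d → ℝ | ∀ i, x i ∈ Set.Ioc (0:ℝ) (0 + 1)}, f (WithLp.toLp 2 x) := by
  have h1 := (PiLp.volume_preserving_toLp (Fin d)).setIntegral_preimage_emb
    (MeasurableEquiv.toLp 2 (Fin d → ℝ)).measurableEmbedding f (TdFund d)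
  unfold tI
  rw [← h1]
  refine setIntegral_congr_set ?_
  have e1 : WithLp.toLp 2 ⁻¹' TdFund d = Set.univ.pi (fun _ : Fin d => Set.Ico (0:ℝ) 1) := by
    ext x; simp [TdFund]
  have e2 : {x : Fin d → ℝ | ∀ i, x i ∈ Set.Ioc (0:ℝ) (0 + 1)} = Set.univ.pi (fun _ : Fin d => Set.Ioc (0:ℝ) 1) := by
    ext x; simp
  rw [e1, e2]
  exact (Measure.univ_pi_Ico_ae_eq_Icc (μ := fun _ : Fin d => volume) (f := fun _ => 0) (g := fun _ => 1)).trans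
    (Measure.univ_pi_Ioc_ae_eq_Icc (μ := fun _ : Fin d => volume) (f := fun _ => 0) (g := fun _ => 1)).symm

lemma tI_mFourierCoeff {f : Rd d → ℂ} {F : C(UnitAddTorus (Fin d), ℂ)}
    (hF : ∀ x : Fin d → ℝ, F (fun i => (x i : UnitAddCircle)) = f (WithLp.toLp 2 x)) (n : Fin d → ℤ) :
    UnitAddTorus.mFourierCoeff F n = tI (fun x => f x * eN (-n) x) := by
  rw [UnitAddTorus.mFourierCoeff_eq_integral F n (fun _ => 0), tI_eq_Ioc]
  congr 1; funext x
  rw [mFourier_eq, hF, smul_eq_mul, mul_comm]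

lemma tI_shift {f : Rd d → ℂ} (hc : Continuous f) (hp : PerC f) (v : Rd d) :
    tI (fun x => f (x + v)) = tI f := by
  obtain ⟨F, hF⟩ := descent hc hp
  have h0 := tI_mFourierCoeff hF 0
  rw [UnitAddTorus.mFourierCoeff_eq_integral F 0 v.ofLp] at h0
  simp only [neg_zero, eN_zero, mul_one] at h0
  rw [← h0, tI_eq_Ioc]
  have h1 := (measurePreserving_add_right (volume : Measure (Fin d → ℝ)) v.ofLp).setIntegral_preimage_emb
    (measurableEmbedding_addRight v.ofLp)
    (fun x => f (WithLp.toLp 2 x)) {x : Fin d → ℝ | ∀ i, x i ∈ Set.Ioc (v i) (v i + 1)}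
  have e : (fun x : Fin d → ℝ => x + v.ofLp) ⁻¹' {x : Fin d → ℝ | ∀ i, x i ∈ Set.Ioc (v i) (v i + 1)} =
      {x : Fin d → ℝ | ∀ i, x i ∈ Set.Ioc (0:ℝ) (0 + 1)} := by
    ext x
    simp only [Set.mem_preimage, Set.mem_ofPred_eq, Set.mem_Ioc, Pi.add_apply]
    refine forall_congr' fun i => ?_
    constructor <;> rintro ⟨h1, h2⟩ <;> constructor <;> linarith
  rw [e] at h1
  calc _ = _ := h1
    _ = _ := by
      congr 1; funext x
      rw [hF, mFourier_eq, eN_zero, one_smul]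

/-- Fourier inversion -/
lemma fourier_inv {f : Rd d → ℂ} (hc : Continuous f) (hp : PerC f)
    (hs : Summable (fun n => tI (fun x => f x * eN (-n) x))) (x : Rd d) :
    HasSum (fun n => tI (fun x => f x * eN (-n) x) * eN n x) (f x) := by
  obtain ⟨F, hF⟩ := descent hc hp
  have e := fun n => tI_mFourierCoeff hF n
  have hs' : Summable (UnitAddTorus.mFourierCoeff F) := by
    rw [funext e]; exact hs
  have := UnitAddTorus.hasSum_mFourier_series_apply_of_summable hs' (fun i => (x.ofLp i : UnitAddCircle))
  rw [hF] at this
  simpa only [e, mFourier_eq, smul_eq_mul] using this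



/-! ### Derivatives and Fourier coefficients -/

abbrev ej (j : Fin d) : Rd d := EuclideanSpace.single j (1:ℝ)

lemma measurableSet_TdFund : MeasurableSet (TdFund d) := by
  have : TdFund d = ⋂ i, {x : Rd d | 0 ≤ x i ∧ x i < 1} := by ext; simp [TdFund]
  rw [this]
  refine MeasurableSet.iInter fun i => ?_
  have h : Measurable (fun x : Rd d => x i) := by fun_prop
  exact (measurableSet_le measurable_const h).inter (measurableSet_lt h measurable_const)

lemma TdFund_sub : TdFund d ⊆ Metric.closedBall (0 : Rd d) (√d) := by
  intro x hx
  rw [mem_closedBall_zero_iff, EuclideanSpace.norm_eq]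
  refine Real.sqrt_le_sqrt ?_
  calc _ ≤ ∑ i : Fin d, (1:ℝ) := Finset.sum_le_sum fun i _ => by
        have := hx i
        rw [Real.norm_eq_abs, sq_abs]; nlinarith
    _ = d := by simp

lemma vol_TdFund_lt : volume (TdFund d) < ⊤ :=
  lt_of_le_of_lt (measure_mono TdFund_sub) measure_closedBall_lt_top

instance : IsFiniteMeasure ((volume : Measure (Rd d)).restrict (TdFund d)) :=
  ⟨by rw [Measure.restrict_apply_univ]; exact vol_TdFund_lt⟩

lemma vol_TdFund : tI (fun _ : Rd d => 1) = 1 := by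
  rw [tI_eq_Ioc]
  have e2 : {x : Fin d → ℝ | ∀ i, x i ∈ Set.Ioc (0:ℝ) (0 + 1)} = Set.univ.pi (fun _ : Fin d => Set.Ioc (0:ℝ) 1) := by
    ext x; simp
  rw [e2]
  simp [Measure.real, Real.volume_pi_Ioc]

lemma tI_intble {f : Rd d → ℂ} (hf : Continuous f) : IntegrableOn f (TdFund d) :=
  (hf.continuousOn.integrableOn_compact (isCompact_closedBall (0 : Rd d) (√d))).mono_set TdFund_sub

lemma tI_add {f g : Rd d → ℂ} (hf : Continuous f) (hg : Continuous g) :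
    tI (fun x => f x + g x) = tI f + tI g := integral_add (tI_intble hf) (tI_intble hg)

lemma tI_sum {ι : Type*} (s : Finset ι) {f : ι → Rd d → ℂ} (hf : ∀ i, Continuous (f i)) :
    tI (fun x => ∑ i ∈ s, f i x) = ∑ i ∈ s, tI (f i) := integral_finsetSum s fun i _ => tI_intble (hf i)

lemma tI_neg {f : Rd d → ℂ} : tI (fun x => - f x) = - tI f := integral_neg _

lemma tI_mul_left {f : Rd d → ℂ} (c : ℂ) : tI (fun x => c * f x) = c * tI f := integral_const_mul _ _

lemma tI_conj {f : Rd d → ℂ} : tI (fun x => (starRingEnd ℂ) (f x)) = (starRingEnd ℂ) (tI f) :=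
  integral_conj

lemma tI_norm_le {f : Rd d → ℂ} {C : ℝ} (h : ∀ x ∈ TdFund d, ‖f x‖ ≤ C) : ‖tI f‖ ≤ C := by
  have h1 := norm_setIntegral_le_of_norm_le_const (μ := volume) vol_TdFund_lt h
  have h2 : volume.real (TdFund d) = 1 := by
    have := vol_TdFund (d := d)
    unfold tI at this
    rw [setIntegral_const, Complex.real_smul, mul_one] at this
    exact_mod_cast this
  rw [h2, mul_one] at h1
  exact h1

/-- differentiation under the torus integral -/
lemma tI_hasDerivAt {G G' : ℝ → Rd d → ℂ} (hG : ∀ t x, HasDerivAt (fun s => G s x) (G' t x) t)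
    (hc : ∀ t, Continuous (G t)) (hc' : Continuous (fun p : ℝ × Rd d => G' p.1 p.2)) (t : ℝ) :
    HasDerivAt (fun s => tI (G s)) (tI (G' t)) t := by
  obtain ⟨C, hC⟩ := ((isCompact_Icc (a := t - 1) (b := t + 1)).prod
    (isCompact_closedBall (0 : Rd d) (√d))).exists_bound_of_continuousOn hc'.continuousOn
  refine (hasDerivAt_integral_of_dominated_loc_of_deriv_le (bound := fun _ => C)
    (Icc_mem_nhds (show t - 1 < t by linarith) (show t < t + 1 by linarith))
    (Eventually.of_forall fun s => (hc s).aestronglyMeasurable) (tI_intble (hc t))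
    (hc'.comp (Continuous.prodMk_right t)).aestronglyMeasurable ?_ (integrable_const C)
    (Eventually.of_forall fun x s _ => hG s x)).2
  refine (ae_restrict_iff' measurableSet_TdFund).mpr (Eventually.of_forall fun x hx s hs => ?_)
  exact hC (s, x) ⟨hs, TdFund_sub hx⟩

/-- the integral of a derivative vanishes -/
lemma tI_deriv {f : Rd d → ℂ} (hf : ContDiff ℝ 1 f) (hp : PerC f) (v : Rd d) :
    tI (fun x => fderiv ℝ f x v) = 0 := by
  have h := tI_hasDerivAt (G := fun s x => f (x + s • v)) (G' := fun s x => fderiv ℝ f (x + s • v) v)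
    (fun t x => by
      have h1 := (hf.differentiable (by norm_num) (x + t • v)).hasFDerivAt
      have h2 : HasDerivAt (fun s : ℝ => x + s • v) v t := by
        simpa using ((hasDerivAt_id t).smul_const v).const_add x
      exact h1.comp_hasDerivAt t h2)
    (fun t => hf.continuous.comp (by fun_prop))
    (by
      have := hf.continuous_fderiv (by norm_num)
      exact (this.comp (show Continuous fun p : ℝ × Rd d => p.2 + p.1 • v by fun_prop)).clm_apply continuous_const) 0
  have e : (fun s : ℝ => tI (fun x => f (x + s • v))) = fun _ => tI f := by
    funext s; exact tI_shift hf.continuous hp _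
  rw [e] at h
  have := h.unique (hasDerivAt_const 0 _)
  simpa using this

lemma eN_hasFDerivAt (n : Fin d → ℤ) (x : Rd d) (j : Fin d) :
    fderiv ℝ (eN n) x (ej j) = dj j n * eN n x := by
  have h1 := ((contDiff_eN n).differentiable (by simp) x).hasFDerivAt
  have h2 : HasDerivAt (fun s : ℝ => x + s • ej j) (ej j) 0 := by
    simpa using ((hasDerivAt_id (0:ℝ)).smul_const (ej j)).const_add x
  have h3 : HasDerivAt (fun s : ℝ => eN n (x + s • ej j)) (fderiv ℝ (eN n) x (ej j)) 0 := by
    have h1' : HasFDerivAt (eN n) (fderiv ℝ (eN n) x) (x + (0:ℝ) • ej j) := by simpa using h1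
    exact h1'.comp_hasDerivAt 0 h2
  have h4 : (fun s : ℝ => eN n (x + s • ej j)) = fun s : ℝ => Complex.exp (dj j n * s) * eN n x := by
    funext s
    unfold eN
    have : ∑ i, (n i : ℝ) * (x + s • ej j) i = n j * s + ∑ i, (n i : ℝ) * x i := by
      simp [mul_add, Finset.sum_add_distrib, ej]; ring
    rw [this, eTheta_add]
    congr 1
    unfold eTheta dj
    congr 1; push_cast; ring
  rw [h4] at h3
  have h5 : HasDerivAt (fun s : ℝ => Complex.exp (dj j n * s) * eN n x) (dj j n * eN n x) 0 := by
    have a1 : HasDerivAt (fun s : ℝ => dj j n * (s : ℂ)) (dj j n) 0 := by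
      have a0 : HasDerivAt (fun s : ℝ => (s : ℂ)) 1 0 := Complex.ofRealCLM.hasDerivAt (x := (0:ℝ))
      simpa using a0.const_mul (dj j n)
    simpa using a1.cexp.mul_const (eN n x)
  exact h3.unique h5

lemma fderiv_ofReal {f : Rd d → ℝ} (hf : Differentiable ℝ f) (x v : Rd d) :
    fderiv ℝ (fun x => (f x : ℂ)) x v = ((fderiv ℝ f x v : ℝ) : ℂ) := by
  have := (Complex.ofRealCLM.hasFDerivAt.comp x (hf x).hasFDerivAt).fderiv
  have e : (fun x => (f x : ℂ)) = Complex.ofRealCLM ∘ f := rfl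
  rw [e, this]; simp

/-- Fourier coefficients of derivatives -/
lemma fCoef_deriv {f : Rd d → ℝ} (hf : ContDiff ℝ 1 f) (hp : Per f) (j : Fin d) :
    fCoef (fun x => fderiv ℝ f x (ej j)) = dj j * fCoef f := by
  funext n
  have hfd := hf.differentiable (by norm_num)
  have hF : ContDiff ℝ 1 (fun x => (f x : ℂ)) := Complex.ofRealCLM.contDiff.comp hf
  have hE : ContDiff ℝ 1 (eN (d := d) (-n)) := (contDiff_eN (-n)).of_le (by exact_mod_cast le_top)
  have h := tI_deriv (f := fun x => (f x : ℂ) * eN (-n) x) (hF.mul hE)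
    (fun x i => by simp only [hp x i, perC_eN (-n) x i]) (ej j)
  have e : (fun x => fderiv ℝ (fun x => (f x : ℂ) * eN (-n) x) x (ej j)) =
      fun x => ((fderiv ℝ f x (ej j) : ℝ) : ℂ) * eN (-n) x + (-dj j n) * ((f x : ℂ) * eN (-n) x) := by
    funext x
    rw [fderiv_fun_mul (hF.differentiable (by norm_num) x) (hE.differentiable (by norm_num) x)]
    simp only [add_apply, smul_apply, smul_eq_mul]
    rw [eN_hasFDerivAt, fderiv_ofReal hfd]
    have : dj j (-n) = - dj j n := by simp [dj]
    rw [this]; ring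
  have c1 : Continuous fun x => ((fderiv ℝ f x (ej j) : ℝ) : ℂ) * eN (-n) x :=
    (Complex.continuous_ofReal.comp ((hf.continuous_fderiv (by norm_num)).clm_apply continuous_const)).mul hE.continuous
  have c2 : Continuous fun x => (-dj j n) * ((f x : ℂ) * eN (-n) x) :=
    continuous_const.mul (hF.continuous.mul hE.continuous)
  rw [e, tI_add c1 c2, tI_mul_left] at h
  rw [Pi.mul_apply, fCoef_eq, fCoef_eq]
  linear_combination h

lemma tI_eN (n : Fin d → ℤ) : tI (eN n) = if n = 0 then 1 else 0 := by
  split_ifs with h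
  · subst h
    rw [show (eN (0 : Fin d → ℤ)) = fun _ => 1 from funext eN_zero, vol_TdFund]
  · obtain ⟨j, hj⟩ := Function.ne_iff.mp h
    have h1 := tI_deriv (f := eN n) ((contDiff_eN n).of_le (by exact_mod_cast le_top)) (perC_eN n) (ej j)
    simp only [eN_hasFDerivAt, tI_mul_left] at h1
    rcases mul_eq_zero.mp h1 with h2 | h2
    · exfalso
      have hj' : n j ≠ 0 := hj
      have := Real.pi_ne_zero
      simp [dj, hj', this] at h2
    · exact h2

lemma fCoef_herm (f : Rd d → ℝ) : Herm (fCoef f) := by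
  intro n
  rw [fCoef_eq, fCoef_eq, ← tI_conj]
  congr 1; funext x
  rw [map_mul, conj_eN, Complex.conj_ofReal]



/-! ### Fourier series -/

lemma eN_cont (n : Fin d → ℤ) : Continuous (eN (d := d) n) := (contDiff_eN n).continuous

lemma fE_cont {f : Rd d → ℝ} (hf : Continuous f) (n : Fin d → ℤ) :
    Continuous (fun x => (f x : ℂ) * eN n x) := (Complex.continuous_ofReal.comp hf).mul (eN_cont _)

lemma tI_series {w : Sq d} (hw : Rapid w) {f : Rd d → ℂ} (hf : Continuous f) :
    tI (fun x => f x * ∑' k, w k * eN k x) = ∑' k, w k * tI (fun x => f x * eN k x) := by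
  have hc : ∀ k, Continuous (fun x => f x * (w k * eN k x)) := fun k =>
    hf.mul (continuous_const.mul (eN_cont k))
  have h := integral_tsum_of_summable_integral_norm (μ := volume.restrict (TdFund d))
    (F := fun (k : Fin d → ℤ) x => f x * (w k * eN k x)) (fun k => tI_intble (hc k))
    (by
      have : ∀ k : Fin d → ℤ, ∫ x in TdFund d, ‖f x * (w k * eN k x)‖ = ‖w k‖ * ∫ x in TdFund d, ‖f x‖ := by
        intro k
        rw [← integral_const_mul]
        congr 1; funext x
        rw [norm_mul, norm_mul, norm_eN]; ring
      simp only [this]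
      exact hw.summable_norm.mul_right _)
  unfold tI
  simp only [← tsum_mul_left]
  rw [← h]
  congr 1; funext k
  rw [← integral_const_mul]
  congr 1; funext x
  ring

lemma perC_of {f : Rd d → ℝ} (hp : Per f) : PerC (fun x => (f x : ℂ)) := fun x i => by
  simp only [hp x i]

lemma fCoef_inv {g : Rd d → ℝ} (hg : Continuous g) (hp : Per g) (rg : Rapid (fCoef g)) (x : Rd d) :
    (g x : ℂ) = ∑' k, fCoef g k * eN k x := by
  have e : (fun n => tI (fun x => (g x : ℂ) * eN (-n) x)) = fCoef g := by
    funext n; rw [fCoef_eq]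
  have h := fourier_inv (f := fun x => (g x : ℂ)) (Complex.continuous_ofReal.comp hg) (perC_of hp) (by
    have := rg.summable
    rw [← e] at this; exact this) x
  rw [← h.tsum_eq]
  congr 1; funext n
  rw [fCoef_eq]

lemma fCoef_mul {f g : Rd d → ℝ} (hf : Continuous f) (hg : Continuous g) (hp : Per g)
    (rg : Rapid (fCoef g)) : fCoef (fun x => f x * g x) = sconv (fCoef f) (fCoef g) := by
  funext n
  have h := tI_series rg (f := fun x => (f x : ℂ) * eN (-n) x)
    ((Complex.continuous_ofReal.comp hf).mul (eN_cont _))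
  rw [fCoef_eq]
  calc _ = tI (fun x => ((f x : ℂ) * eN (-n) x) * ∑' k, fCoef g k * eN k x) := by
        congr 1; funext x
        rw [← fCoef_inv hg hp rg]; push_cast; ring
    _ = _ := h
    _ = _ := by
        unfold sconv
        congr 1; funext k
        rw [fCoef_eq f, mul_comm]
        congr 2; funext x
        rw [show -(n - k) = -n + k by abel, eN_add]; ring

lemma fCoef_add {f g : Rd d → ℝ} (hf : Continuous f) (hg : Continuous g) :
    fCoef (fun x => f x + g x) = fCoef f + fCoef g := by
  funext n
  rw [Pi.add_apply, fCoef_eq, fCoef_eq, fCoef_eq, ← tI_add (fE_cont hf _) (fE_cont hg _)]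
  congr 1; funext x; push_cast; ring

lemma fCoef_neg {f : Rd d → ℝ} : fCoef (fun x => - f x) = - fCoef f := by
  funext n
  rw [Pi.neg_apply, fCoef_eq, fCoef_eq, ← tI_neg]
  congr 1; funext x; push_cast; ring

lemma fCoef_sub {f g : Rd d → ℝ} (hf : Continuous f) (hg : Continuous g) :
    fCoef (fun x => f x - g x) = fCoef f - fCoef g := by
  simp only [sub_eq_add_neg]
  rw [fCoef_add (g := fun x => - g x) hf hg.neg, fCoef_neg]

lemma fCoef_sum {ι : Type*} (s : Finset ι) {f : ι → Rd d → ℝ} (hf : ∀ i, Continuous (f i)) :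
    fCoef (fun x => ∑ i ∈ s, f i x) = ∑ i ∈ s, fCoef (f i) := by
  funext n
  rw [Finset.sum_apply, fCoef_eq]
  simp only [fCoef_eq]
  rw [← tI_sum s fun i => fE_cont (hf i) _]
  congr 1; funext x; push_cast; rw [Finset.sum_mul]

/-- real trigonometric series -/
def trig (c : Sq d) (x : Rd d) : ℝ := (∑' n, c n * eN n x).re

lemma trig_summable {c : Sq d} (hc : Rapid c) (x : Rd d) : Summable (fun n => c n * eN n x) := by
  refine Summable.of_norm ?_
  simp only [norm_mul, norm_eN, mul_one]
  exact hc.summable_norm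

lemma trig_real {c : Sq d} (hh : Herm c) (x : Rd d) :
    ((trig c x : ℝ) : ℂ) = ∑' n, c n * eN n x := by
  unfold trig
  rw [← Complex.conj_eq_iff_re, Complex.conj_tsum]
  rw [← (Equiv.neg (Fin d → ℤ)).tsum_eq]
  congr 1; funext n
  simp only [Equiv.neg_apply, map_mul, conj_eN, hh n, neg_neg, Complex.conj_conj]

lemma fCoef_trig {c : Sq d} (hc : Rapid c) (hh : Herm c) : fCoef (trig c) = c := by
  funext n
  rw [fCoef_eq]
  simp only [trig_real hh]
  have h := tI_series hc (f := eN (-n)) (eN_cont _)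
  calc _ = tI (fun x => eN (-n) x * ∑' k, c k * eN k x) := by congr 1; funext x; ring
    _ = ∑' k, c k * (if k = n then 1 else 0) := by
      rw [h]; congr 1; funext k
      simp only [← eN_add]
      congr 1
      rw [show (fun x : Rd d => eN (-n + k) x) = eN (-n + k) from rfl, tI_eN]
      simp only [neg_add_eq_zero, eq_comm]
    _ = c n := by simp

lemma clm_norm_le (L : Rd d →L[ℝ] ℂ) : ‖L‖ ≤ ∑ j, ‖L (ej j)‖ := by
  refine L.opNorm_le_bound (by positivity) fun v => ?_
  have hv : v = ∑ j, v j • ej j := by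
    ext i; simp [ej, Pi.single_apply]
  calc ‖L v‖ = ‖∑ j, v j • L (ej j)‖ := by
        conv_lhs => rw [hv]
        simp
    _ ≤ ∑ j, ‖v j • L (ej j)‖ := norm_sum_le _ _
    _ ≤ ∑ j, ‖L (ej j)‖ * ‖v‖ := Finset.sum_le_sum fun j _ => by
        rw [norm_smul, mul_comm]
        gcongr
        exact PiLp.norm_apply_le v j
    _ = _ := by rw [Finset.sum_mul]

lemma trig_deriv {c : Sq d} (hc : Rapid c) (x : Rd d) :
    DifferentiableAt ℝ (trig c) x ∧ ∀ j, fderiv ℝ (trig c) x (ej j) = trig (dj j * c) x := by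
  have hu : Summable (fun n => ∑ j : Fin d, ‖(dj j * c) n‖) :=
    summable_sum fun j _ => (hc.mul (polyB_dj j)).summable_norm
  have hD : ∀ n (y : Rd d), HasFDerivAt (fun y => c n * eN n y) (c n • fderiv ℝ (eN n) y) y := fun n y =>
    ((contDiff_eN n).differentiable (by simp) y).hasFDerivAt.const_mul (c n)
  have hap : ∀ n (y : Rd d) j, (c n • fderiv ℝ (eN n) y) (ej j) = (dj j * c) n * eN n y := by
    intro n y j
    rw [smul_apply, eN_hasFDerivAt, Pi.mul_apply, smul_eq_mul]; ring
  have hb : ∀ n (y : Rd d), ‖c n • fderiv ℝ (eN n) y‖ ≤ ∑ j : Fin d, ‖(dj j * c) n‖ := by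
    intro n y
    refine (clm_norm_le _).trans (Finset.sum_le_sum fun j _ => ?_)
    rw [hap, norm_mul, norm_eN, mul_one]
  have h1 := hasFDerivAt_tsum hu hD hb (trig_summable hc x) x
  have h2 : HasFDerivAt (trig c) (Complex.reCLM.comp (∑' n, c n • fderiv ℝ (eN n) x)) x :=
    Complex.reCLM.hasFDerivAt.comp x h1
  have hsum : Summable (fun n => c n • fderiv ℝ (eN n) x) := Summable.of_norm_bounded hu (fun n => hb n x)
  refine ⟨h2.differentiableAt, fun j => ?_⟩
  rw [h2.fderiv]
  unfold trig
  rw [ContinuousLinearMap.comp_apply, Complex.reCLM_apply]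
  congr 1
  have := (ContinuousLinearMap.apply ℝ ℂ (ej j)).map_tsum hsum
  simp only [ContinuousLinearMap.apply_apply, hap] at this
  exact this



/-! ### Space-time smooth functions -/

def CS (f : ℝ → Rd d → ℝ) : Prop := ContDiff ℝ (⊤ : ℕ∞) (fun p : ℝ × Rd d => f p.1 p.2)

def sd (j : Fin d) (f : ℝ → Rd d → ℝ) : ℝ → Rd d → ℝ := fun t x => fderiv ℝ (f t) x (ej j)

section
variable {f g : ℝ → Rd d → ℝ}

lemma CS.space (hf : CS f) (t : ℝ) : ContDiff ℝ (⊤ : ℕ∞) (f t) :=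
  ContDiff.comp (g := fun p : ℝ × Rd d => f p.1 p.2) (f := fun x : Rd d => (t, x)) hf
    (contDiff_const.prodMk contDiff_id)

lemma CS.cont (hf : CS f) (t : ℝ) : Continuous (f t) := (hf.space t).continuous
lemma CS.c1 (hf : CS f) (t : ℝ) : ContDiff ℝ 1 (f t) := (hf.space t).of_le (by exact_mod_cast le_top)
lemma CS.diff (hf : CS f) (t : ℝ) : Differentiable ℝ (f t) := (hf.c1 t).differentiable (by norm_num)

lemma CS.fderiv_cs (hf : CS f) (v : ℝ × Rd d) :
    ContDiff ℝ (⊤ : ℕ∞) (fun p : ℝ × Rd d => fderiv ℝ (fun p : ℝ × Rd d => f p.1 p.2) p v) :=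
  (hf.fderiv_right (m := (⊤ : ℕ∞)) (by simp)).clm_apply contDiff_const

lemma CS.hasF (hf : CS f) (p : ℝ × Rd d) : HasFDerivAt (fun p : ℝ × Rd d => f p.1 p.2)
    (fderiv ℝ (fun p : ℝ × Rd d => f p.1 p.2) p) p :=
  (ContDiff.differentiable hf (by simp) p).hasFDerivAt

lemma CS.sd_eq (hf : CS f) (j : Fin d) (t : ℝ) (x : Rd d) :
    sd j f t x = fderiv ℝ (fun p : ℝ × Rd d => f p.1 p.2) (t, x) (0, ej j) := by
  have h1 : HasFDerivAt (fun x : Rd d => (t, x)) (ContinuousLinearMap.inr ℝ ℝ (Rd d)) x :=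
    hasFDerivAt_prodMk_right t x
  have h2 := HasFDerivAt.comp (g := fun p : ℝ × Rd d => f p.1 p.2) x (hf.hasF (t, x)) h1
  have h3 : sd j f t x = fderiv ℝ ((fun p : ℝ × Rd d => f p.1 p.2) ∘ fun x => (t, x)) x (ej j) := rfl
  rw [h3, h2.fderiv]
  simp

lemma CS.sd (hf : CS f) (j : Fin d) : CS (sd j f) := by
  have e : (fun p : ℝ × Rd d => _root_.sd j f p.1 p.2) =
      fun p => fderiv ℝ (fun p : ℝ × Rd d => f p.1 p.2) p (0, ej j) := funext fun p => hf.sd_eq j p.1 p.2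
  unfold CS
  rw [e]
  exact hf.fderiv_cs (0, ej j)

lemma CS.time (hf : CS f) (t : ℝ) (x : Rd d) : HasDerivAt (fun s => f s x)
    (fderiv ℝ (fun p : ℝ × Rd d => f p.1 p.2) (t, x) (1, 0)) t := by
  have h1 : HasDerivAt (fun s : ℝ => (s, x)) ((1 : ℝ), (0 : Rd d)) t :=
    (hasDerivAt_id t).prodMk (hasDerivAt_const t x)
  exact HasFDerivAt.comp_hasDerivAt (l := fun p : ℝ × Rd d => f p.1 p.2) t (hf.hasF (t, x)) h1

lemma CS.td_cont (hf : CS f) : Continuous (fun p : ℝ × Rd d => deriv (fun s => f s p.2) p.1) := by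
  refine (hf.fderiv_cs (1, 0)).continuous.congr fun p => ?_
  rw [(hf.time p.1 p.2).deriv]

lemma CS.fCoef_deriv (hf : CS f) (t : ℝ) (n : Fin d → ℤ) :
    HasDerivAt (fun s => fCoef (f s) n) (fCoef (fun x => deriv (fun s => f s x) t) n) t := by
  simp only [fCoef_eq]
  exact tI_hasDerivAt (G := fun s x => (f s x : ℂ) * eN (-n) x)
    (G' := fun t x => ((deriv (fun s => f s x) t : ℝ) : ℂ) * eN (-n) x)
    (fun t x => by
      have h := (hf.time t x).ofReal_comp.mul_const (eN (-n) x)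
      rw [(hf.time t x).deriv]
      exact h)
    (fun t => fE_cont (hf.cont t) _)
    ((Complex.continuous_ofReal.comp hf.td_cont).mul ((eN_cont _).comp continuous_snd)) t

lemma per_sd {t : ℝ} (hf : Per (f t)) (j : Fin d) : Per (sd j f t) := by
  intro x i
  have h : (fun y => f t (y + EuclideanSpace.single i 1)) = f t := funext fun y => hf y i
  unfold sd
  have h2 := fderiv_comp_add_right (𝕜 := ℝ) (f := f t) (x := x) (EuclideanSpace.single i (1:ℝ))
  rw [h] at h2
  rw [h2]

lemma Jw_le_one_add (n : Fin d → ℤ) : Jw n ≤ 1 + ∑ j, |(n j : ℝ)| := by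
  have h0 : 0 ≤ ∑ j, |(n j : ℝ)| := by positivity
  refine max_le (by linarith) ?_
  have : zNorm n ≤ ∑ j, |(n j : ℝ)| := by
    refine Real.sqrt_le_iff.mpr ⟨h0, ?_⟩
    calc ∑ j, (n j : ℝ) ^ 2 = ∑ j, |(n j : ℝ)| ^ 2 := by simp
      _ ≤ _ := Finset.sum_sq_le_sq_sum_of_nonneg fun i _ => abs_nonneg _
  linarith

lemma CS.decay (K : ℕ) : ∀ {f : ℝ → Rd d → ℝ}, CS f → (∀ t, 0 ≤ t → Per (f t)) → ∀ T : ℝ,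
    ∃ C : ℝ, ∀ t ∈ Set.Icc 0 T, ∀ n, Jw n ^ K * ‖fCoef (f t) n‖ ≤ C := by
  induction K with
  | zero =>
    intro f hf hp T
    obtain ⟨C, hC⟩ := ((isCompact_Icc (a := 0) (b := T)).prod
      (isCompact_closedBall (0 : Rd d) (√d))).exists_bound_of_continuousOn (ContDiff.continuous hf).continuousOn
    refine ⟨C, fun t ht n => ?_⟩
    rw [pow_zero, one_mul, fCoef_eq]
    refine tI_norm_le fun x hx => ?_
    rw [norm_mul, norm_eN, mul_one, Complex.norm_real]
    exact hC (t, x) ⟨ht, TdFund_sub hx⟩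
  | succ K ih =>
    intro f hf hp T
    obtain ⟨C, hC⟩ := ih hf hp T
    choose D hD using fun j : Fin d => ih (hf.sd j) (fun t ht => per_sd (hp t ht) j) T
    refine ⟨C + ∑ j, D j, fun t ht n => ?_⟩
    have h1 : ∀ j, Jw n ^ K * (|(n j : ℝ)| * ‖fCoef (f t) n‖) ≤ D j := by
      intro j
      refine le_trans ?_ (hD j t ht n)
      have hJ := Jw_pos n
      gcongr
      have e : fCoef (_root_.sd j f t) n = dj j n * fCoef (f t) n := by
        have := _root_.fCoef_deriv (hf.c1 t) (hp t ht.1) j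
        exact congrFun this n
      rw [e, norm_mul]
      gcongr
      have : ‖dj j n‖ = 2 * π * |(n j : ℝ)| := by
        simp [dj, abs_of_pos Real.pi_pos]
      rw [this]
      have := Real.pi_gt_three
      nlinarith [abs_nonneg (n j : ℝ)]
    calc Jw n ^ (K + 1) * ‖fCoef (f t) n‖ = Jw n ^ K * (Jw n * ‖fCoef (f t) n‖) := by ring
      _ ≤ Jw n ^ K * ((1 + ∑ j, |(n j : ℝ)|) * ‖fCoef (f t) n‖) := by
          have hJ := Jw_pos n
          gcongr
          exact Jw_le_one_add n
      _ = Jw n ^ K * ‖fCoef (f t) n‖ + ∑ j, Jw n ^ K * (|(n j : ℝ)| * ‖fCoef (f t) n‖) := by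
          rw [← Finset.mul_sum, ← Finset.sum_mul]; ring
      _ ≤ _ := add_le_add (hC t ht n) (Finset.sum_le_sum fun j _ => h1 j)

lemma CS.lrapid (hf : CS f) (hp : ∀ t, 0 ≤ t → Per (f t)) : LRapid (fun t => fCoef (f t)) := by
  intro T
  rcases lt_or_ge T 0 with hT | hT
  · exact ⟨0, rapid_zero, fun t ht => by linarith [ht.1, ht.2]⟩
  have hdec := fun K => CS.decay K hf hp T
  have hbd : ∀ n, BddAbove ((fun t => ‖fCoef (f t) n‖) '' Set.Icc 0 T) := by
    obtain ⟨C, hC⟩ := hdec 0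
    rintro n
    refine ⟨C, ?_⟩
    rintro _ ⟨t, ht, rfl⟩
    simpa using hC t ht n
  have hne : ∀ n, ((fun t => ‖fCoef (f t) n‖) '' Set.Icc 0 T).Nonempty := fun n =>
    ⟨_, 0, ⟨le_rfl, hT⟩, rfl⟩
  have h0 : ∀ n, 0 ≤ sSup ((fun t => ‖fCoef (f t) n‖) '' Set.Icc 0 T) := fun n =>
    Real.sSup_nonneg (by rintro _ ⟨t, ht, rfl⟩; exact norm_nonneg _)
  refine ⟨fun n => ((sSup ((fun t => ‖fCoef (f t) n‖) '' Set.Icc 0 T) : ℝ) : ℂ), fun K => ?_, fun t ht n => ?_⟩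
  · obtain ⟨C, hC⟩ := hdec K
    refine ⟨C, fun n => ?_⟩
    rw [Complex.norm_real, Real.norm_of_nonneg (h0 n)]
    have hJ : 0 < Jw n ^ K := pow_pos (Jw_pos n) K
    have : sSup ((fun t => ‖fCoef (f t) n‖) '' Set.Icc 0 T) ≤ C / Jw n ^ K := by
      refine csSup_le (hne n) ?_
      rintro _ ⟨t, ht, rfl⟩
      rw [le_div_iff₀ hJ, mul_comm]
      exact hC t ht n
    rw [le_div_iff₀ hJ] at this
    linarith
  · rw [Complex.norm_real, Real.norm_of_nonneg (h0 n)]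
    exact le_csSup (hbd n) ⟨t, ht, rfl⟩

lemma CS.smth (hf : CS f) (hp : ∀ t, 0 ≤ t → Per (f t)) {f' : ℝ → Sq d} (hf' : LRapid f')
    (he : ∀ t, 0 < t → fCoef (fun x => deriv (fun s => f s x) t) = f' t) :
    Smth (fun t => fCoef (f t)) f' where
  l := hf.lrapid hp
  l' := hf'
  hd t ht n := by rw [← he t ht]; exact hf.fCoef_deriv t n
  hc n := fun t _ => (hf.fCoef_deriv t n).continuousAt.continuousWithinAt

end



/-! ### From the PDE to the Fourier side -/

lemma grad_apply {f : Rd d → ℝ} (x : Rd d) (i : Fin d) : grad f x i = fderiv ℝ f x (ej i) := by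
  have h1 : grad f x i = inner ℝ (grad f x) (ej i) := by
    simp [ej, EuclideanSpace.inner_single_right]
  rw [h1]
  unfold grad gradient
  rw [InnerProductSpace.toDual_symm_apply]

def zW (s : ℝ) : Sq d := fun n => ((zNorm n ^ s : ℝ) : ℂ)

lemma zNorm_rpow_le {s : ℝ} (hs : s < 0) (n : Fin d → ℤ) : zNorm n ^ s ≤ 1 := by
  rcases eq_or_ne n 0 with rfl | hn
  · rw [zNorm_zero, Real.zero_rpow hs.ne]; norm_num
  · exact Real.rpow_le_one_of_one_le_of_nonpos (one_le_zNorm hn) hs.le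

lemma polyB_zW {s : ℝ} (hs : s < 0) : PolyB (zW s : Sq d) :=
  ⟨0, 1, zero_le_one, fun n => by
    simp only [zW, Complex.norm_real, pow_zero, mul_one]
    rw [Real.norm_of_nonneg (Real.rpow_nonneg (zNorm_nonneg n) s)]
    exact zNorm_rpow_le hs n⟩

lemma dj_zW (s : ℝ) (j : Fin d) (a : Sq d) : dj j * (zW s * a) = dj j * (Wm s * a) := by
  funext n
  rcases eq_or_ne n 0 with rfl | hn
  · simp [dj]
  · simp [zW, Wm, Jw_eq hn]

lemma tFracLap_eq (s : ℝ) (f : Rd d → ℝ) : tFracLap s f = trig (zW s * fCoef f) := by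
  funext x
  unfold tFracLap trig
  congr 2; funext n
  rw [Complex.real_smul, Pi.mul_apply, mul_assoc]
  rfl

lemma fCoef_grad {s : ℝ} (hs : s < 0) {f : Rd d → ℝ} (hf : Rapid (fCoef f)) (i : Fin d) :
    (Continuous fun x => grad (tFracLap s f) x i) →
    fCoef (fun x => grad (tFracLap s f) x i) = dj i * (Wm s * fCoef f) := by
  intro _
  have r1 : Rapid (zW s * fCoef f) := hf.mul (polyB_zW hs)
  have e : (fun x => grad (tFracLap s f) x i) = trig (dj i * (zW s * fCoef f)) := by
    funext x
    rw [grad_apply, tFracLap_eq, (trig_deriv r1 x).2]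
  rw [e, fCoef_trig (r1.mul (polyB_dj i)), dj_zW]
  intro n
  have h1 : dj i (-n) = (starRingEnd ℂ) (dj i n) := by simp [dj, Complex.conj_ofNat]
  have h2 : zW s (-n) = (starRingEnd ℂ) ((zW s : Sq d) n) := by simp [zW, zNorm_neg]
  simp only [Pi.mul_apply, map_mul, h1, h2, fCoef_herm f n]

section
variable {α m : ℝ} {h : ℝ → Rd d → ℝ} {u : ℝ → Rd d → Rd d}

def Uc (u : ℝ → Rd d → Rd d) (i : Fin d) : ℝ → Rd d → ℝ := fun t x => u t x i

lemma sol_of_classical (hα2 : α < d) (hs : tIsClassicalSol α m h u (Set.Ici 0))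
    (h0 : (∫ x in TdFund d, h 0 x) = 0) :
    Sol (((d : ℝ) - α) / 2) (fun t => fCoef (h t)) (fun t i => fCoef (fun x => u t x i)) := by
  obtain ⟨⟨hper, hpde⟩, -, hsm, hsu⟩ := hs
  have ch : CS h := hsm
  have cu : ∀ i, CS (Uc u i) := fun i =>
    (EuclideanSpace.proj (𝕜 := ℝ) i).contDiff.comp hsu
  have ph : ∀ t, 0 ≤ t → Per (h t) := fun t ht => (hper t ht).1
  have pu : ∀ i t, 0 ≤ t → Per (Uc u i t) := fun i t ht x j => by
    simp only [Uc, (hper t ht).2 x j]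
  have la := ch.lrapid ph
  have lb := fun i => (cu i).lrapid (pu i)
  have chu : ∀ i, CS (fun t x => h t x * Uc u i t x) := fun i => ContDiff.mul ch (cu i)
  have phu : ∀ i t, 0 ≤ t → Per (fun x => h t x * Uc u i t x) := fun i t ht x j => by
    simp only [ph t ht x j, pu i t ht x j]
  have lFa : LRapid (fun t => Fa (fCoef (h t)) (fun i => fCoef (Uc u i t))) := by
    unfold Fa
    exact (lrapid_sum _ fun j => (((lb j).add (la.conv (lb j))).mul (polyB_dj j))).neg
  have lFb : ∀ i, LRapid (fun t => Fb (((d : ℝ) - α) / 2) (fCoef (h t)) (fun i => fCoef (Uc u i t)) i) := by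
    intro i
    unfold Fb
    exact ((lb i).neg.sub ((la.mul (polyB_Wm _)).mul (polyB_dj i))).sub
      (lrapid_sum _ fun j => (lb j).conv ((lb i).mul (polyB_dj j)))
  have eA : ∀ t, 0 ≤ t → fCoef (fun x => deriv (fun s => h s x) t) =
      Fa (fCoef (h t)) (fun i => fCoef (Uc u i t)) := by
    intro t ht
    have e1 : (fun x => deriv (fun s => h s x) t) = fun x => -(∑ i, (sd i (Uc u i) t x +
        sd i (fun t x => h t x * Uc u i t x) t x)) := by
      funext x
      have := (hpde t ht x).1
      have e2 : dvg (fun y => h t y • u t y) x = ∑ i, sd i (fun t x => h t x * Uc u i t x) t x := rfl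
      have e3 : dvg (u t) x = ∑ i, sd i (Uc u i) t x := rfl
      rw [e2, e3] at this
      rw [Finset.sum_add_distrib]
      linarith
    rw [e1, fCoef_neg, fCoef_sum Finset.univ
      (f := fun i x => sd i (Uc u i) t x + sd i (fun t x => h t x * Uc u i t x) t x)
      (fun i => (((cu i).sd i).cont t).add (((chu i).sd i).cont t))]
    unfold Fa
    congr 1
    refine Finset.sum_congr rfl fun i _ => ?_
    rw [fCoef_add (((cu i).sd i).cont t) (((chu i).sd i).cont t), mul_add]
    have f1 := fCoef_deriv ((cu i).c1 t) (pu i t ht) i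
    have f2 := fCoef_deriv ((chu i).c1 t) (phu i t ht) i
    rw [fCoef_mul (ch.cont t) ((cu i).cont t) (pu i t ht) ((lb i).rapid ht)] at f2
    exact congrArg₂ (· + ·) f1 f2
  have eB : ∀ i t, 0 < t → fCoef (fun x => deriv (fun s => Uc u i s x) t) =
      Fb (((d : ℝ) - α) / 2) (fCoef (h t)) (fun i => fCoef (Uc u i t)) i := by
    intro i t ht
    have hder : ∀ x, (deriv (fun s => u s x) t) i = deriv (fun s => Uc u i s x) t := by
      intro x
      have hd1 : DifferentiableAt ℝ (fun s => u s x) t :=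
        (hsu.comp (contDiff_id.prodMk contDiff_const : ContDiff ℝ (⊤ : ℕ∞) fun s : ℝ => (s, x))).differentiable
          (by simp) t
      exact (((EuclideanSpace.proj (𝕜 := ℝ) i).hasFDerivAt.comp_hasDerivAt t hd1.hasDerivAt).deriv).symm
    have hconv : ∀ x, (fderiv ℝ (u t) x (u t x)) i = ∑ j, Uc u j t x * sd j (Uc u i) t x := by
      intro x
      have hd1 : DifferentiableAt ℝ (u t) x :=
        (hsu.comp (contDiff_const.prodMk contDiff_id : ContDiff ℝ (⊤ : ℕ∞) fun x : Rd d => (t, x))).differentiable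
          (by simp) x
      have h1 := ((EuclideanSpace.proj (𝕜 := ℝ) i).hasFDerivAt.comp x hd1.hasFDerivAt).fderiv
      have h2 : (fderiv ℝ (u t) x (u t x)) i = fderiv ℝ (Uc u i t) x (u t x) := by
        have : Uc u i t = (EuclideanSpace.proj (𝕜 := ℝ) i) ∘ u t := rfl
        rw [this, h1]; rfl
      have hv : u t x = ∑ j, (u t x) j • ej j := by
        ext i; simp [ej, Pi.single_apply]
      rw [h2]
      conv_lhs => rw [hv]
      simp [Uc, sd]
    have hgr : ∀ x, grad (tFracLap (α - d) (h t)) x i =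
        -(Uc u i t x) - deriv (fun s => Uc u i s x) t - ∑ j, Uc u j t x * sd j (Uc u i) t x := by
      intro x
      have h1 := (hpde t ht.le x).2
      have h2 : (deriv (fun s => u s x) t) i + (fderiv ℝ (u t) x (u t x)) i = - (u t x i) -
          grad (tFracLap (α - d) (h t)) x i := by
        have := congrArg (fun v : Rd d => v i) h1
        simpa using this
      rw [hder, hconv] at h2
      simp only [Uc] at h2 ⊢
      linarith
    have cd : Continuous fun x => deriv (fun s => Uc u i s x) t :=
      (cu i).td_cont.comp (Continuous.prodMk_right t)
    have cs : ∀ j, Continuous fun x => Uc u j t x * sd j (Uc u i) t x := fun j =>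
      ((cu j).cont t).mul (((cu i).sd j).cont t)
    have csum : Continuous fun x => ∑ j, Uc u j t x * sd j (Uc u i) t x :=
      continuous_finsetSum _ fun j _ => cs j
    have cg : Continuous fun x => grad (tFracLap (α - d) (h t)) x i := by
      simp only [hgr]
      exact ((((cu i).cont t).neg).sub cd).sub csum
    have fg := fCoef_grad (s := α - d) (by linarith) (la.rapid ht.le) i cg
    have e1 : (fun x => deriv (fun s => Uc u i s x) t) = fun x => (-(Uc u i t x) -
        grad (tFracLap (α - d) (h t)) x i) - ∑ j, Uc u j t x * sd j (Uc u i) t x := by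
      funext x; rw [hgr]; ring
    rw [e1, fCoef_sub (f := fun x => -(Uc u i t x) - grad (tFracLap (α - d) (h t)) x i)
      (((cu i).cont t).neg.sub cg) csum, fCoef_sub (f := fun x => -(Uc u i t x)) ((cu i).cont t).neg cg,
      fCoef_neg, fg, fCoef_sum _ cs]
    unfold Fb
    have es : -2 * (((d : ℝ) - α) / 2) = α - d := by ring
    rw [es]
    congr 1
    refine Finset.sum_congr rfl fun j _ => ?_
    have f1 := fCoef_deriv ((cu i).c1 t) (pu i t ht.le) j
    rw [fCoef_mul ((cu j).cont t) (((cu i).sd j).cont t) (per_sd (pu i t ht.le) j)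
      ((((cu i).sd j).lrapid fun t ht => per_sd (pu i t ht) j).rapid ht.le)]
    exact congrArg _ f1
  have sA := ch.smth ph lFa fun t ht => eA t ht.le
  refine ⟨sA, fun i => (cu i).smth (pu i) (lFb i) (eB i), fun t _ => fCoef_herm _,
    fun t _ i => fCoef_herm _, ?_⟩
  intro t ht
  have hz : fCoef (h 0) 0 = 0 := by
    rw [fCoef_eq]
    simp only [neg_zero, eN_zero, mul_one]
    unfold tI
    rw [integral_complex_ofReal, h0]; simp
  have hder0 : ∀ s, 0 ≤ s → HasDerivAt (fun t => fCoef (h t) 0) 0 s := by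
    intro s hs
    refine (ch.fCoef_deriv s 0).congr_deriv ?_
    rw [eA s hs]
    simp [Fa, dj]
  show fCoef (h t) 0 = 0
  rw [← hz]
  refine constant_of_has_deriv_right_zero (f := fun t => fCoef (h t) 0) (a := 0) (b := t)
    ((sA.hc 0).mono Set.Icc_subset_Ici_self) ?_ t ⟨ht, le_rfl⟩
  intro s hs
  exact (hder0 s hs.1).hasDerivWithinAt

end


/-! ### Link with the Sobolev norms of the statement -/

lemma norm_Wm_mul_sq (s : ℝ) (f : Sq d) (n : Fin d → ℤ) :
    ‖(Wm s * f : Sq d) n‖ ^ 2 = (Jw n ^ 2) ^ s * ‖f n‖ ^ 2 := by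
  rw [Pi.mul_apply, norm_mul, norm_Wm, mul_pow, ← Real.rpow_natCast (Jw n ^ s), ← Real.rpow_natCast (Jw n),
    ← Real.rpow_mul (Jw_pos n).le, ← Real.rpow_mul (Jw_pos n).le, mul_comm s]

lemma Jw_sq_le (n : Fin d → ℤ) : Jw n ^ 2 ≤ 1 + zNorm n ^ 2 := by
  have := zNorm_nonneg n
  unfold Jw
  rcases max_cases 1 (zNorm n) with h | h <;> rw [h.1] <;> nlinarith

lemma le_Jw_sq (n : Fin d → ℤ) : 1 + zNorm n ^ 2 ≤ 2 * Jw n ^ 2 := by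
  have h0 := zNorm_nonneg n
  have h1 := one_le_Jw n
  have h2 := zNorm_le_Jw n
  nlinarith

lemma sob_term_le {s : ℝ} (hs : 0 ≤ s) (f : Sq d) (n : Fin d → ℤ) :
    (1 + zNorm n ^ 2) ^ s * ‖f n‖ ^ 2 ≤ 2 ^ s * ‖(Wm s * f : Sq d) n‖ ^ 2 := by
  rw [norm_Wm_mul_sq, ← mul_assoc, ← Real.mul_rpow (by norm_num) (by positivity)]
  gcongr
  exact le_Jw_sq n

lemma sob_le_term {s : ℝ} (hs : 0 ≤ s) (f : Sq d) (n : Fin d → ℤ) :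
    ‖(Wm s * f : Sq d) n‖ ^ 2 ≤ (1 + zNorm n ^ 2) ^ s * ‖f n‖ ^ 2 := by
  rw [norm_Wm_mul_sq]
  gcongr
  exact Jw_sq_le n

lemma sob_summable {s : ℝ} (hs : 0 ≤ s) {f : Sq d} (hf : Rapid f) :
    Summable fun n => (1 + zNorm n ^ 2) ^ s * ‖f n‖ ^ 2 :=
  Summable.of_nonneg_of_le (fun n => by positivity) (sob_term_le hs f)
    ((hf.mul (polyB_Wm s)).summable_sq.mul_left _)

lemma tSobSq_le {s : ℝ} (hs : 0 ≤ s) {f : Rd d → ℝ} (hf : Rapid (fCoef f)) :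
    tSobSq s f ≤ 2 ^ s * sN2 (Wm s * fCoef f) ^ 2 := by
  rw [sN2_sq, ← tsum_mul_left]
  exact (sob_summable hs hf).tsum_le_tsum (sob_term_le hs _)
    ((hf.mul (polyB_Wm s)).summable_sq.mul_left _)

lemma le_tSobSq {s : ℝ} (hs : 0 ≤ s) {f : Rd d → ℝ} (hf : Rapid (fCoef f)) :
    sN2 (Wm s * fCoef f) ^ 2 ≤ tSobSq s f := by
  rw [sN2_sq]
  exact (hf.mul (polyB_Wm s)).summable_sq.tsum_le_tsum (sob_le_term hs _) (sob_summable hs hf)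

lemma tHSobSq_nonneg (s : ℝ) (f : Rd d → ℝ) : 0 ≤ tHSobSq s f :=
  tsum_nonneg fun n => mul_nonneg (Real.rpow_nonneg (zNorm_nonneg n) _) (by positivity)

lemma tHSobSq_le {s σ : ℝ} (hs : 0 ≤ s) (hσ : 0 < σ) {f : Rd d → ℝ} (hf : Rapid (fCoef f)) :
    tHSobSq (-σ) f ≤ sN2 (Wm s * fCoef f) ^ 2 := by
  rw [sN2_sq]
  have key : ∀ n : Fin d → ℤ, zNorm n ^ (2 * -σ) * ‖fCoef f n‖ ^ 2 ≤ ‖(Wm s * fCoef f : Sq d) n‖ ^ 2 := by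
    intro n
    rw [norm_Wm_mul_sq]
    gcongr
    exact (zNorm_rpow_le (by linarith) n).trans
      (Real.one_le_rpow (one_le_pow₀ (one_le_Jw n)) hs)
  have sm := (hf.mul (polyB_Wm s)).summable_sq
  exact (Summable.of_nonneg_of_le (fun n => mul_nonneg (Real.rpow_nonneg (zNorm_nonneg n) _)
    (by positivity)) key sm).tsum_le_tsum key sm

lemma Eq2_le_tXnormSq {α m : ℝ} (hα : α < d) (hm : 0 ≤ m) {h : Rd d → ℝ} {u : Rd d → Rd d}
    (hh : Rapid (fCoef h)) (hu : ∀ i, Rapid (fCoef fun x => u x i)) :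
    Eq2 (((d : ℝ) - α) / 2) m (fCoef h) (fun i => fCoef fun x => u x i) ≤ tXnormSq α m h u := by
  unfold Eq2 tXnormSq
  have h1 := le_tSobSq hm hh
  have h2 := Finset.sum_le_sum fun i (_ : i ∈ Finset.univ) =>
    le_tSobSq (s := m + ((d : ℝ) - α) / 2) (by linarith) (hu i)
  have h3 := tHSobSq_nonneg (-(((d : ℝ) - α) / 2)) h
  linarith

lemma tXnormSq_le_Eq2 {α m : ℝ} (hα : α < d) (hm : 0 ≤ m) {h : Rd d → ℝ} {u : Rd d → Rd d}
    (hh : Rapid (fCoef h)) (hu : ∀ i, Rapid (fCoef fun x => u x i)) :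
    tXnormSq α m h u ≤ (2 ^ (m + ((d : ℝ) - α) / 2) + 1) *
      Eq2 (((d : ℝ) - α) / 2) m (fCoef h) (fun i => fCoef fun x => u x i) := by
  unfold Eq2 tXnormSq
  have h1 := tSobSq_le hm hh
  have h2 := Finset.sum_le_sum fun i (_ : i ∈ Finset.univ) =>
    tSobSq_le (s := m + ((d : ℝ) - α) / 2) (by linarith) (hu i)
  rw [← Finset.mul_sum] at h2
  have h3 := tHSobSq_le (σ := ((d : ℝ) - α) / 2) hm (by linarith) hh
  have h4 : (2 : ℝ) ^ m ≤ 2 ^ (m + ((d : ℝ) - α) / 2) :=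
    Real.rpow_le_rpow_of_exponent_le (by norm_num) (by linarith)
  have h5 := mul_le_mul_of_nonneg_right h4 (sq_nonneg (sN2 (Wm m * fCoef h)))
  have h6 : 0 ≤ ∑ i, sN2 (Wm (m + ((d : ℝ) - α) / 2) * fCoef fun x => u x i) ^ 2 :=
    Finset.sum_nonneg fun i _ => sq_nonneg _
  linarith

/-- Exponential decay of the global small-data solution on the torus `𝕋^d`. -/
theorem exponential_decay_torus
    (d : ℕ) (hd : 2 ≤ d) (α : ℝ)
    (hα1 : max ((d : ℝ) - 2) 0 < α) (hα2 : α < d)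
    (m : ℕ) (hm : (d : ℝ) / 2 + 2 < m) :
    ∃ ε₁ : ℝ, 0 < ε₁ ∧
      ∀ (h : ℝ → Rd d → ℝ) (u : ℝ → Rd d → Rd d),
        tIsClassicalSol α (m : ℝ) h u (Set.Ici 0) →
        (∃ c : ℝ, -1 < c ∧ ∀ x, c ≤ h 0 x) →
        (∫ x in TdFund d, h 0 x) = 0 →
        tXnorm α (m : ℝ) (h 0) (u 0) < ε₁ →
        ∃ C lam : ℝ, 0 < C ∧ 0 < lam ∧ ∀ t : ℝ, 0 ≤ t →
          tXnorm α (m : ℝ) (h t) (u t) ≤ C * Real.exp (-lam * t) := by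
  have hα3 : (d : ℝ) - 2 < α := (le_max_left _ _).trans_lt hα1
  have hm0 : (0 : ℝ) ≤ m := Nat.cast_nonneg m
  obtain ⟨ε, hε, H⟩ := decay_fourier (d := d) (σ := ((d : ℝ) - α) / 2) (r := (m : ℝ) - 1)
    (by omega) (by linarith) (by linarith) (by linarith)
  rw [sub_add_cancel] at H
  refine ⟨√ε, Real.sqrt_pos.mpr hε, fun h u hs _ h0 hsmall => ?_⟩
  have S := sol_of_classical hα2 hs h0
  have G := fun t (ht : 0 ≤ t) => S.good ht
  have ra : ∀ t, 0 ≤ t → Rapid (fCoef (h t)) := fun t ht => S.sa.l.rapid ht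
  have rb : ∀ t, 0 ≤ t → ∀ i, Rapid (fCoef fun x => u t x i) := fun t ht i => (S.sb i).l.rapid ht
  have hX : tXnormSq α (m : ℝ) (h 0) (u 0) < ε := by
    unfold tXnorm at hsmall
    exact (Real.sqrt_lt_sqrt_iff_of_pos hε).mp hsmall
  obtain ⟨C, lam, hC, hlam, hdec⟩ := H _ _ S
    ((Eq2_le_tXnormSq hα2 hm0 (ra 0 le_rfl) (rb 0 le_rfl)).trans_lt hX)
  have hK : (0 : ℝ) < 2 ^ ((m : ℝ) + ((d : ℝ) - α) / 2) + 1 := by positivity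
  refine ⟨√((2 ^ ((m : ℝ) + ((d : ℝ) - α) / 2) + 1) * C), lam / 2,
    Real.sqrt_pos.mpr (mul_pos hK hC), by linarith, fun t ht => ?_⟩
  unfold tXnorm
  rw [Real.sqrt_le_left (by positivity), mul_pow, Real.sq_sqrt (mul_pos hK hC).le,
    ← Real.exp_nat_mul]
  refine (tXnormSq_le_Eq2 hα2 hm0 (ra t ht) (rb t ht)).trans ?_
  refine (mul_le_mul_of_nonneg_left (hdec t ht) hK.le).trans (le_of_eq ?_)
  rw [← mul_assoc]
  congr 2
  push_cast
  ring
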